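/- Let K4 be the complete graph on 4 vertices, fix an edge e0 of K4 with endpoints u, v, and let F = K4 − e0 with marked vertices u, v (the two-loop propagator graph: |E| = 5, loop number h = 2). Let ψ, φ be its Kirchhoff and second Symanzik polynomials. Then for all naturals k, k1, ..., k5, the coefficient integral ∫_{(0,∞)^4} (ψφ)^{-1} · ln^k(ψ^3/φ^2) · Π_{i=1}^5 ln^{k_i}(α_{e_i} ψ/φ) dα_{e_1}...dα_{e_4}, evaluated at α_{e_5} = 1, is absolutely convergent and its value is a rational linear combination of 1 and multiple zeta values. -/

import Mathlib

open MeasureTheory SimpleGraph Finset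

noncomputable section

open Classical in
/-- The Kirchhoff (first Symanzik) polynomial, as a real-valued function, of the
graph whose edges are listed by `ed : Fin m → Sym2 V`: the sum over all (index
sets of) spanning trees `S` of the product of the variables `x i` over `i ∉ S`. -/
def psiI {V : Type} [Fintype V] [DecidableEq V] {m : ℕ}
    (ed : Fin m → Sym2 V) (x : Fin m → ℝ) : ℝ :=
  ∑ S : Finset (Fin m),
    if (SimpleGraph.fromEdgeSet (↑(S.image ed) : Set (Sym2 V))).IsTree then
      ∏ i ∈ Sᶜ, x i
    else 0

open Classical in
/-- The second Symanzik polynomial with marked vertices `u`, `v`, as a real-valued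
function: the sum over all (index sets of) spanning 2-forests (acyclic spanning
subgraphs with exactly two connected components) separating `u` from `v`, of the
product of the variables `x i` over the complementary indices. -/
def phiI {V : Type} [Fintype V] [DecidableEq V] {m : ℕ}
    (ed : Fin m → Sym2 V) (u v : V) (x : Fin m → ℝ) : ℝ :=
  ∑ S : Finset (Fin m),
    if ((SimpleGraph.fromEdgeSet (↑(S.image ed) : Set (Sym2 V))).IsAcyclic ∧
        Nat.card (SimpleGraph.fromEdgeSet (↑(S.image ed) : Set (Sym2 V))).ConnectedComponent = 2 ∧
        ¬ (SimpleGraph.fromEdgeSet (↑(S.image ed) : Set (Sym2 V))).Reachable u v) then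
      ∏ i ∈ Sᶜ, x i
    else 0

/-- The multiple zeta value `ζ(n₁,…,n_d) = ∑_{1 ≤ k₁ < … < k_d} k₁^{-n₁} ⋯ k_d^{-n_d}`. -/
def multipleZeta {d : ℕ} (n : Fin d → ℕ) : ℝ :=
  ∑' k : {k : Fin d → ℕ // StrictMono k ∧ ∀ i, 0 < k i},
    ∏ i, ((k.1 i : ℝ) ^ n i)⁻¹

/-- The set of multiple zeta values `ζ(n₁,…,n_d)` with all `nᵢ ≥ 1` and `n_d ≥ 2`. -/
def mzvSet : Set ℝ :=
  {x | ∃ (d : ℕ) (n : Fin (d + 1) → ℕ),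
    (∀ i, 0 < n i) ∧ 2 ≤ n (Fin.last d) ∧ x = multipleZeta n}

/-- The open positive orthant `(0, ∞)^m`. -/
def posOrthant (m : ℕ) : Set (Fin m → ℝ) := Set.univ.pi fun _ => Set.Ioi 0

/-- The coefficient integrand `ψ^a · φ^b · ln^k(ψ^c/φ^d) · ∏ᵢ ln^{kᵢ}(αᵢ ψ/φ)` of a
propagator graph with edges `ed`, marked vertices `u`, `v`, in the affine chart where
the last Schwinger variable is set to `1` (via `Fin.snoc y 1`). -/
def coeffIntegrand {V : Type} [Fintype V] [DecidableEq V] {m : ℕ}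
    (ed : Fin (m + 1) → Sym2 V) (u v : V) (a b : ℤ) (c d : ℕ) (k : ℕ)
    (kk : Fin (m + 1) → ℕ) (y : Fin m → ℝ) : ℝ :=
  let x : Fin (m + 1) → ℝ := Fin.snoc y 1
  psiI ed x ^ a * phiI ed u v x ^ b *
    Real.log (psiI ed x ^ c / phiI ed u v x ^ d) ^ k *
    ∏ i, Real.log (x i * psiI ed x / phiI ed u v x) ^ kk i

open Filter Topology

/-- nested harmonic sums -/
def mhs : List ℕ → ℕ → ℝ
  | [], _ => 1
  | (a :: w), n => ∑ k ∈ range n, mhs w k / ((k : ℝ) + 1) ^ a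

def PosW (w : List ℕ) : Prop := ∀ a ∈ w, 1 ≤ a

def Zs : Submodule ℚ ℝ := Submodule.span ℚ (insert (1 : ℝ) mzvSet)

abbrev Hn (n : ℕ) : ℝ := mhs [1] n

lemma mhs_nonneg (w : List ℕ) : ∀ n, 0 ≤ mhs w n := by
  induction w with
  | nil => intro n; simp [mhs]
  | cons a w ih => intro n; rw [mhs]; exact sum_nonneg fun k _ => div_nonneg (ih k) (by positivity)

lemma mhs_mono (w : List ℕ) : Monotone (mhs w) := by
  cases w with
  | nil => intro a b _; simp [mhs]
  | cons a w =>
    intro m n h; simp only [mhs]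
    exact sum_le_sum_of_subset_of_nonneg (range_mono h) fun k _ _ =>
      div_nonneg (mhs_nonneg w k) (by positivity)

lemma Hn_eq (n : ℕ) : Hn n = ∑ k ∈ range n, 1 / ((k : ℝ) + 1) := by
  simp [Hn, mhs]

lemma Hn_le_log (n : ℕ) : Hn n ≤ 1 + Real.log n := by
  have := harmonic_le_one_add_log n
  refine le_trans (le_of_eq ?_) this
  rw [Hn_eq, harmonic]; push_cast; simp

lemma Hn_tendsto : Tendsto Hn atTop atTop := by
  have h := Real.tendsto_sum_range_one_div_nat_succ_atTop
  exact h.congr fun n => (Hn_eq n).symm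

lemma mhs_le_pow (w : List ℕ) (hw : PosW w) (n : ℕ) : mhs w n ≤ Hn n ^ w.length := by
  induction w generalizing n with
  | nil => simp [mhs]
  | cons a w ih =>
    have ha : 1 ≤ a := hw a (by simp)
    have hw' : PosW w := fun b hb => hw b (by simp [hb])
    rw [mhs, List.length_cons, pow_succ, Hn_eq n, mul_sum]
    refine sum_le_sum fun k hk => ?_
    rw [div_eq_mul_one_div]
    refine mul_le_mul ?_ ?_ (by positivity) (pow_nonneg (sum_nonneg fun _ _ => by positivity) _)
    · refine (ih hw' k).trans ?_
      rw [← Hn_eq]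
      exact pow_le_pow_left₀ (mhs_nonneg _ _) (mhs_mono _ (mem_range.1 hk).le) _
    · refine one_div_le_one_div_of_le (by positivity) ?_
      exact le_self_pow₀ (by linarith [(Nat.cast_nonneg k : (0:ℝ) ≤ k)]) (by omega)

lemma Hn_pow_growth (j : ℕ) : ∃ C : ℝ, 0 ≤ C ∧ ∀ n : ℕ, Hn n ^ j ≤ C * ((n : ℝ) + 1) ^ (1/2 : ℝ) := by
  have h1 : (fun x : ℝ => (Real.log x) ^ (j:ℝ)) =o[atTop] fun x => x ^ (1/2 : ℝ) :=
    isLittleO_log_rpow_rpow_atTop (j:ℝ) (by norm_num)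
  have h2 : Tendsto (fun n : ℕ => Real.exp 1 * ((n : ℝ) + 1)) atTop atTop :=
    (tendsto_atTop_add_const_right _ _ tendsto_natCast_atTop_atTop).const_mul_atTop (Real.exp_pos 1)
  have h3 := (h1.comp_tendsto h2).isBigO
  have h4 := h3.bound
  obtain ⟨c, hc⟩ := h4
  have key : ∀ n : ℕ, Hn n ≤ Real.log (Real.exp 1 * ((n : ℝ) + 1)) := by
    intro n
    rw [Real.log_mul (by positivity) (by positivity), Real.log_exp]
    refine (Hn_le_log n).trans ?_
    rcases Nat.eq_zero_or_pos n with h | h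
    · subst h; simp
    · have : (0:ℝ) < n := by exact_mod_cast h
      gcongr; linarith
  obtain ⟨N, hN⟩ := eventually_atTop.1 hc
  let C1 := |c| * (Real.exp 1) ^ (1/2:ℝ)
  refine ⟨C1 + Hn N ^ j, by have := mhs_nonneg [1] N; positivity, fun n => ?_⟩
  have hn1 : (1:ℝ) ≤ ((n : ℝ) + 1) ^ (1/2 : ℝ) :=
    Real.one_le_rpow (by linarith [(Nat.cast_nonneg n : (0:ℝ) ≤ n)]) (by norm_num)
  rcases le_total N n with h | h
  · have h5 := hN n h
    simp only [Function.comp, Real.rpow_natCast] at h5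
    have h6 : Hn n ^ j ≤ |c| * ((Real.exp 1 * ((n : ℝ) + 1)) ^ (1/2:ℝ)) := by
      refine (pow_le_pow_left₀ (mhs_nonneg _ _) (key n) j).trans ?_
      refine (le_abs_self _).trans ?_
      rw [Real.norm_eq_abs, Real.norm_eq_abs] at h5
      refine h5.trans ?_
      rw [abs_of_nonneg (by positivity : (0:ℝ) ≤ (Real.exp 1 * ((n : ℝ) + 1)) ^ (1/2:ℝ))]
      gcongr; exact le_abs_self c
    rw [Real.mul_rpow (by positivity) (by positivity), ← mul_assoc] at h6
    refine h6.trans ?_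
    gcongr
    have := mhs_nonneg [1] N
    have : 0 ≤ Hn N ^ j := by positivity
    simp only [C1]; linarith
  · have h7 : Hn n ^ j ≤ Hn N ^ j := pow_le_pow_left₀ (mhs_nonneg _ _) (mhs_mono _ h) j
    have h8 : 0 ≤ Hn N ^ j := pow_nonneg (mhs_nonneg _ _) j
    have h9 : 0 ≤ C1 := by positivity
    nlinarith

lemma Hn_pow_summable (j : ℕ) : Summable fun n : ℕ => Hn n ^ j / ((n : ℝ) + 1) ^ 2 := by
  obtain ⟨C, hC, h⟩ := Hn_pow_growth j
  have hs : Summable fun n : ℕ => C * (((n + 1 : ℕ) : ℝ) ^ (-(3/2) : ℝ)) := by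
    apply Summable.mul_left
    have := (Real.summable_nat_rpow (p := -(3/2))).2 (by norm_num)
    exact (summable_nat_add_iff 1).2 this
  refine Summable.of_nonneg_of_le (fun n => div_nonneg (pow_nonneg (mhs_nonneg _ _) _) (by positivity)) (fun n => ?_) hs
  have hp : (0:ℝ) < (n:ℝ) + 1 := by positivity
  rw [div_le_iff₀ (by positivity)]
  refine (h n).trans (le_of_eq ?_)
  push_cast
  rw [mul_assoc, ← Real.rpow_natCast _ 2, ← Real.rpow_add hp]
  norm_num

lemma Hn_pow_div_tendsto (j : ℕ) : Tendsto (fun n : ℕ => Hn n ^ j / ((n : ℝ) + 1)) atTop (𝓝 0) := by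
  obtain ⟨C, hC, h⟩ := Hn_pow_growth j
  have h1 : Tendsto (fun n : ℕ => C * (((n:ℝ) + 1) ^ (-(1/2) : ℝ))) atTop (𝓝 0) := by
    rw [← mul_zero C]
    refine Tendsto.const_mul _ ?_
    exact (tendsto_rpow_neg_atTop (by norm_num : (0:ℝ) < 1/2)).comp
      (tendsto_atTop_add_const_right _ _ tendsto_natCast_atTop_atTop)
  refine squeeze_zero (fun n => div_nonneg (pow_nonneg (mhs_nonneg _ _) _) (by positivity)) (fun n => ?_) h1
  have hp : (0:ℝ) < (n:ℝ) + 1 := by positivity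
  rw [div_le_iff₀ (by positivity)]
  refine (h n).trans (le_of_eq ?_)
  rw [mul_assoc]
  nth_rewrite 3 [← Real.rpow_one ((n:ℝ)+1)]
  rw [← Real.rpow_add hp]
  norm_num

/-- the finite set of increasing tuples with entries in `[1,N]` -/
def Tup (d N : ℕ) : Finset (Fin d → ℕ) :=
  (Fintype.piFinset fun _ => Icc 1 N).filter StrictMono

lemma mem_Tup {d N : ℕ} {k : Fin d → ℕ} : k ∈ Tup d N ↔ (∀ i, 1 ≤ k i ∧ k i ≤ N) ∧ StrictMono k := by
  simp [Tup]

lemma mhs_ofFn : ∀ (d : ℕ) (n : Fin d → ℕ) (N : ℕ),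
    mhs (List.ofFn n).reverse N = ∑ k ∈ Tup d N, ∏ i, ((k i : ℝ) ^ n i)⁻¹ := by
  intro d
  induction d with
  | zero =>
    intro n N
    have : Tup 0 N = {Fin.elim0} := by
      ext k; rw [mem_Tup]; simp [Subsingleton.elim k Fin.elim0, Subsingleton.strictMono]
    simp [this, mhs]
  | succ d ih =>
    intro n N
    rw [List.ofFn_succ', List.concat_eq_append, List.reverse_append]
    simp only [List.reverse_cons, List.reverse_nil, List.nil_append, List.singleton_append, mhs]
    simp_rw [ih, sum_div]
    rw [Finset.sum_sigma']
    refine Finset.sum_bij' (fun p _ => (Fin.snoc p.2 (p.1 + 1) : Fin (d+1) → ℕ))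
      (fun s _ => ⟨s (Fin.last d) - 1, fun i => s i.castSucc⟩) ?_ ?_ ?_ ?_ ?_
    · rintro ⟨k, t⟩ h
      simp only [mem_sigma, mem_range, mem_Tup] at h
      obtain ⟨hk, ht, hm⟩ := h
      rw [mem_Tup]
      constructor
      · intro i
        refine Fin.lastCases ?_ (fun i => ?_) i
        · simp; omega
        · have := ht i; simp; omega
      · intro i j hij
        induction j using Fin.lastCases with
        | last =>
          induction i using Fin.lastCases with
          | last => exact absurd hij (lt_irrefl _)
          | cast i => have := ht i; simp; omega
        | cast j =>
          induction i using Fin.lastCases with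
          | last => exact absurd hij (not_lt_of_gt (Fin.castSucc_lt_last j))
          | cast i => simp; exact hm (by simpa using hij)
    · intro s hs
      rw [mem_Tup] at hs
      simp only [mem_sigma, mem_range, mem_Tup]
      have h1 := hs.1 (Fin.last d)
      refine ⟨by omega, fun i => ?_, fun i j hij => hs.2 (by simpa using hij)⟩
      have h2 := hs.1 i.castSucc
      have h3 := hs.2 (Fin.castSucc_lt_last i)
      omega
    · rintro ⟨k, t⟩ h
      simp
    · intro s hs
      rw [mem_Tup] at hs
      have h1 := hs.1 (Fin.last d)
      ext i
      refine Fin.lastCases ?_ (fun i => ?_) i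
      · simp; omega
      · simp
    · rintro ⟨k, t⟩ h
      rw [Fin.prod_univ_castSucc]
      simp [div_eq_mul_inv]

lemma mhs_cons_succ (a : ℕ) (w : List ℕ) (n : ℕ) :
    mhs (a :: w) (n + 1) = mhs (a :: w) n + mhs w n / ((n:ℝ) + 1) ^ a := by
  simp [mhs, sum_range_succ]

lemma mhs_summable (a : ℕ) (w : List ℕ) (ha : 2 ≤ a) (hw : PosW w) (j : ℕ) :
    Summable fun n : ℕ => mhs w n / ((n:ℝ)+1)^a * Hn n ^ j := by
  refine Summable.of_nonneg_of_le (fun n => ?_) (fun n => ?_) (Hn_pow_summable (w.length + j))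
  · have := mhs_nonneg w n
    have := mhs_nonneg [1] n
    positivity
  · rw [pow_add, mul_div_right_comm]
    have := mhs_nonneg [1] n
    gcongr
    · exact mhs_le_pow w hw n
    · linarith [(Nat.cast_nonneg n : (0:ℝ) ≤ n)]

lemma mhs_tendsto_tsum (a : ℕ) (w : List ℕ) (ha : 2 ≤ a) (hw : PosW w) :
    Tendsto (mhs (a :: w)) atTop (𝓝 (∑' n : ℕ, mhs w n / ((n:ℝ)+1)^a)) := by
  have := mhs_summable a w ha hw 0
  simp only [pow_zero, mul_one] at this
  exact this.hasSum.tendsto_sum_nat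

lemma mhs_tail (a : ℕ) (w : List ℕ) (ha : 2 ≤ a) (hw : PosW w) (j : ℕ) :
    Tendsto (fun n => (mhs (a :: w) n - (∑' n : ℕ, mhs w n / ((n:ℝ)+1)^a)) * Hn n ^ j) atTop (𝓝 0) := by
  have h0 := mhs_summable a w ha hw 0
  simp only [pow_zero, mul_one] at h0
  have hj := mhs_summable a w ha hw j
  have ht := tendsto_sum_nat_add fun n : ℕ => mhs w n / ((n:ℝ)+1)^a * Hn n ^ j
  have hb : ∀ n, ‖(mhs (a :: w) n - (∑' n : ℕ, mhs w n / ((n:ℝ)+1)^a)) * Hn n ^ j‖ ≤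
      ∑' k, (mhs w (k+n) / (((k+n:ℕ):ℝ)+1)^a * Hn (k+n) ^ j) := by
    intro n
    have e : mhs (a :: w) n - (∑' n : ℕ, mhs w n / ((n:ℝ)+1)^a) =
        - ∑' k, (mhs w (k+n) / (((k+n:ℕ):ℝ)+1)^a) := by
      rw [← h0.sum_add_tsum_nat_add n]; simp [mhs]
    have hH := mhs_nonneg [1] n
    have s1 : Summable fun k => (mhs w (k+n) / (((k+n:ℕ):ℝ)+1)^a) := (summable_nat_add_iff n).2 h0
    have s2 : Summable fun k => (mhs w (k+n) / (((k+n:ℕ):ℝ)+1)^a * Hn (k+n) ^ j) := (summable_nat_add_iff n).2 hj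
    rw [e, neg_mul, norm_neg, ← tsum_mul_right, Real.norm_of_nonneg]
    · refine Summable.tsum_le_tsum (fun k => ?_) (s1.mul_right _) s2
      have := mhs_nonneg w (k+n)
      gcongr
      exact mhs_mono _ (by omega)
    · refine tsum_nonneg fun k => ?_
      have := mhs_nonneg w (k+n)
      positivity
  exact squeeze_zero_norm hb ht

lemma tsum_Tup {d : ℕ} {n : Fin (d+1) → ℕ} {F : ℕ → ℝ} {L : ℝ}
    (hr : ∀ N, F N = ∑ k ∈ Tup (d+1) N, ∏ i, ((k i : ℝ) ^ n i)⁻¹) (hle : ∀ N, F N ≤ L)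
    (hT : Tendsto F atTop (𝓝 L)) :
    (∑' k : {k : Fin (d+1) → ℕ // StrictMono k ∧ ∀ i, 0 < k i}, ∏ i, ((k.1 i : ℝ) ^ n i)⁻¹) = L := by
  set f : {k : Fin (d+1) → ℕ // StrictMono k ∧ ∀ i, 0 < k i} → ℝ :=
    fun k => ∏ i, ((k.1 i : ℝ) ^ n i)⁻¹ with hf
  let g : ℕ → Finset {k : Fin (d+1) → ℕ // StrictMono k ∧ ∀ i, 0 < k i} :=
    fun N => (Tup (d+1) N).subtype _
  have hg : ∀ N, ∑ k ∈ g N, f k = F N := by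
    intro N
    rw [hr]
    simp only [g, hf]
    rw [Finset.sum_subtype_eq_sum_filter (fun k : Fin (d+1) → ℕ => ∏ i, ((k i : ℝ) ^ n i)⁻¹)]
    rw [Finset.filter_true_of_mem]
    intro k hk
    rw [mem_Tup] at hk
    exact ⟨hk.2, fun i => (hk.1 i).1⟩
  have hgm : Monotone g := by
    intro M N h k hk
    simp only [g, mem_subtype, mem_Tup] at hk ⊢
    exact ⟨fun i => ⟨(hk.1 i).1, (hk.1 i).2.trans h⟩, hk.2⟩
  have hgt : Tendsto g atTop atTop := by
    refine tendsto_atTop_finset_of_monotone hgm fun k => ⟨k.1 (Fin.last _), ?_⟩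
    simp only [g, mem_subtype, mem_Tup]
    exact ⟨fun i => ⟨k.2.2 i, k.2.1.monotone (Fin.le_last i)⟩, k.2.1⟩
  have hfn : ∀ k, 0 ≤ f k := fun k => prod_nonneg fun i _ => by positivity
  have hsum : Summable f := by
    refine summable_of_sum_le hfn (c := L) fun s => ?_
    obtain ⟨N, hN⟩ := (tendsto_atTop.1 hgt s).exists
    refine (sum_le_sum_of_subset_of_nonneg hN fun k _ _ => hfn k).trans ?_
    rw [hg]; exact hle N
  have h1 := hsum.hasSum.comp hgt
  exact (tendsto_nhds_unique hT (h1.congr hg)).symm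

lemma mhs_limit_mem (a : ℕ) (w : List ℕ) (ha : 2 ≤ a) (hw : PosW w) :
    (∑' n : ℕ, mhs w n / ((n:ℝ)+1)^a) ∈ mzvSet := by
  set L := (∑' n : ℕ, mhs w n / ((n:ℝ)+1)^a) with hL
  have hT := mhs_tendsto_tsum a w ha hw
  rw [← hL] at hT
  -- the word as a function
  let l := (a :: w).reverse
  have hlen : l.length = w.length + 1 := by simp [l]
  let n : Fin (w.length + 1) → ℕ := fun i => l.get (i.cast hlen.symm)
  have hn : List.ofFn n = l := by
    apply List.ext_getElem
    · simp [hlen]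
    · intro i h1 h2; rw [List.getElem_ofFn]; rfl
  have hmono := mhs_mono (a :: w)
  have hle : ∀ N, mhs (a :: w) N ≤ L := fun N => hmono.ge_of_tendsto hT N
  have hr : ∀ N, mhs (a :: w) N = ∑ k ∈ Tup (w.length+1) N, ∏ i, ((k i : ℝ) ^ n i)⁻¹ := by
    intro N; rw [← mhs_ofFn, hn]; simp [l]
  refine ⟨w.length, n, ?_, ?_, ?_⟩
  · intro i
    have : n i ∈ l := List.get_mem _ _
    simp only [l, List.mem_reverse, List.mem_cons] at this
    rcases this with h | h
    · omega
    · exact hw _ h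
  · have : n (Fin.last w.length) = a := by
      simp [n, l]
    omega
  · rw [multipleZeta]
    exact (tsum_Tup hr hle hT).symm

/-- prefix sum operator -/
def PP (a : ℕ) : (ℕ → ℝ) →ₗ[ℝ] (ℕ → ℝ) where
  toFun f n := ∑ k ∈ range n, f k / ((k : ℝ) + 1) ^ a
  map_add' f g := by ext n; simp [add_div, sum_add_distrib]
  map_smul' c f := by ext n; simp [mul_sum, mul_div_assoc]

lemma PP_apply (a : ℕ) (f : ℕ → ℝ) (n : ℕ) : PP a f n = ∑ k ∈ range n, f k / ((k : ℝ) + 1) ^ a := rfl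

lemma PP_mhs (a : ℕ) (w : List ℕ) : PP a (mhs w) = mhs (a :: w) := by
  ext n; simp [PP_apply, mhs]

lemma PosW.cons {a : ℕ} {w : List ℕ} (ha : 1 ≤ a) (hw : PosW w) : PosW (a :: w) := by
  intro b hb; rcases List.mem_cons.1 hb with h | h
  · omega
  · exact hw b h

lemma PosW.head {a : ℕ} {w : List ℕ} (h : PosW (a :: w)) : 1 ≤ a := h a (by simp)
lemma PosW.tail {a : ℕ} {w : List ℕ} (h : PosW (a :: w)) : PosW w := fun b hb => h b (by simp [hb])
lemma PosW.nil : PosW [] := fun b hb => by simp at hb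

def Ssp : Submodule ℚ (ℕ → ℝ) := Submodule.span ℚ {f | ∃ w, PosW w ∧ f = mhs w}

lemma mhs_mem_Ssp {w : List ℕ} (hw : PosW w) : mhs w ∈ Ssp := Submodule.subset_span ⟨w, hw, rfl⟩

lemma PP_Ssp {a : ℕ} (ha : 1 ≤ a) {f : ℕ → ℝ} (hf : f ∈ Ssp) : PP a f ∈ Ssp := by
  induction hf using Submodule.span_induction with
  | mem f h => obtain ⟨w, hw, rfl⟩ := h; rw [PP_mhs]; exact mhs_mem_Ssp (hw.cons ha)
  | zero => rw [map_zero]; exact zero_mem _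
  | add f g _ _ h1 h2 => rw [map_add]; exact add_mem h1 h2
  | smul c f _ h =>
    have : PP a (c • f) = c • PP a f := map_rat_smul (PP a) c f
    rw [this]; exact Submodule.smul_mem _ _ h

lemma stuffle_rec (a b : ℕ) (u v : List ℕ) :
    mhs (a :: u) * mhs (b :: v) = PP a (mhs u * mhs (b :: v)) + PP b (mhs (a :: u) * mhs v)
      + PP (a + b) (mhs u * mhs v) := by
  ext n
  simp only [Pi.mul_apply, Pi.add_apply, PP_apply]
  induction n with
  | zero => simp [mhs]
  | succ n ih =>
    rw [sum_range_succ, sum_range_succ, sum_range_succ, mhs_cons_succ, mhs_cons_succ]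
    have hp : ((n:ℝ) + 1) ≠ 0 := by positivity
    rw [pow_add]
    generalize hA : ((n:ℝ) + 1) ^ a = A
    generalize hB : ((n:ℝ) + 1) ^ b = B
    have hA0 : A ≠ 0 := by rw [← hA]; positivity
    have hB0 : B ≠ 0 := by rw [← hB]; positivity
    have : ∀ X Y Z x y z : ℝ, (X + x) + (Y + y) + (Z + z) = (X + Y + Z) + (x + y + z) := by intros; ring
    rw [this, ← ih]
    field_simp
    ring

lemma stuffle : ∀ (m : ℕ) (u v : List ℕ), u.length + v.length ≤ m → PosW u → PosW v →
    mhs u * mhs v ∈ Ssp := by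
  intro m
  induction m with
  | zero =>
    intro u v h hu hv
    have h1 : u = [] := List.length_eq_zero_iff.1 (by omega)
    have h2 : v = [] := List.length_eq_zero_iff.1 (by omega)
    subst h1 h2
    have : mhs [] * mhs [] = mhs [] := by ext n; simp [mhs]
    rw [this]; exact mhs_mem_Ssp hu
  | succ m ih =>
    intro u v h hu hv
    cases u with
    | nil =>
      have : mhs [] * mhs v = mhs v := by ext n; simp [mhs]
      rw [this]; exact mhs_mem_Ssp hv
    | cons a u =>
      cases v with
      | nil =>
        have : mhs (a :: u) * mhs [] = mhs (a :: u) := by ext n; simp [mhs]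
        rw [this]; exact mhs_mem_Ssp hu
      | cons b v =>
        rw [stuffle_rec]
        simp only [List.length_cons] at h
        refine add_mem (add_mem (PP_Ssp hu.head (ih _ _ ?_ hu.tail hv)) (PP_Ssp hv.head (ih _ _ ?_ hu hv.tail)))
          (PP_Ssp (by have := hu.head; omega) (ih _ _ ?_ hu.tail hv.tail))
        all_goals (try simp only [List.length_cons]); omega

lemma Ssp_mul {f g : ℕ → ℝ} (hf : f ∈ Ssp) (hg : g ∈ Ssp) : f * g ∈ Ssp := by
  induction hf using Submodule.span_induction with
  | mem f h =>
    obtain ⟨u, hu, rfl⟩ := h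
    induction hg using Submodule.span_induction with
    | mem g h => obtain ⟨v, hv, rfl⟩ := h; exact stuffle _ u v le_rfl hu hv
    | zero => rw [mul_zero]; exact zero_mem _
    | add f g _ _ h1 h2 => rw [mul_add]; exact add_mem h1 h2
    | smul c f _ h => rw [mul_smul_comm]; exact Submodule.smul_mem _ _ h
  | zero => rw [zero_mul]; exact zero_mem _
  | add f g _ _ h1 h2 => rw [add_mul]; exact add_mem h1 h2
  | smul c f _ h => rw [smul_mul_assoc]; exact Submodule.smul_mem _ _ h

/-- admissible words -/
def Adm (w : List ℕ) : Prop := PosW w ∧ (w = [] ∨ ∃ a v, 2 ≤ a ∧ w = a :: v)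

def LO (m : ℕ) : Submodule ℚ (ℕ → ℝ) :=
  Submodule.span ℚ {f | ∃ k w, k ≤ m ∧ Adm w ∧ f = mhs (List.replicate k 1 ++ w)}

lemma LO_mono {m n : ℕ} (h : m ≤ n) : LO m ≤ LO n :=
  Submodule.span_mono fun f ⟨k, w, hk, hw, e⟩ => ⟨k, w, hk.trans h, hw, e⟩

lemma LO_mem {k m : ℕ} {w : List ℕ} (hk : k ≤ m) (hw : Adm w) : mhs (List.replicate k 1 ++ w) ∈ LO m :=
  Submodule.subset_span ⟨k, w, hk, hw, rfl⟩

lemma word_decomp (w : List ℕ) (hw : PosW w) : ∃ k w0, Adm w0 ∧ w = List.replicate k 1 ++ w0 := by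
  induction w with
  | nil => exact ⟨0, [], ⟨PosW.nil, Or.inl rfl⟩, rfl⟩
  | cons a w ih =>
    obtain ⟨k, w0, h0, e⟩ := ih hw.tail
    rcases Nat.lt_or_ge a 2 with h | h
    · have : a = 1 := by have := hw.head; omega
      exact ⟨k + 1, w0, h0, by rw [e, this]; rfl⟩
    · exact ⟨0, a :: w, ⟨hw, Or.inr ⟨a, w, h, rfl⟩⟩, rfl⟩

lemma PP_LO0 {a : ℕ} (ha : 2 ≤ a) {f : ℕ → ℝ} (hf : f ∈ Ssp) : PP a f ∈ LO 0 := by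
  induction hf using Submodule.span_induction with
  | mem f h =>
    obtain ⟨w, hw, rfl⟩ := h; rw [PP_mhs]
    exact LO_mem (k := 0) le_rfl ⟨hw.cons (by omega), Or.inr ⟨a, w, ha, rfl⟩⟩
  | zero => rw [map_zero]; exact zero_mem _
  | add f g _ _ h1 h2 => rw [map_add]; exact add_mem h1 h2
  | smul c f _ h => rw [map_rat_smul (PP a) c f]; exact Submodule.smul_mem _ _ h

lemma PP_LO1 {m : ℕ} {f : ℕ → ℝ} (hf : f ∈ LO m) : PP 1 f ∈ LO (m + 1) := by
  induction hf using Submodule.span_induction with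
  | mem f h =>
    obtain ⟨k, w, hk, hw, rfl⟩ := h; rw [PP_mhs]
    exact LO_mem (k := k + 1) (by omega) hw
  | zero => rw [map_zero]; exact zero_mem _
  | add f g _ _ h1 h2 => rw [map_add]; exact add_mem h1 h2
  | smul c f _ h => rw [map_rat_smul (PP 1) c f]; exact Submodule.smul_mem _ _ h

lemma PosW.one : PosW [1] := by intro a ha; simp at ha; omega

lemma posW_rep (k : ℕ) {w : List ℕ} (hw : PosW w) : PosW (List.replicate k 1 ++ w) := by
  intro b hb
  rcases List.mem_append.1 hb with h | h
  · rw [List.eq_of_mem_replicate h]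
  · exact hw b h

lemma mul_nil (f : ℕ → ℝ) : f * mhs [] = f := by ext n; simp [mhs]
lemma nil_mul (f : ℕ → ℝ) : mhs [] * f = f := by ext n; simp [mhs]

lemma reg_step (k : ℕ) (w : List ℕ) (hw : Adm w) :
    mhs [1] * mhs (List.replicate k 1 ++ w) - ((k : ℚ) + 1) • mhs (List.replicate (k + 1) 1 ++ w) ∈ LO k := by
  induction k with
  | zero =>
    rcases hw.2 with h | ⟨a, v, ha, h⟩
    · subst h; simp [mul_nil]
    · subst h
      have hv := hw.1.tail
      simp only [List.replicate_zero, List.nil_append, zero_add, Nat.cast_zero, one_smul]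
      rw [stuffle_rec, nil_mul, nil_mul, PP_mhs]
      have : ∀ x y z : ℕ → ℝ, x + y + z - x = y + z := by intros; abel
      rw [show List.replicate 1 1 ++ a :: v = 1 :: a :: v from rfl, this]
      exact add_mem (PP_LO0 ha (Ssp_mul (mhs_mem_Ssp PosW.one) (mhs_mem_Ssp hv)))
        (PP_LO0 (by omega) (mhs_mem_Ssp hv))
  | succ k ih =>
    rw [List.replicate_succ, List.cons_append, stuffle_rec, nil_mul, nil_mul, PP_mhs]
    have h1 := PP_LO1 ih
    rw [map_sub, map_rat_smul (PP 1), PP_mhs] at h1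
    have h2 := PP_LO0 (a := 1 + 1) le_rfl (mhs_mem_Ssp (posW_rep k hw.1))
    have h3 := add_mem h1 (LO_mono (Nat.zero_le (k+1)) h2)
    convert h3 using 1
    rw [show List.replicate (k + 1 + 1) 1 ++ w = 1 :: 1 :: (List.replicate k 1 ++ w) from rfl,
      show List.replicate (k + 1) 1 ++ w = 1 :: (List.replicate k 1 ++ w) from rfl]
    rw [show ((k+1 : ℕ) : ℚ) + 1 = ((k:ℚ) + 1) + 1 by push_cast; ring, add_smul, one_smul]
    abel

/-- sequences with an asymptotic expansion in harmonic numbers with coefficients in `Zs` -/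
def Asy (f : ℕ → ℝ) : Prop := ∃ p : Polynomial ℝ, (∀ i, p.coeff i ∈ Zs) ∧
  ∀ j : ℕ, Tendsto (fun n => (f n - p.eval (Hn n)) * Hn n ^ j) atTop (𝓝 0)

lemma Asy.add {f g : ℕ → ℝ} (hf : Asy f) (hg : Asy g) : Asy (f + g) := by
  obtain ⟨p, hp, h1⟩ := hf
  obtain ⟨q, hq, h2⟩ := hg
  refine ⟨p + q, fun i => by rw [Polynomial.coeff_add]; exact add_mem (hp i) (hq i), fun j => ?_⟩
  have := (h1 j).add (h2 j)
  rw [add_zero] at this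
  refine this.congr fun n => ?_
  simp; ring

lemma Asy.smul {f : ℕ → ℝ} (c : ℚ) (hf : Asy f) : Asy (c • f) := by
  obtain ⟨p, hp, h1⟩ := hf
  refine ⟨c • p, fun i => by rw [Polynomial.coeff_smul]; exact Submodule.smul_mem _ _ (hp i), fun j => ?_⟩
  have := (h1 j).const_mul (c:ℝ)
  rw [mul_zero] at this
  refine this.congr fun n => ?_
  simp [Polynomial.eval_smul, Rat.smul_def]; ring

lemma Zs_one : (1:ℝ) ∈ Zs := Submodule.subset_span (by simp)

lemma Asy.zero : Asy 0 := ⟨0, fun i => by simp, fun j => by simp⟩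

lemma Asy.Hmul {f : ℕ → ℝ} (hf : Asy f) : Asy (mhs [1] * f) := by
  obtain ⟨p, hp, h1⟩ := hf
  refine ⟨Polynomial.X * p, fun i => ?_, fun j => ?_⟩
  · cases i with
    | zero => simp
    | succ i => rw [Polynomial.coeff_X_mul]; exact hp i
  · refine (h1 (j+1)).congr fun n => ?_
    simp [Hn]; ring

lemma Asy.adm {w : List ℕ} (hw : Adm w) : Asy (mhs w) := by
  rcases hw.2 with h | ⟨a, v, ha, h⟩
  · subst h
    refine ⟨Polynomial.C 1, fun i => ?_, fun j => by simp [mhs]⟩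
    rw [Polynomial.coeff_C]; split_ifs
    · exact Zs_one
    · exact zero_mem _
  · subst h
    refine ⟨Polynomial.C (∑' n : ℕ, mhs v n / ((n:ℝ)+1)^a), fun i => ?_, fun j => ?_⟩
    · rw [Polynomial.coeff_C]; split_ifs
      · exact Submodule.subset_span (Or.inr (mhs_limit_mem a v ha hw.1.tail))
      · exact zero_mem _
    · simp only [Polynomial.eval_C]
      exact mhs_tail a v ha hw.1.tail j

lemma Asy.LO (m : ℕ) : ∀ f ∈ LO m, Asy f := by
  induction m with
  | zero =>
    intro f hf
    induction hf using Submodule.span_induction with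
    | mem f h =>
      obtain ⟨k, w, hk, hw, rfl⟩ := h
      obtain rfl : k = 0 := by omega
      exact Asy.adm hw
    | zero => exact Asy.zero
    | add f g _ _ h1 h2 => exact h1.add h2
    | smul c f _ h => exact h.smul c
  | succ m ih =>
    intro f hf
    induction hf using Submodule.span_induction with
    | mem f h =>
      obtain ⟨k, w, hk, hw, rfl⟩ := h
      rcases Nat.lt_or_ge k (m+1) with h | h
      · exact ih _ (LO_mem (by omega) hw)
      · obtain rfl : k = m + 1 := by omega
        have h1 := reg_step m w hw
        have h2 := ih _ h1
        have h3 := (ih _ (LO_mem (k := m) le_rfl hw)).Hmul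
        have h4 := (h3.add (h2.smul (-1))).smul ((m:ℚ)+1)⁻¹
        convert h4 using 1
        have : ((m:ℚ)+1) ≠ 0 := by positivity
        rw [neg_smul, one_smul, neg_sub, add_sub_cancel, smul_smul, inv_mul_cancel₀ this, one_smul]
    | zero => exact Asy.zero
    | add f g _ _ h1 h2 => exact h1.add h2
    | smul c f _ h => exact h.smul c

lemma Asy.Ssp {f : ℕ → ℝ} (hf : f ∈ Ssp) : Asy f := by
  induction hf using Submodule.span_induction with
  | mem f h =>
    obtain ⟨w, hw, rfl⟩ := h
    obtain ⟨k, w0, h0, rfl⟩ := word_decomp w hw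
    exact Asy.LO k _ (LO_mem le_rfl h0)
  | zero => exact Asy.zero
  | add f g _ _ h1 h2 => exact h1.add h2
  | smul c f _ h => exact h.smul c

lemma Asy.limit {f : ℕ → ℝ} (hf : Asy f) {L : ℝ} (hL : Tendsto f atTop (𝓝 L)) : L ∈ Zs := by
  obtain ⟨p, hp, h1⟩ := hf
  have h0 := h1 0
  simp only [pow_zero, mul_one] at h0
  have h2 : Tendsto (fun n => p.eval (Hn n)) atTop (𝓝 L) := by
    have := hL.sub h0
    rw [sub_zero] at this
    exact this.congr fun n => by ring
  by_cases hd : 0 < p.degree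
  · exfalso
    have h3 := (Polynomial.abs_tendsto_atTop p hd).comp Hn_tendsto
    exact not_tendsto_nhds_of_tendsto_atTop h3 _ h2.abs
  · have h4 := Polynomial.eq_C_of_degree_le_zero (not_lt.1 hd)
    rw [h4] at h2
    simp only [Polynomial.eval_C] at h2
    rw [tendsto_nhds_unique h2 tendsto_const_nhds]
    exact hp 0

lemma mzv_is_limit {z : ℝ} (hz : z ∈ insert 1 mzvSet) : ∃ f ∈ Ssp, Tendsto f atTop (𝓝 z) := by
  rcases hz with rfl | ⟨d, n, hn, h2, rfl⟩
  · exact ⟨mhs [], mhs_mem_Ssp PosW.nil, by simp [mhs]⟩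
  · -- reconstruct the word
    have hl : (List.ofFn n).reverse = n (Fin.last d) :: (List.ofFn fun i : Fin d => n i.castSucc).reverse := by
      rw [List.ofFn_succ', List.concat_eq_append, List.reverse_append]; rfl
    set a := n (Fin.last d)
    set w := (List.ofFn fun i : Fin d => n i.castSucc).reverse with hw
    have hpw : PosW w := by
      intro b hb
      rw [hw, List.mem_reverse, List.mem_ofFn] at hb
      obtain ⟨i, rfl⟩ := hb
      exact hn _
    refine ⟨mhs (a :: w), mhs_mem_Ssp (hpw.cons (by omega)), ?_⟩
    have h1 := mhs_tendsto_tsum a w h2 hpw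
    convert h1 using 2
    -- the same computation as before
    have hle : ∀ N, mhs (a :: w) N ≤ ∑' n : ℕ, mhs w n / ((n:ℝ)+1)^a := fun N => (mhs_mono _).ge_of_tendsto h1 N
    have hr : ∀ N, mhs (a :: w) N = ∑ k ∈ Tup (d+1) N, ∏ i, ((k i : ℝ) ^ n i)⁻¹ := by
      intro N; rw [← mhs_ofFn, hl]
    rw [multipleZeta]
    exact tsum_Tup hr hle h1

def ZA : Subalgebra ℚ ℝ where
  carrier := Zs
  mul_mem' := by
    intro a b ha hb
    change a ∈ Zs at ha
    change b ∈ Zs at hb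
    change a * b ∈ Zs
    induction ha using Submodule.span_induction with
    | mem a h =>
      induction hb using Submodule.span_induction with
      | mem b h' =>
        obtain ⟨f, hf, h1⟩ := mzv_is_limit h
        obtain ⟨g, hg, h2⟩ := mzv_is_limit h'
        exact (Asy.Ssp (Ssp_mul hf hg)).limit (h1.mul h2)
      | zero => rw [mul_zero]; exact zero_mem _
      | add f g _ _ h1 h2 => rw [mul_add]; exact add_mem h1 h2
      | smul c f _ h => rw [mul_smul_comm]; exact Submodule.smul_mem _ _ h
    | zero => rw [zero_mul]; exact zero_mem _
    | add f g _ _ h1 h2 => rw [add_mul]; exact add_mem h1 h2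
    | smul c f _ h => rw [smul_mul_assoc]; exact Submodule.smul_mem _ _ h
  add_mem' := fun ha hb => Zs.add_mem ha hb
  algebraMap_mem' r := by
    change (algebraMap ℚ ℝ r) ∈ Zs
    rw [Algebra.algebraMap_eq_smul_one]
    exact Submodule.smul_mem _ _ Zs_one

lemma mem_ZA {z : ℝ} : z ∈ ZA ↔ z ∈ Zs := Iff.rfl

def tm (u : List ℕ) (r : ℕ) : ℕ → ℝ := fun n => mhs u n / ((n:ℝ) + 1) ^ r

def TT (r0 : ℕ) : Submodule ZA (ℕ → ℝ) :=
  Submodule.span ZA {f | ∃ u r, PosW u ∧ r0 ≤ r ∧ f = tm u r}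

lemma tm_mem {u : List ℕ} {r r0 : ℕ} (hu : PosW u) (hr : r0 ≤ r) : tm u r ∈ TT r0 :=
  Submodule.subset_span ⟨u, r, hu, hr, rfl⟩

lemma TT_mono {r s : ℕ} (h : r ≤ s) : TT s ≤ TT r :=
  Submodule.span_mono fun _ ⟨u, t, hu, ht, e⟩ => ⟨u, t, hu, h.trans ht, e⟩

lemma TT_map (L : (ℕ → ℝ) →ₗ[ℝ] (ℕ → ℝ)) {r0 : ℕ} {S : Submodule ZA (ℕ → ℝ)}
    (h : ∀ u r, PosW u → r0 ≤ r → L (tm u r) ∈ S) {f : ℕ → ℝ} (hf : f ∈ TT r0) : L f ∈ S := by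
  induction hf using Submodule.span_induction with
  | mem f h' => obtain ⟨u, r, hu, hr, rfl⟩ := h'; exact h u r hu hr
  | zero => rw [map_zero]; exact zero_mem _
  | add f g _ _ h1 h2 => rw [map_add]; exact add_mem h1 h2
  | smul c f _ h =>
    have : L (c • f) = c • L f := by
      have := L.map_smul (c:ℝ) f
      exact this
    rw [this]; exact Submodule.smul_mem _ _ h

lemma rat_smul_mem {S : Submodule ZA (ℕ → ℝ)} (c : ℚ) {f : ℕ → ℝ} (hf : f ∈ S) : c • f ∈ S := by
  have : c • f = (algebraMap ℚ ZA c) • f := by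
    ext n
    simp [Algebra.smul_def]
  rw [this]; exact Submodule.smul_mem _ _ hf

lemma Ssp_map (L : (ℕ → ℝ) →ₗ[ℝ] (ℕ → ℝ)) {S : Submodule ZA (ℕ → ℝ)}
    (h : ∀ u, PosW u → L (mhs u) ∈ S) {f : ℕ → ℝ} (hf : f ∈ Ssp) : L f ∈ S := by
  induction hf using Submodule.span_induction with
  | mem f h' => obtain ⟨u, hu, rfl⟩ := h'; exact h u hu
  | zero => rw [map_zero]; exact zero_mem _
  | add f g _ _ h1 h2 => rw [map_add]; exact add_mem h1 h2
  | smul c f _ h => rw [map_rat_smul L c f]; exact rat_smul_mem _ h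

/-- multiplication by a fixed sequence -/
def mulL (g : ℕ → ℝ) : (ℕ → ℝ) →ₗ[ℝ] (ℕ → ℝ) := LinearMap.mulLeft ℝ g

lemma mulL_apply (g f : ℕ → ℝ) : mulL g f = g * f := rfl

lemma tm_zero (u : List ℕ) : tm u 0 = mhs u := by ext n; simp [tm]

lemma Ssp_div {f : ℕ → ℝ} (hf : f ∈ Ssp) (r : ℕ) : (fun n => f n / ((n:ℝ)+1)^r) ∈ TT r := by
  have := Ssp_map (mulL fun n => (((n:ℝ)+1)^r)⁻¹) (S := TT r) (fun u hu => ?_) hf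
  · convert this using 1
    ext n; simp [mulL_apply]; rw [div_eq_inv_mul]
  · convert tm_mem hu le_rfl using 1
    ext n; simp [mulL_apply, tm]; rw [div_eq_inv_mul]

lemma TT_mul {r s : ℕ} {f g : ℕ → ℝ} (hf : f ∈ TT r) (hg : g ∈ TT s) : f * g ∈ TT (r + s) := by
  refine TT_map (mulL f) (fun v s' hv hs => ?_) hg
  rw [mulL_apply, mul_comm]
  refine TT_map (mulL (tm v s')) (fun u r' hu hr => ?_) hf
  rw [mulL_apply]
  have := Ssp_div (Ssp_mul (mhs_mem_Ssp hv) (mhs_mem_Ssp hu)) (s' + r')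
  refine TT_mono (by omega : r + s ≤ s' + r') ?_
  convert this using 1
  ext n; simp [tm]; rw [pow_add, div_mul_div_comm]

lemma PP_tm (a r : ℕ) (u : List ℕ) : PP a (tm u r) = mhs ((r + a) :: u) := by
  ext n; simp only [PP_apply, mhs, tm]
  exact sum_congr rfl fun k _ => by rw [div_div, pow_add]

lemma PP_TT {a r : ℕ} (h : 1 ≤ r + a) {f : ℕ → ℝ} (hf : f ∈ TT r) : PP a f ∈ TT 0 := by
  refine TT_map (PP a) (fun u r' hu hr => ?_) hf
  rw [PP_tm, ← tm_zero]
  exact tm_mem (hu.cons (by omega)) le_rfl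

lemma TT_div {r : ℕ} {f : ℕ → ℝ} (hf : f ∈ TT r) : (fun n => f n / ((n:ℝ)+1)) ∈ TT (r+1) := by
  have h := TT_mul hf (tm_mem (r := 1) PosW.nil le_rfl)
  convert h using 1
  ext n; simp [tm, mhs]; rw [div_eq_mul_inv]

lemma TT_const {z : ℝ} (hz : z ∈ Zs) : (fun _ => z) ∈ TT 0 := by
  have h := Submodule.smul_mem (TT 0) (⟨z, hz⟩ : ZA) (tm_mem (r := 0) PosW.nil le_rfl)
  convert h using 1
  ext n; simp only [Pi.smul_apply, tm, mhs, pow_zero, div_one]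
  exact (mul_one z).symm

lemma TT_zmul {z : ℝ} (hz : z ∈ Zs) {r : ℕ} {f : ℕ → ℝ} (hf : f ∈ TT r) : (fun n => z * f n) ∈ TT r :=
  Submodule.smul_mem (TT r) (⟨z, hz⟩ : ZA) hf

lemma Asy.zsmul {f : ℕ → ℝ} (c : ZA) (hf : Asy f) : Asy (c • f) := by
  obtain ⟨p, hp, h1⟩ := hf
  refine ⟨Polynomial.C (c:ℝ) * p, fun i => ?_, fun j => ?_⟩
  · rw [Polynomial.coeff_C_mul]; exact ZA.mul_mem c.2 (hp i)
  · have := (h1 j).const_mul (c:ℝ)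
    rw [mul_zero] at this
    refine this.congr fun n => ?_
    simp [Algebra.smul_def]; ring

lemma Asy.TT {f : ℕ → ℝ} (hf : f ∈ TT 0) : Asy f := by
  induction hf using Submodule.span_induction with
  | mem f h =>
    obtain ⟨u, r, hu, -, rfl⟩ := h
    cases r with
    | zero => rw [tm_zero]; exact Asy.Ssp (mhs_mem_Ssp hu)
    | succ r =>
      refine ⟨0, fun i => by simp, fun j => ?_⟩
      refine squeeze_zero (fun n => ?_) (fun n => ?_) (Hn_pow_div_tendsto (u.length + j))
      · have := mhs_nonneg u n
        have := mhs_nonneg [1] n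
        simp [tm]; positivity
      · simp only [Polynomial.eval_zero, sub_zero, tm]
        rw [pow_add (Hn n), mul_div_right_comm]
        have := mhs_nonneg [1] n
        have h1 : (1:ℝ) ≤ (n:ℝ) + 1 := by linarith [(Nat.cast_nonneg n : (0:ℝ) ≤ n)]
        gcongr
        · exact mhs_le_pow u hu n
        · exact le_self_pow₀ h1 (by omega)
  | zero => exact Asy.zero
  | add f g _ _ h1 h2 => exact h1.add h2
  | smul c f _ h => exact h.zsmul c

lemma TT_limit {f : ℕ → ℝ} (hf : f ∈ TT 0) {L : ℝ} (hL : Tendsto f atTop (𝓝 L)) : L ∈ Zs :=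
  (Asy.TT hf).limit hL

/-- shifted partial fraction sums -/
def VV (a r : ℕ) : (ℕ → ℝ) →ₗ[ℝ] (ℕ → ℝ) where
  toFun f n := ∑ k ∈ range n, f k / (((k : ℝ) + 1) ^ a * ((k:ℝ) + 2) ^ r)
  map_add' f g := by ext n; simp [add_div, sum_add_distrib]
  map_smul' c f := by ext n; simp [mul_sum, mul_div_assoc]

lemma VV_apply (a r : ℕ) (f : ℕ → ℝ) (n : ℕ) :
  VV a r f n = ∑ k ∈ range n, f k / (((k : ℝ) + 1) ^ a * ((k:ℝ) + 2) ^ r) := rfl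

lemma VV_step (a r : ℕ) (f : ℕ → ℝ) : VV (a+1) (r+1) f = VV (a+1) r f - VV a (r+1) f := by
  ext n; simp only [VV_apply, Pi.sub_apply, ← sum_sub_distrib]
  refine sum_congr rfl fun k _ => ?_
  have h1 : ((k:ℝ) + 1) ≠ 0 := by positivity
  have h2 : ((k:ℝ) + 2) ≠ 0 := by positivity
  field_simp
  ring

lemma VV_shift (r : ℕ) (w : List ℕ) :
    (fun M => ∑ m ∈ range M, mhs w (m+1) / ((m:ℝ) + 2) ^ r) = mhs (r :: w) + tm w r - fun _ => mhs w 0 := by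
  ext M
  simp only [Pi.add_apply, Pi.sub_apply, tm]
  induction M with
  | zero => simp [mhs]
  | succ M ih =>
    rw [sum_range_succ, ih, mhs_cons_succ]; push_cast
    rw [show (M:ℝ) + 1 + 1 = M + 2 by ring]; ring

lemma mhs_zero_mem (w : List ℕ) : mhs w 0 ∈ Zs := by
  cases w with
  | nil => simpa [mhs] using Zs_one
  | cons a w => simp [mhs]

lemma VV_mhs_of (w : List ℕ) (hw : PosW w) (h0 : ∀ r, VV 0 (r+1) (mhs w) ∈ TT 0) :
    ∀ s a r : ℕ, a + r = s → 1 ≤ s → VV a r (mhs w) ∈ TT 0 := by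
  intro s
  induction s with
  | zero => intro a r _ h; omega
  | succ s ih =>
    intro a r h _
    cases a with
    | zero => cases r with
      | zero => omega
      | succ r => exact h0 r
    | succ a => cases r with
      | zero =>
        have : VV (a+1) 0 (mhs w) = PP (a+1) (mhs w) := by ext n; simp [VV_apply, PP_apply]
        rw [this, ← tm_zero]
        exact PP_TT (r := 0) (by omega) (tm_mem hw le_rfl)
      | succ r =>
        rw [VV_step]
        exact sub_mem (ih _ _ (by omega) (by omega)) (ih _ _ (by omega) (by omega))

lemma VV_mhs (w : List ℕ) (hw : PosW w) : ∀ a r : ℕ, 1 ≤ a + r → VV a r (mhs w) ∈ TT 0 := by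
  induction w with
  | nil =>
    intro a r h
    refine VV_mhs_of [] hw (fun r => ?_) _ a r rfl h
    have e := VV_shift (r+1) []
    have : VV 0 (r+1) (mhs []) = (fun M => ∑ m ∈ range M, mhs [] (m+1) / ((m:ℝ) + 2) ^ (r+1)) := by
      ext n; simp [VV_apply, mhs]
    rw [this, e]
    refine sub_mem (add_mem ?_ (tm_mem hw (Nat.zero_le _))) (TT_const (mhs_zero_mem _))
    rw [← tm_zero]; exact tm_mem (hw.cons (by omega)) le_rfl
  | cons b w ih =>
    intro a r h
    refine VV_mhs_of (b :: w) hw (fun r => ?_) _ a r rfl h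
    have e := VV_shift (r+1) (b :: w)
    have : VV 0 (r+1) (mhs (b :: w)) = (fun M => ∑ m ∈ range M, mhs (b :: w) (m+1) / ((m:ℝ) + 2) ^ (r+1))
        - VV b (r+1) (mhs w) := by
      ext n; simp only [VV_apply, Pi.sub_apply, ← sum_sub_distrib]
      refine sum_congr rfl fun k _ => ?_
      rw [mhs_cons_succ]
      have h1 : ((k:ℝ) + 1) ≠ 0 := by positivity
      have h2 : ((k:ℝ) + 2) ≠ 0 := by positivity
      field_simp
      ring
    rw [this, e]
    refine sub_mem (sub_mem (add_mem ?_ (tm_mem hw (Nat.zero_le _))) (TT_const (mhs_zero_mem _))) (ih hw.tail _ _ (by omega))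
    rw [← tm_zero]; exact tm_mem (hw.cons (by omega)) le_rfl

lemma VV_Ssp {f : ℕ → ℝ} (hf : f ∈ Ssp) {a r : ℕ} (h : 1 ≤ a + r) : VV a r f ∈ TT 0 :=
  Ssp_map (VV a r) (fun u hu => VV_mhs u hu a r h) hf

/-- the pairing `∑_{m<M} c[m+1] e[m]` -/
def pairL (e : ℕ → ℝ) : (ℕ → ℝ) →ₗ[ℝ] (ℕ → ℝ) where
  toFun c M := ∑ m ∈ range M, c (m+1) * e m
  map_add' f g := by ext n; simp [add_mul, sum_add_distrib]
  map_smul' c f := by ext n; simp [mul_sum, mul_assoc]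

def pairR (c : ℕ → ℝ) : (ℕ → ℝ) →ₗ[ℝ] (ℕ → ℝ) where
  toFun e M := ∑ m ∈ range M, c (m+1) * e m
  map_add' f g := by ext n; simp [mul_add, sum_add_distrib]
  map_smul' c f := by ext n; simp [mul_sum, mul_left_comm]

lemma pair_mem {c e : ℕ → ℝ} (hc : c ∈ TT 1) (he : e ∈ TT 1) :
    (fun M => ∑ m ∈ range M, c (m+1) * e m) ∈ TT 0 := by
  refine TT_map (pairL e) (fun u r hu hr => ?_) hc
  refine TT_map (pairR (tm u r)) (fun v s hv hs => ?_) he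
  have key : ∀ u' : List ℕ, PosW u' → ∀ a, VV a r (mhs u' * mhs v) ∈ TT 0 := fun u' hu' a =>
    VV_Ssp (Ssp_mul (mhs_mem_Ssp hu') (mhs_mem_Ssp hv)) (by omega)
  cases u with
  | nil =>
    convert key [] hu s using 1
    ext n
    simp only [pairR, VV_apply, LinearMap.coe_mk, AddHom.coe_mk, tm, Pi.mul_apply, mhs]
    refine sum_congr rfl fun k _ => ?_
    push_cast
    rw [show (k:ℝ) + 1 + 1 = k + 2 by ring]
    field_simp
  | cons a u =>
    convert add_mem (key (a :: u) hu s) (key u hu.tail (a + s)) using 1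
    ext n
    simp only [pairR, VV_apply, LinearMap.coe_mk, AddHom.coe_mk, tm, Pi.mul_apply, Pi.add_apply, ← sum_add_distrib]
    refine sum_congr rfl fun k _ => ?_
    rw [mhs_cons_succ]
    push_cast
    rw [show (k:ℝ) + 1 + 1 = k + 2 by ring]
    have h1 : ((k:ℝ) + 1) ≠ 0 := by positivity
    have h2 : ((k:ℝ) + 2) ≠ 0 := by positivity
    rw [pow_add]
    field_simp

/-- shifted convolution -/
def cv (c d : ℕ → ℝ) : ℕ → ℝ
  | 0 => 0
  | (n+1) => ∑ p ∈ antidiagonal n, c p.1 * d p.2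

def cvL (c : ℕ → ℝ) : (ℕ → ℝ) →ₗ[ℝ] (ℕ → ℝ) where
  toFun d := cv c d
  map_add' f g := by ext n; cases n <;> simp [cv, mul_add, sum_add_distrib]
  map_smul' c f := by ext n; cases n <;> simp [cv, mul_sum, mul_left_comm]

lemma cv_comm (c d : ℕ → ℝ) : cv c d = cv d c := by
  ext n; cases n with
  | zero => rfl
  | succ n =>
    simp only [cv]
    rw [← Finset.Nat.sum_antidiagonal_swap]
    exact sum_congr rfl fun p _ => by simp [mul_comm]

lemma cv_mk (c d : ℕ → ℝ) : PowerSeries.mk (cv c d) = PowerSeries.X * (PowerSeries.mk c * PowerSeries.mk d) := by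
  ext n; cases n with
  | zero => simp [cv]
  | succ n => rw [PowerSeries.coeff_succ_X_mul, PowerSeries.coeff_mul]; simp [cv]

lemma cv_assoc (c d e : ℕ → ℝ) : cv (cv c d) e = cv c (cv d e) := by
  have : PowerSeries.mk (cv (cv c d) e) = PowerSeries.mk (cv c (cv d e)) := by
    simp only [cv_mk]; ring
  ext n
  have := congrArg (PowerSeries.coeff n) this
  simpa using this

lemma cv_one (d : ℕ → ℝ) : cv (fun _ => 1) d = PP 0 d := by
  ext n; cases n with
  | zero => simp [cv, PP_apply]
  | succ n =>
    simp only [cv, PP_apply, pow_zero, div_one, one_mul]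
    rw [Finset.Nat.sum_antidiagonal_eq_sum_range_succ (fun _ j => d j) n]
    exact Finset.sum_range_reflect (fun j => d j) (n+1)

lemma cv_N (c d : ℕ → ℝ) (n : ℕ) : ((n:ℝ)+1) * cv c d n =
    cv (fun k => ((k:ℝ)+1) * c k) d n + cv c (fun k => ((k:ℝ)+1) * d k) n := by
  cases n with
  | zero => simp [cv]
  | succ n =>
    simp only [cv, mul_sum, ← sum_add_distrib]
    refine sum_congr rfl fun p hp => ?_
    rw [HasAntidiagonal.mem_antidiagonal] at hp
    rw [← hp]; push_cast; ring

lemma cv_tm : ∀ (m : ℕ) (u v : List ℕ) (r s : ℕ), PosW u → PosW v → u.sum + r + (v.sum + s) ≤ m →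
    cv (tm u (r+1)) (tm v (s+1)) ∈ TT 1 := by
  intro m
  induction m using Nat.strong_induction_on with
  | _ m ih =>
    -- the half step
    have half : ∀ (u v : List ℕ) (r s : ℕ), PosW u → PosW v → u.sum + r + (v.sum + s) ≤ m →
        cv (fun k : ℕ => ((k:ℝ)+1) * tm u (r+1) k) (tm v (s+1)) ∈ TT 0 := by
      intro u v r s hu hv hm
      have e : (fun k : ℕ => ((k:ℝ)+1) * tm u (r+1) k) = tm u r := by
        ext k; simp only [tm]
        have h1 : ((k:ℝ) + 1) ≠ 0 := by positivity
        field_simp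
        ring
      rw [e]
      cases r with
      | succ r =>
        exact TT_mono (Nat.zero_le 1) (ih (m-1) (by omega) u v r s hu hv (by omega))
      | zero =>
        rw [tm_zero]
        cases u with
        | nil =>
          have : mhs [] = fun _ => 1 := by ext; simp [mhs]
          rw [this, cv_one]
          exact PP_TT (r := 1) (by omega) (tm_mem hv (by omega))
        | cons a u =>
          obtain ⟨a, rfl⟩ : ∃ a', a = a' + 1 := ⟨a - 1, by have := hu.head; omega⟩
          have : mhs ((a+1) :: u) = cv (fun _ => 1) (tm u (a+1)) := by
            rw [cv_one, PP_tm]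
          rw [this, cv_assoc, cv_one]
          simp only [List.sum_cons] at hm
          exact PP_TT (r := 1) (by omega) (ih (m-1) (by omega) u v a s hu.tail hv (by omega))
    intro u v r s hu hv hm
    have h1 := half u v r s hu hv hm
    have h2 := half v u s r hv hu (by omega)
    rw [cv_comm] at h2
    convert TT_div (add_mem h1 h2) using 1
    ext n
    rw [Pi.add_apply, ← cv_N]
    have h1 : ((n:ℝ) + 1) ≠ 0 := by positivity
    field_simp

lemma cv_mem {c d : ℕ → ℝ} (hc : c ∈ TT 1) (hd : d ∈ TT 1) : cv c d ∈ TT 1 := by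
  refine TT_map (cvL c) (fun v s hv hs => ?_) hd
  change cv c (tm v s) ∈ _
  rw [cv_comm]
  refine TT_map (cvL (tm v s)) (fun u r hu hr => ?_) hc
  obtain ⟨s, rfl⟩ : ∃ a', s = a' + 1 := ⟨s - 1, by omega⟩
  obtain ⟨r, rfl⟩ : ∃ a', r = a' + 1 := ⟨r - 1, by omega⟩
  exact cv_tm _ v u s r hv hu le_rfl

lemma neglog_pow_le (i : ℕ) {ε : ℝ} (hε : 0 < ε) :
    ∃ C : ℝ, 0 ≤ C ∧ ∀ x ∈ Set.Ioo (0:ℝ) 1, (-Real.log x) ^ i ≤ C * x ^ (-ε) := by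
  rcases Nat.eq_zero_or_pos i with h | h
  · subst h
    refine ⟨1, zero_le_one, fun x hx => ?_⟩
    rw [pow_zero, one_mul]
    exact Real.one_le_rpow_of_pos_of_le_one_of_nonpos hx.1 hx.2.le (by linarith)
  · have hi : (0:ℝ) < i := by exact_mod_cast h
    refine ⟨(1 / (ε / i)) ^ i, by positivity, fun x hx => ?_⟩
    have h1 := Real.abs_log_mul_self_rpow_lt x (ε / i) hx.1 hx.2.le (by positivity)
    have hx0 := hx.1
    have hl : Real.log x < 0 := Real.log_neg hx.1 hx.2
    rw [abs_mul, abs_of_neg hl, abs_of_pos (by positivity)] at h1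
    have h2 : -Real.log x ≤ (1 / (ε / i)) * x ^ (-(ε / i)) := by
      rw [Real.rpow_neg hx0.le, ← div_eq_mul_inv, le_div_iff₀ (by positivity)]
      exact h1.le
    refine (pow_le_pow_left₀ (by linarith) h2 i).trans (le_of_eq ?_)
    rw [mul_pow, ← Real.rpow_natCast (x ^ _), ← Real.rpow_mul hx0.le]
    congr 2
    field_simp

lemma beta_fin {a b : ℝ} (ha : a < 1) (hb : b < 1) :
    ∫⁻ t in Set.Ioo (0:ℝ) 1, ENNReal.ofReal (t ^ (-a) * (1 - t) ^ (-b)) < ⊤ := by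
  have h := ProbabilityTheory.lintegral_betaPDF_eq_one (α := 1 - a) (β := 1 - b) (by linarith) (by linarith)
  have hB := ProbabilityTheory.beta_pos (α := 1 - a) (β := 1 - b) (by linarith) (by linarith)
  set B := ProbabilityTheory.beta (1 - a) (1 - b)
  have : ∫⁻ t in Set.Ioo (0:ℝ) 1, ENNReal.ofReal (t ^ (-a) * (1 - t) ^ (-b)) =
      ENNReal.ofReal B * ∫⁻ x, ProbabilityTheory.betaPDF (1-a) (1-b) x := by
    rw [← lintegral_indicator measurableSet_Ioo, ← lintegral_const_mul']
    · refine lintegral_congr fun x => ?_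
      rw [ProbabilityTheory.betaPDF_eq, ← ENNReal.ofReal_mul hB.le, Set.indicator_apply]
      simp only [Set.mem_Ioo]
      split_ifs
      · congr 1
        rw [← mul_assoc, ← mul_assoc, mul_one_div_cancel hB.ne', one_mul]
        congr 2 <;> ring
      · simp
    · exact ENNReal.ofReal_ne_top
  rw [this, h, mul_one]
  exact ENNReal.ofReal_lt_top

lemma ll_meas (i j : ℕ) : Measurable fun t : ℝ => (-Real.log t) ^ i * (-Real.log (1 - t)) ^ j := by
  fun_prop

lemma ll_int (i j : ℕ) : IntegrableOn (fun t : ℝ => (-Real.log t) ^ i * (-Real.log (1 - t)) ^ j)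
    (Set.Ioo 0 1) := by
  obtain ⟨C, hC, h1⟩ := neglog_pow_le i (ε := 1/2) (by norm_num)
  obtain ⟨D, hD, h2⟩ := neglog_pow_le j (ε := 1/2) (by norm_num)
  have hb : IntegrableOn (fun t : ℝ => t ^ (-(1/2) : ℝ) * (1 - t) ^ (-(1/2) : ℝ)) (Set.Ioo 0 1) := by
    refine ⟨(by fun_prop), ?_⟩
    rw [hasFiniteIntegral_iff_ofReal]
    · exact beta_fin (by norm_num) (by norm_num)
    · filter_upwards [ae_restrict_mem measurableSet_Ioo] with t ht
      have := ht.1; have := ht.2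
      have : 0 < 1 - t := by linarith
      simp only [Pi.zero_apply]; positivity
  refine Integrable.mono' (hb.const_mul (C * D)) (ll_meas i j).aestronglyMeasurable ?_
  filter_upwards [ae_restrict_mem measurableSet_Ioo] with t ht
  have h3 := h1 t ht
  have h4 := h2 (1 - t) ⟨by linarith [ht.2], by linarith [ht.1]⟩
  have p1 : 0 ≤ -Real.log t := by linarith [Real.log_neg ht.1 ht.2]
  have p2 : 0 ≤ -Real.log (1 - t) := by linarith [Real.log_neg (by linarith [ht.2] : 0 < 1 - t) (by linarith [ht.1])]
  rw [Real.norm_of_nonneg (by positivity)]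
  calc _ ≤ (C * t ^ (-(1/2) : ℝ)) * (D * (1 - t) ^ (-(1/2) : ℝ)) :=
        mul_le_mul h3 h4 (by positivity) (mul_nonneg hC (Real.rpow_nonneg ht.1.le _))
    _ = _ := by ring

def EE (i j n : ℕ) : ℝ := ∫ t in Set.Ioo (0:ℝ) 1, t ^ n * ((-Real.log t) ^ i * (-Real.log (1 - t)) ^ j)

lemma EE_int (i j n : ℕ) : IntegrableOn (fun t : ℝ => t ^ n * ((-Real.log t) ^ i * (-Real.log (1 - t)) ^ j))
    (Set.Ioo 0 1) := by
  refine Integrable.mono (ll_int i j) (by fun_prop) ?_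
  filter_upwards [ae_restrict_mem measurableSet_Ioo] with t ht
  rw [norm_mul]
  refine mul_le_of_le_one_left (norm_nonneg _) ?_
  rw [norm_pow, Real.norm_of_nonneg ht.1.le]
  exact pow_le_one₀ ht.1.le ht.2.le

lemma EE_nonneg (i j n : ℕ) : 0 ≤ EE i j n := by
  refine setIntegral_nonneg measurableSet_Ioo fun t ht => ?_
  have p1 : 0 ≤ -Real.log t := by linarith [Real.log_neg ht.1 ht.2]
  have p2 : 0 ≤ -Real.log (1 - t) := by linarith [Real.log_neg (by linarith [ht.2] : 0 < 1 - t) (by linarith [ht.1])]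
  have := ht.1
  positivity

lemma EE_bdry (i j n : ℕ) (l : Filter ℝ) (hl : ∀ᶠ t in l, t ∈ Set.Ioo (0:ℝ) 1)
    (h : Tendsto (fun t : ℝ => t ^ (1/2:ℝ) * (1 - t) ^ (1/2:ℝ)) l (𝓝 0)) :
    Tendsto (fun t : ℝ => t ^ (n+1) * (1 - t) * ((-Real.log t) ^ i * (-Real.log (1 - t)) ^ j)) l (𝓝 0) := by
  obtain ⟨C, hC, h1⟩ := neglog_pow_le i (ε := 1/2) (by norm_num)
  obtain ⟨D, hD, h2⟩ := neglog_pow_le j (ε := 1/2) (by norm_num)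
  have h' := h.const_mul (C * D)
  rw [mul_zero] at h'
  refine squeeze_zero_norm' ?_ h'
  filter_upwards [hl] with t ht
  have h3 := h1 t ht
  have h4 := h2 (1 - t) ⟨by linarith [ht.2], by linarith [ht.1]⟩
  have p1 : 0 ≤ -Real.log t := by linarith [Real.log_neg ht.1 ht.2]
  have p2 : 0 ≤ -Real.log (1 - t) := by linarith [Real.log_neg (by linarith [ht.2] : 0 < 1 - t) (by linarith [ht.1])]
  have q1 := ht.1
  have q2 : 0 < 1 - t := by linarith [ht.2]
  rw [Real.norm_of_nonneg (by positivity)]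
  have e1 : t * t ^ (-(1/2) : ℝ) = t ^ (1/2 : ℝ) := by
    nth_rewrite 1 [← Real.rpow_one t]
    rw [← Real.rpow_add q1]; norm_num
  have e2 : (1 - t) * (1 - t) ^ (-(1/2) : ℝ) = (1 - t) ^ (1/2 : ℝ) := by
    nth_rewrite 1 [← Real.rpow_one (1 - t)]
    rw [← Real.rpow_add q2]; norm_num
  calc _ ≤ t * (1 - t) * ((C * t ^ (-(1/2) : ℝ)) * (D * (1 - t) ^ (-(1/2) : ℝ))) := by
        gcongr
        exact pow_le_of_le_one q1.le ht.2.le (by omega)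
    _ = C * D * ((t * t ^ (-(1/2) : ℝ)) * ((1 - t) * (1 - t) ^ (-(1/2) : ℝ))) := by ring
    _ = _ := by rw [e1, e2]

lemma EE_rec (i j n : ℕ) : ((n:ℝ) + 2) * EE i j (n+1) = ((n:ℝ)+1) * EE i j n
    - i * (EE (i-1) j n - EE (i-1) j (n+1)) + j * EE i (j-1) (n+1) := by
  let f : ℝ → ℝ := fun t => t ^ (n+1) * (1 - t) * ((-Real.log t) ^ i * (-Real.log (1 - t)) ^ j)
  let g : ℝ → ℕ → ℕ → ℕ → ℝ := fun t i j n => t ^ n * ((-Real.log t) ^ i * (-Real.log (1 - t)) ^ j)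
  let f' : ℝ → ℝ := fun t => ((n:ℝ)+1) * g t i j n - ((n:ℝ) + 2) * g t i j (n+1)
    - i * (g t (i-1) j n - g t (i-1) j (n+1)) + j * g t i (j-1) (n+1)
  have hd : ∀ t ∈ Set.Ioo (0:ℝ) 1, HasDerivAt f (f' t) t := by
    intro t ht
    have q1 := ht.1
    have q2 : 0 < 1 - t := by linarith [ht.2]
    have d1 : HasDerivAt (fun t : ℝ => t ^ (n+1)) (((n+1:ℕ):ℝ) * t ^ n) t := by
      simpa using hasDerivAt_pow (n+1) t
    have d2 : HasDerivAt (fun t : ℝ => 1 - t) (-1) t := by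
      simpa using (hasDerivAt_id t).const_sub 1
    have d3 : HasDerivAt (fun t : ℝ => (-Real.log t) ^ i) (i * (-Real.log t) ^ (i-1) * (-t⁻¹)) t :=
      ((Real.hasDerivAt_log q1.ne').neg).pow i
    have d4 : HasDerivAt (fun t : ℝ => (-Real.log (1 - t)) ^ j) (j * (-Real.log (1-t)) ^ (j-1) * (-(-1 / (1-t)))) t :=
      ((d2.log q2.ne').neg).pow j
    have := (d1.mul d2).mul (d3.mul d4)
    refine this.congr_deriv ?_
    simp only [f', g, Pi.mul_apply]
    push_cast
    field_simp
    ring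
  have hgi : ∀ i j n, IntervalIntegrable (fun t => g t i j n) volume 0 1 := fun i j n => by
    rw [intervalIntegrable_iff_integrableOn_Ioo_of_le zero_le_one]; exact EE_int i j n
  have hgv : ∀ i j n, ∫ t in (0:ℝ)..1, g t i j n = EE i j n := fun i j n => by
    rw [intervalIntegral.integral_of_le zero_le_one, integral_Ioc_eq_integral_Ioo]; rfl
  have hi : IntervalIntegrable f' volume 0 1 :=
    ((((hgi i j n).const_mul _).sub ((hgi i j (n+1)).const_mul _)).sub
      (((hgi (i-1) j n).sub (hgi (i-1) j (n+1))).const_mul _)).add ((hgi i (j-1) (n+1)).const_mul _)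
  have c0 : Continuous (fun t : ℝ => t ^ (1/2:ℝ) * (1 - t) ^ (1/2:ℝ)) := by
    refine Continuous.mul ?_ ?_
    · exact Real.continuous_rpow_const (by norm_num)
    · exact (Real.continuous_rpow_const (by norm_num)).comp (by fun_prop)
  have b0 : Tendsto f (𝓝[>] 0) (𝓝 0) := by
    refine EE_bdry i j n _ (Ioo_mem_nhdsGT zero_lt_one) ?_
    have := c0.tendsto 0
    simp only [Real.zero_rpow (by norm_num : (1/2:ℝ) ≠ 0), zero_mul] at this
    exact this.mono_left nhdsWithin_le_nhds
  have b1 : Tendsto f (𝓝[<] 1) (𝓝 0) := by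
    refine EE_bdry i j n _ (Ioo_mem_nhdsLT zero_lt_one) ?_
    have := c0.tendsto 1
    simp only [sub_self, Real.zero_rpow (by norm_num : (1/2:ℝ) ≠ 0), mul_zero] at this
    exact this.mono_left nhdsWithin_le_nhds
  have key := intervalIntegral.integral_eq_sub_of_hasDerivAt_of_tendsto zero_lt_one hd hi b0 b1
  simp only [f'] at key
  rw [intervalIntegral.integral_add, intervalIntegral.integral_sub, intervalIntegral.integral_sub,
    intervalIntegral.integral_const_mul, intervalIntegral.integral_const_mul,
    intervalIntegral.integral_const_mul, intervalIntegral.integral_const_mul, intervalIntegral.integral_sub] at key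
  · simp only [hgv] at key
    linarith
  all_goals first
    | exact hgi _ _ _
    | exact (hgi _ _ _).const_mul _
    | exact ((hgi _ _ _).sub (hgi _ _ _)).const_mul _
    | exact ((hgi _ _ _).const_mul _).sub ((hgi _ _ _).const_mul _)
    | exact (((hgi _ _ _).const_mul _).sub ((hgi _ _ _).const_mul _)).sub (((hgi _ _ _).sub (hgi _ _ _)).const_mul _)

lemma EE_closed (i j n : ℕ) : ((n:ℝ)+1) * EE i j n =
    (EE i j 0 - i * EE (i-1) j 0 - j * EE i (j-1) 0) + (i * EE (i-1) j n
      + j * (PP 0 (EE i (j-1)) n + EE i (j-1) n)) := by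
  induction n with
  | zero => simp [PP_apply]
  | succ n ih =>
    have h := EE_rec i j n
    have e : PP 0 (EE i (j-1)) (n+1) = PP 0 (EE i (j-1)) n + EE i (j-1) n := by
      simp [PP_apply, sum_range_succ]
    push_cast
    rw [e, show (n:ℝ) + 1 + 1 = n + 2 by ring, h, ih]; ring

lemma npow_bound (n : ℕ) {t : ℝ} (ht : t ∈ Set.Ioo (0:ℝ) 1) : ((n:ℝ)+2) * t ^ n * (1 - t) ≤ 2 := by
  have q1 := ht.1
  have q2 : 0 < 1 - t := by linarith [ht.2]
  have h1 : ((n:ℝ)+1) * t ^ n ≤ ∑ k ∈ range (n+1), t ^ k := by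
    have := Finset.card_nsmul_le_sum (range (n+1)) (fun k => t ^ k) (t ^ n) (fun k hk =>
      pow_le_pow_of_le_one q1.le ht.2.le (by have := mem_range.1 hk; omega))
    simpa using this
  have h2 := geom_sum_mul_neg t (n+1)
  have h3 : ((n:ℝ)+1) * t ^ n * (1 - t) ≤ 1 := by
    calc _ ≤ (∑ k ∈ range (n+1), t ^ k) * (1 - t) := by gcongr
      _ = 1 - t ^ (n+1) := h2
      _ ≤ 1 := by have := pow_pos q1 (n+1); linarith
  have h4 : (n:ℝ) + 2 ≤ 2 * (n + 1) := by linarith [(Nat.cast_nonneg n : (0:ℝ) ≤ n)]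
  have h5 : 0 < t ^ n * (1 - t) := by positivity
  nlinarith

lemma EE_lim (i j : ℕ) : Tendsto (fun n : ℕ => ((n:ℝ)+1) * EE (i+1) j n) atTop (𝓝 0) := by
  rw [← tendsto_add_atTop_iff_nat 1]
  have : (fun n : ℕ => (((n+1:ℕ):ℝ)+1) * EE (i+1) j (n+1)) = fun n : ℕ =>
      ∫ t in Set.Ioo (0:ℝ) 1, ((n:ℝ)+2) * (t ^ (n+1) * ((-Real.log t) ^ (i+1) * (-Real.log (1 - t)) ^ j)) := by
    ext n
    rw [EE, ← integral_const_mul]; push_cast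
    rw [show (n:ℝ) + 1 + 1 = n + 2 by ring]
  rw [this]
  have h0 : (0:ℝ) = ∫ t in Set.Ioo (0:ℝ) 1, (0:ℝ) := by simp
  suffices h : Tendsto (fun n : ℕ =>
      ∫ t in Set.Ioo (0:ℝ) 1, ((n:ℝ)+2) * (t ^ (n+1) * ((-Real.log t) ^ (i+1) * (-Real.log (1 - t)) ^ j))) atTop
      (𝓝 (∫ t in Set.Ioo (0:ℝ) 1, (0:ℝ))) by rwa [← h0] at h
  refine tendsto_integral_of_dominated_convergence (fun t => 2 * ((-Real.log t) ^ i * (-Real.log (1 - t)) ^ j))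
    (fun n => by fun_prop) ((ll_int i j).const_mul 2) (fun n => ?_) ?_
  · filter_upwards [ae_restrict_mem measurableSet_Ioo] with t ht
    have q1 := ht.1
    have q2 : 0 < 1 - t := by linarith [ht.2]
    have p1 : 0 ≤ -Real.log t := by linarith [Real.log_neg ht.1 ht.2]
    have p2 : 0 ≤ -Real.log (1 - t) := by linarith [Real.log_neg q2 (by linarith [ht.1])]
    rw [Real.norm_of_nonneg (by positivity)]
    have hl : t * (-Real.log t) ≤ 1 - t := by
      have := Real.one_sub_inv_le_log_of_pos q1
      have : t * (1 - t⁻¹) ≤ t * Real.log t := by gcongr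
      rw [mul_sub, mul_inv_cancel₀ q1.ne'] at this
      linarith
    have hb := npow_bound n ht
    calc ((n:ℝ)+2) * (t ^ (n+1) * ((-Real.log t) ^ (i+1) * (-Real.log (1 - t)) ^ j))
        = ((n:ℝ)+2) * t ^ n * (t * (-Real.log t)) * ((-Real.log t) ^ i * (-Real.log (1 - t)) ^ j) := by ring
      _ ≤ ((n:ℝ)+2) * t ^ n * (1 - t) * ((-Real.log t) ^ i * (-Real.log (1 - t)) ^ j) := by gcongr
      _ ≤ _ := by gcongr
  · filter_upwards [ae_restrict_mem measurableSet_Ioo] with t ht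
    have h1 := tendsto_self_mul_const_pow_of_lt_one ht.1.le ht.2
    have h2 := tendsto_pow_atTop_nhds_zero_of_lt_one ht.1.le ht.2
    have h3 := ((h1.add (h2.const_mul 2)).mul_const t).mul_const ((-Real.log t) ^ (i+1) * (-Real.log (1 - t)) ^ j)
    simp only [mul_zero, add_zero, zero_mul] at h3
    refine h3.congr fun n => ?_
    ring

lemma TT_val {r : ℕ} {f : ℕ → ℝ} (hf : f ∈ TT r) (n : ℕ) : f n ∈ Zs := by
  induction hf using Submodule.span_induction with
  | mem f h =>
    obtain ⟨u, r, hu, -, rfl⟩ := h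
    have h1 : ∀ (u : List ℕ) n r, ∃ q : ℚ, mhs u n / ((n:ℝ)+1)^r = q := by
      intro u
      induction u with
      | nil => intro n r; exact ⟨1 / ((n:ℚ)+1)^r, by simp [mhs]⟩
      | cons a u ih =>
        intro n r
        choose q hq using fun k => ih k a
        refine ⟨(∑ k ∈ range n, q k) / ((n:ℚ)+1)^r, ?_⟩
        push_cast
        simp only [mhs, hq]
    obtain ⟨q, hq⟩ := h1 u n r
    rw [tm, hq]
    exact ZA.algebraMap_mem q
  | zero => exact zero_mem _
  | add f g _ _ h1 h2 => exact add_mem h1 h2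
  | smul c f _ h => exact ZA.mul_mem c.2 h

lemma EE_symm0 (j : ℕ) : EE 0 j 0 = EE j 0 0 := by
  have e : ∀ i j, EE i j 0 = ∫ t in (0:ℝ)..1, ((-Real.log t) ^ i * (-Real.log (1 - t)) ^ j) := fun i j => by
    rw [intervalIntegral.integral_of_le zero_le_one, integral_Ioc_eq_integral_Ioo]; simp [EE]
  rw [e, e]
  have := intervalIntegral.integral_comp_sub_left (a := 0) (b := 1) (fun t : ℝ => (-Real.log t) ^ j) 1
  simpa using this

lemma nat_mul_TT (i : ℕ) {r : ℕ} {f : ℕ → ℝ} (hf : f ∈ TT r) : (fun n => (i:ℝ) * f n) ∈ TT r := 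
  TT_zmul (ZA.natCast_mem i) hf

lemma EE_of_mul {f : ℕ → ℝ} (h : (fun n : ℕ => ((n:ℝ)+1) * f n) ∈ TT 0) : f ∈ TT 1 := by
  have := TT_div h
  convert this using 1
  ext n
  have : ((n:ℝ)+1) ≠ 0 := by positivity
  field_simp

lemma EE_step (i j : ℕ) (h1 : 1 ≤ i → EE (i-1) j ∈ TT 1) (h2 : 1 ≤ j → EE i (j-1) ∈ TT 1)
    (h3 : i = 0 → EE 0 j 0 ∈ Zs) : EE i j ∈ TT 1 := by
  set g : ℕ → ℝ := fun n => (i * EE (i-1) j n + j * (PP 0 (EE i (j-1)) n + EE i (j-1) n)) with hg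
  have hgT : g ∈ TT 0 := by
    refine add_mem (a := fun n => i * EE (i-1) j n) (b := fun n => j * (PP 0 (EE i (j-1)) n + EE i (j-1) n)) ?_ ?_
    · rcases Nat.eq_zero_or_pos i with h | h
      · subst h; simp only [Nat.cast_zero, zero_mul]; exact zero_mem _
      · exact nat_mul_TT i (TT_mono (Nat.zero_le 1) (h1 h))
    · rcases Nat.eq_zero_or_pos j with h | h
      · subst h; simp only [Nat.cast_zero, zero_mul]; exact zero_mem _
      · exact nat_mul_TT j (add_mem (PP_TT (r := 1) (by omega) (h2 h)) (TT_mono (Nat.zero_le 1) (h2 h)))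
  set K := (EE i j 0 - i * EE (i-1) j 0 - j * EE i (j-1) 0) with hK
  have hcl : (fun n : ℕ => ((n:ℝ)+1) * EE i j n) = fun n => K + g n := by
    ext n; rw [EE_closed]
  have hKz : K ∈ Zs := by
    rcases Nat.eq_zero_or_pos i with h | h
    · subst h
      rw [hK]
      simp only [Nat.cast_zero, zero_mul, sub_zero]
      refine sub_mem (h3 rfl) ?_
      rcases Nat.eq_zero_or_pos j with h | h
      · subst h; simp
      · exact TT_val (nat_mul_TT j (h2 h)) 0
    · obtain ⟨i, rfl⟩ : ∃ a', i = a' + 1 := ⟨i - 1, by omega⟩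
      have hl := EE_lim i j
      rw [hcl] at hl
      have : Tendsto g atTop (𝓝 (-K)) := by
        have := hl.sub_const K
        rw [zero_sub] at this
        exact this.congr fun n => by ring
      have := TT_limit hgT this
      simpa using neg_mem this
  refine EE_of_mul ?_
  rw [hcl]
  exact add_mem (TT_const hKz) hgT

lemma EE_j0 (i : ℕ) : EE i 0 ∈ TT 1 := by
  induction i with
  | zero =>
    refine EE_step 0 0 (by simp) (by simp) (fun _ => ?_)
    have : EE 0 0 0 = 1 := by simp [EE]
    rw [this]; exact Zs_one
  | succ i ih => exact EE_step (i+1) 0 (fun _ => ih) (by simp) (by simp)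

lemma EE_mem (i j : ℕ) : EE i j ∈ TT 1 := by
  induction j generalizing i with
  | zero => exact EE_j0 i
  | succ j ihj =>
    induction i with
    | zero =>
      refine EE_step 0 (j+1) (by simp) (fun _ => ihj 0) (fun _ => ?_)
      rw [EE_symm0]; exact TT_val (EE_j0 _) 0
    | succ i ih => exact EE_step (i+1) (j+1) (fun _ => ih) (fun _ => ihj _) (by simp)

def gf (c : ℕ → ℝ) (z : ℝ) : ENNReal := ∑' n, ENNReal.ofReal (c n * z ^ n)

lemma cv_nonneg {c d : ℕ → ℝ} (hc : ∀ n, 0 ≤ c n) (hd : ∀ n, 0 ≤ d n) (n : ℕ) : 0 ≤ cv c d n := by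
  cases n with
  | zero => simp [cv]
  | succ n => exact sum_nonneg fun p _ => mul_nonneg (hc _) (hd _)

lemma gf_succ (c : ℕ → ℝ) {z : ℝ} (hz : 0 ≤ z) (h0 : c 0 = 0) :
    gf c z = ENNReal.ofReal z * gf (fun n => c (n+1)) z := by
  rw [gf, tsum_eq_zero_add' ENNReal.summable, gf, ← ENNReal.tsum_mul_left]
  simp only [h0, zero_mul, ENNReal.ofReal_zero, zero_add]
  refine tsum_congr fun n => ?_
  rw [← ENNReal.ofReal_mul hz]; congr 1; ring

lemma gf_cv {c d : ℕ → ℝ} (hc : ∀ n, 0 ≤ c n) (hd : ∀ n, 0 ≤ d n) {z : ℝ} (hz : 0 ≤ z) :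
    gf (cv c d) z = ENNReal.ofReal z * (gf c z * gf d z) := by
  rw [gf_succ _ hz (by simp [cv])]
  congr 1
  simp only [gf]
  rw [← ENNReal.tsum_mul_right]
  simp_rw [← ENNReal.tsum_mul_left]
  rw [← ENNReal.tsum_prod (f := fun i j => ENNReal.ofReal (c i * z ^ i) * ENNReal.ofReal (d j * z ^ j)),
    ← HasAntidiagonal.sigmaAntidiagonalEquivProd.tsum_eq (_ : ℕ × ℕ → ENNReal), ENNReal.tsum_sigma']
  refine tsum_congr fun n => ?_
  rw [tsum_fintype, cv, sum_mul, ENNReal.ofReal_sum_of_nonneg]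
  · rw [← Finset.sum_coe_sort]
    refine sum_congr rfl fun p _ => ?_
    have hp := HasAntidiagonal.mem_antidiagonal.1 p.2
    rw [← ENNReal.ofReal_mul (mul_nonneg (hc _) (by positivity))]
    congr 1
    have h2 : z ^ n = z ^ p.1.1 * z ^ p.1.2 := by rw [← pow_add, hp]
    rw [h2]; simp only [HasAntidiagonal.sigmaAntidiagonalEquivProd_apply]; ring
  · intro p _
    exact mul_nonneg (mul_nonneg (hc _) (hd _)) (by positivity)

/-- coefficients of powers of `-log(1-z)`, divided by `z` -/
def AA : ℕ → ℕ → ℝ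
  | 0 => tm [] 1
  | (k+1) => cv (tm [] 1) (AA k)

def hh : ℕ → ℕ → ℝ
  | 0 => fun _ => 1
  | (k+1) => cv (fun _ => 1) (AA k)

lemma tm_nonneg (u : List ℕ) (r n : ℕ) : 0 ≤ tm u r n := div_nonneg (mhs_nonneg _ _) (by positivity)

lemma AA_nonneg (k n : ℕ) : 0 ≤ AA k n := by
  induction k generalizing n with
  | zero => exact tm_nonneg _ _ _
  | succ k ih => exact cv_nonneg (tm_nonneg _ _) ih n

lemma hh_nonneg (k n : ℕ) : 0 ≤ hh k n := by
  cases k with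
  | zero => simp [hh]
  | succ k => exact cv_nonneg (fun _ => zero_le_one) (AA_nonneg k) n

lemma AA_mem (k : ℕ) : AA k ∈ TT 1 := by
  induction k with
  | zero => exact tm_mem PosW.nil le_rfl
  | succ k ih => exact cv_mem (tm_mem PosW.nil le_rfl) ih

lemma hh_mem (k : ℕ) : hh k ∈ TT 0 := by
  cases k with
  | zero => exact TT_const Zs_one
  | succ k => rw [hh, cv_one]; exact PP_TT (r := 1) (by omega) (AA_mem k)

lemma gf_log {z : ℝ} (hz : z ∈ Set.Ioo (0:ℝ) 1) :
    ENNReal.ofReal z * gf (tm [] 1) z = ENNReal.ofReal (-Real.log (1 - z)) := by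
  have h := Real.hasSum_pow_div_log_of_abs_lt_one (x := z) (by rw [abs_of_pos hz.1]; exact hz.2)
  have h2 := hz.1
  rw [gf, ← ENNReal.tsum_mul_left, ← h.tsum_eq, ENNReal.ofReal_tsum_of_nonneg _ h.summable]
  · refine tsum_congr fun n => ?_
    rw [← ENNReal.ofReal_mul hz.1.le]; congr 1
    simp [tm, mhs]; field_simp
    ring
  · intro n; positivity

lemma gf_AA (k : ℕ) {z : ℝ} (hz : z ∈ Set.Ioo (0:ℝ) 1) :
    ENNReal.ofReal z * gf (AA k) z = ENNReal.ofReal ((-Real.log (1 - z)) ^ (k+1)) := by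
  have p2 : 0 ≤ -Real.log (1 - z) := by
    linarith [Real.log_neg (by linarith [hz.2] : 0 < 1 - z) (by linarith [hz.1])]
  induction k with
  | zero => rw [zero_add, pow_one]; exact gf_log hz
  | succ k ih =>
    rw [AA, gf_cv (tm_nonneg _ _) (AA_nonneg k) hz.1.le, pow_succ, ENNReal.ofReal_mul (by positivity), ← ih,
      ← gf_log hz]
    ring

lemma gf_one {z : ℝ} (hz : z ∈ Set.Ioo (0:ℝ) 1) : gf (fun _ => 1) z = ENNReal.ofReal (1 / (1 - z)) := by
  have h := hasSum_geometric_of_lt_one hz.1.le hz.2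
  rw [gf, one_div, ← h.tsum_eq, ENNReal.ofReal_tsum_of_nonneg _ h.summable]
  · simp
  · intro n; exact pow_nonneg hz.1.le n

lemma gf_hh (k : ℕ) {z : ℝ} (hz : z ∈ Set.Ioo (0:ℝ) 1) :
    gf (hh k) z = ENNReal.ofReal ((-Real.log (1 - z)) ^ k / (1 - z)) := by
  have p2 : 0 ≤ -Real.log (1 - z) := by
    linarith [Real.log_neg (by linarith [hz.2] : 0 < 1 - z) (by linarith [hz.1])]
  cases k with
  | zero => rw [hh, gf_one hz, pow_zero]
  | succ k =>
    rw [hh, gf_cv (fun _ => zero_le_one) (AA_nonneg k) hz.1.le, gf_one hz, mul_left_comm, gf_AA k hz,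
      ← ENNReal.ofReal_mul (by have := hz.2; have : 0 < 1 - z := by linarith
                               positivity)]
    congr 1; ring

lemma EE_lint (i j n : ℕ) : ∫⁻ t in Set.Ioo (0:ℝ) 1,
    ENNReal.ofReal (t ^ n * ((-Real.log t) ^ i * (-Real.log (1 - t)) ^ j)) = ENNReal.ofReal (EE i j n) := by
  rw [EE, ofReal_integral_eq_lintegral_ofReal (EE_int i j n)]
  filter_upwards [ae_restrict_mem measurableSet_Ioo] with t ht
  have p1 : 0 ≤ -Real.log t := by linarith [Real.log_neg ht.1 ht.2]
  have p2 : 0 ≤ -Real.log (1 - t) := by linarith [Real.log_neg (by linarith [ht.2] : 0 < 1 - t) (by linarith [ht.1])]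
  have := ht.1
  simp only [Pi.zero_apply]
  positivity

def PsiI3 (i j k : ℕ) (X : ℝ) : ENNReal := ∫⁻ t in Set.Ioo (0:ℝ) 1,
  ENNReal.ofReal ((-Real.log t) ^ i * (-Real.log (1 - t)) ^ j * ((-Real.log (1 - X * t)) ^ k / (1 - X * t)))

/-- weighting a generating function against logs -/
lemma gf_weight (i j : ℕ) {c : ℕ → ℝ} (hc : ∀ n, 0 ≤ c n) (X : ℝ) (hX : 0 ≤ X) :
    ∫⁻ t in Set.Ioo (0:ℝ) 1, ENNReal.ofReal ((-Real.log t) ^ i * (-Real.log (1 - t)) ^ j) * gf c (X * t)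
      = gf (fun n => c n * EE i j n) X := by
  simp only [gf, ← ENNReal.tsum_mul_left]
  rw [lintegral_tsum]
  · refine tsum_congr fun n => ?_
    rw [mul_right_comm, ENNReal.ofReal_mul (mul_nonneg (hc n) (by positivity)), ← EE_lint,
      ← lintegral_const_mul' _ _ ENNReal.ofReal_ne_top]
    refine setLIntegral_congr_fun measurableSet_Ioo fun t ht => ?_
    have p1 : 0 ≤ -Real.log t := by linarith [Real.log_neg ht.1 ht.2]
    have p2 : 0 ≤ -Real.log (1 - t) := by linarith [Real.log_neg (by linarith [ht.2] : 0 < 1 - t) (by linarith [ht.1])]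
    have := ht.1
    have := hc n
    rw [← ENNReal.ofReal_mul (by positivity), ← ENNReal.ofReal_mul (by positivity)]
    congr 1; ring
  · intro n; fun_prop

lemma PsiI3_eq (i j k : ℕ) {X : ℝ} (hX : X ∈ Set.Ioo (0:ℝ) 1) :
    PsiI3 i j k X = gf (fun n => hh k n * EE i j n) X := by
  rw [← gf_weight i j (hh_nonneg k) X hX.1.le, PsiI3]
  refine setLIntegral_congr_fun measurableSet_Ioo fun t ht => ?_
  have p1 : 0 ≤ -Real.log t := by linarith [Real.log_neg ht.1 ht.2]
  have p2 : 0 ≤ -Real.log (1 - t) := by linarith [Real.log_neg (by linarith [ht.2] : 0 < 1 - t) (by linarith [ht.1])]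
  have hz : X * t ∈ Set.Ioo (0:ℝ) 1 := ⟨mul_pos hX.1 ht.1, by nlinarith [hX.1, hX.2, ht.1, ht.2]⟩
  rw [gf_hh k hz, ← ENNReal.ofReal_mul (by positivity)]

def Jmon (i0 j0 i1 j1 k1 i2 j2 k2 i3 j3 k3 : ℕ) : ENNReal :=
  ∫⁻ X in Set.Ioo (0:ℝ) 1, ENNReal.ofReal (X * ((-Real.log X) ^ i0 * (-Real.log (1 - X)) ^ j0)) *
    (PsiI3 i1 j1 k1 X * PsiI3 i2 j2 k2 X * PsiI3 i3 j3 k3 X)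

lemma Jmon_mem (i0 j0 i1 j1 k1 i2 j2 k2 i3 j3 k3 : ℕ)
    (hfin : Jmon i0 j0 i1 j1 k1 i2 j2 k2 i3 j3 k3 ≠ ⊤) :
    (Jmon i0 j0 i1 j1 k1 i2 j2 k2 i3 j3 k3).toReal ∈ Zs := by
  set p1 : ℕ → ℝ := fun n => hh k1 n * EE i1 j1 n with hp1
  set p2 : ℕ → ℝ := fun n => hh k2 n * EE i2 j2 n with hp2
  set p3 : ℕ → ℝ := fun n => hh k3 n * EE i3 j3 n with hp3
  have m : ∀ i j k, (fun n => hh k n * EE i j n) ∈ TT 1 := fun i j k => by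
    have := TT_mul (hh_mem k) (EE_mem i j)
    rwa [zero_add] at this
  have nn : ∀ i j k n, 0 ≤ hh k n * EE i j n := fun i j k n => mul_nonneg (hh_nonneg _ _) (EE_nonneg _ _ _)
  set c := cv (cv p1 p2) p3 with hc
  have hcm : c ∈ TT 1 := cv_mem (cv_mem (m _ _ _) (m _ _ _)) (m _ _ _)
  have hcn : ∀ n, 0 ≤ c n := cv_nonneg (cv_nonneg (nn _ _ _) (nn _ _ _)) (nn _ _ _)
  have key : ∀ X ∈ Set.Ioo (0:ℝ) 1, ENNReal.ofReal X * (PsiI3 i1 j1 k1 X * PsiI3 i2 j2 k2 X * PsiI3 i3 j3 k3 X)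
      = gf (fun n => c (n+1)) X := by
    intro X hX
    have h0 : ENNReal.ofReal X ≠ 0 := by simpa using hX.1
    rw [← ENNReal.mul_right_inj h0 ENNReal.ofReal_ne_top, ← gf_succ c hX.1.le (by simp [hc, cv]), hc,
      gf_cv (cv_nonneg (nn _ _ _) (nn _ _ _)) (nn _ _ _) hX.1.le, gf_cv (nn _ _ _) (nn _ _ _) hX.1.le,
      PsiI3_eq _ _ _ hX, PsiI3_eq _ _ _ hX, PsiI3_eq _ _ _ hX]
    ring
  have hJ : Jmon i0 j0 i1 j1 k1 i2 j2 k2 i3 j3 k3 = ∑' n, ENNReal.ofReal (c (n+1) * EE i0 j0 n) := by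
    have hw := gf_weight i0 j0 (c := fun n => c (n+1)) (fun n => hcn _) 1 zero_le_one
    simp only [gf, one_pow, mul_one] at hw
    rw [← hw, Jmon]
    refine setLIntegral_congr_fun measurableSet_Ioo fun t ht => ?_
    have h1 : 0 ≤ -Real.log t := by linarith [Real.log_neg ht.1 ht.2]
    have h2 : 0 ≤ -Real.log (1 - t) := by linarith [Real.log_neg (by linarith [ht.2] : 0 < 1 - t) (by linarith [ht.1])]
    simp only [one_mul]
    have := key t ht
    simp only [gf] at this
    rw [← this, ENNReal.ofReal_mul ht.1.le]
    ring
  have tn : ∀ n, 0 ≤ c (n+1) * EE i0 j0 n := fun n => mul_nonneg (hcn _) (EE_nonneg _ _ _)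
  rw [hJ] at hfin ⊢
  have hs : Summable fun n => c (n+1) * EE i0 j0 n := by
    have := ENNReal.summable_toReal hfin
    refine this.congr fun n => ENNReal.toReal_ofReal (tn n)
  have ht := hs.hasSum.tendsto_sum_nat
  have := TT_limit (pair_mem hcm (EE_mem i0 j0)) ht
  rwa [← ENNReal.ofReal_tsum_of_nonneg tn hs, ENNReal.toReal_ofReal (tsum_nonneg tn)]

/-- Moebius substitution -/
lemma mob_sub {K : ℝ} (hK : 0 < K) (f : ℝ → ENNReal) :
    ∫⁻ x in Set.Ioi (0:ℝ), f x = ∫⁻ t in Set.Ioo (0:ℝ) 1,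
      ENNReal.ofReal (Real.exp (Real.log K - 2 * Real.log (1 - t))) * f (K * t / (1 - t)) := by
  have him : (fun t : ℝ => K * t / (1 - t)) '' Set.Ioo 0 1 = Set.Ioi 0 := by
    ext x
    constructor
    · rintro ⟨t, ht, rfl⟩
      exact div_pos (mul_pos hK ht.1) (by linarith [ht.2])
    · intro hx
      have hx : 0 < x := hx
      refine ⟨x / (K + x), ⟨by positivity, by rw [div_lt_one (by positivity)]; linarith⟩, ?_⟩
      have : 1 - x / (K + x) = K / (K + x) := by field_simp; ring
      simp only [this]
      field_simp
  have hinj : Set.InjOn (fun t : ℝ => K * t / (1 - t)) (Set.Ioo 0 1) := by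
    intro s hs t ht h
    have h1 : 1 - s ≠ 0 := by linarith [hs.2]
    have h2 : 1 - t ≠ 0 := by linarith [ht.2]
    simp only at h
    rw [div_eq_div_iff h1 h2] at h
    have : K * (s - t) = 0 := by linarith
    rcases mul_eq_zero.1 this with h | h <;> linarith
  have hd : ∀ t ∈ Set.Ioo (0:ℝ) 1, HasDerivWithinAt (fun t : ℝ => K * t / (1 - t)) (K / (1 - t)^2) (Set.Ioo 0 1) t := by
    intro t ht
    have h2 : 1 - t ≠ 0 := by linarith [ht.2]
    have := (((hasDerivAt_id t).const_mul K).div ((hasDerivAt_id t).const_sub 1) h2)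
    refine HasDerivAt.hasDerivWithinAt ?_
    have e : K / (1 - t)^2 = (K * 1 * (1 - id t) - K * id t * -1) / (1 - id t) ^ 2 := by
      congr 1; simp only [id]; ring
    rw [e]; exact this
  rw [← him, lintegral_image_eq_lintegral_abs_deriv_mul measurableSet_Ioo hd hinj]
  refine setLIntegral_congr_fun measurableSet_Ioo fun t ht => ?_
  have h2 : 0 < 1 - t := by linarith [ht.2]
  have : Real.exp (Real.log K - 2 * Real.log (1 - t)) = K / (1 - t)^2 := by
    rw [Real.exp_sub, Real.exp_log hK, mul_comm, Real.exp_mul, Real.exp_log h2]; norm_num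
  rw [this, abs_of_pos (by positivity)]

lemma scale_sub {K : ℝ} (hK : 0 < K) (f : ℝ → ENNReal) :
    ∫⁻ x in Set.Ioi (0:ℝ), f x = ∫⁻ t in Set.Ioi (0:ℝ), ENNReal.ofReal (Real.exp (Real.log K)) * f (K * t) := by
  have him : (fun t : ℝ => K * t) '' Set.Ioi 0 = Set.Ioi 0 := by
    ext x
    constructor
    · rintro ⟨t, ht, rfl⟩
      exact mul_pos hK ht
    · intro hx
      exact ⟨x / K, div_pos hx hK, by field_simp⟩
  have hinj : Set.InjOn (fun t : ℝ => K * t) (Set.Ioi 0) := by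
    intro s hs t ht h
    exact mul_left_cancel₀ hK.ne' h
  have hd : ∀ t ∈ Set.Ioi (0:ℝ), HasDerivWithinAt (fun t : ℝ => K * t) K (Set.Ioi 0) t := by
    intro t ht
    simpa using ((hasDerivAt_id t).const_mul K).hasDerivWithinAt
  conv_lhs => rw [← him]
  rw [lintegral_image_eq_lintegral_abs_deriv_mul measurableSet_Ioi hd hinj, Real.exp_log hK, abs_of_pos hK]

lemma gam_lint {z r : ℝ} (hz : -1 < z) (hr : 0 < r) :
    ∫⁻ x in Set.Ioi (0:ℝ), ENNReal.ofReal (Real.exp (z * Real.log x - r * x))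
      = ENNReal.ofReal (Real.Gamma (1 + z)) * ENNReal.ofReal (Real.exp (-(1 + z) * Real.log r)) := by
  have h1 := Real.integral_rpow_mul_exp_neg_mul_Ioi (a := 1 + z) (by linarith) hr
  have h2 : (1 / r) ^ (1 + z) = Real.exp (-(1 + z) * Real.log r) := by
    rw [Real.rpow_def_of_pos (by positivity), one_div, Real.log_inv]; ring_nf
  rw [h2] at h1
  have hne : ∫ t in Set.Ioi (0:ℝ), t ^ (1 + z - 1) * Real.exp (-(r * t)) ≠ 0 := by
    rw [h1]; exact mul_ne_zero (Real.exp_pos _).ne' (Real.Gamma_pos_of_pos (by linarith)).ne'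
  have hint := not_imp_comm.1 integral_undef hne
  rw [← ENNReal.ofReal_mul (Real.Gamma_pos_of_pos (by linarith)).le, mul_comm (Real.Gamma _),
    ← h1, ofReal_integral_eq_lintegral_ofReal hint]
  · refine setLIntegral_congr_fun measurableSet_Ioi fun t ht => ?_
    have ht : 0 < t := ht
    rw [Real.rpow_def_of_pos ht, ← Real.exp_add]; ring_nf
  · filter_upwards [self_mem_ae_restrict measurableSet_Ioi] with t ht
    have ht : 0 < t := ht
    positivity

abbrev mI : Measure ℝ := volume.restrict (Set.Ioi (0:ℝ))
abbrev mQ : Measure ℝ := volume.restrict (Set.Ioo (0:ℝ) 1)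

lemma swap22 {α β γ δ : Type*} [MeasurableSpace α] [MeasurableSpace β] [MeasurableSpace γ] [MeasurableSpace δ]
    (μ : Measure α) (ν : Measure β) (ρ : Measure γ) (σ : Measure δ) [SFinite μ] [SFinite ν] [SFinite ρ] [SFinite σ]
    (f : α → β → γ → δ → ENNReal) (hf : Measurable fun p : (α × β) × (γ × δ) => f p.1.1 p.1.2 p.2.1 p.2.2) :
    ∫⁻ a, ∫⁻ b, ∫⁻ c, ∫⁻ d, f a b c d ∂σ ∂ρ ∂ν ∂μ = ∫⁻ c, ∫⁻ d, ∫⁻ a, ∫⁻ b, f a b c d ∂ν ∂μ ∂σ ∂ρ := by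
  have h1 : ∀ a b, ∫⁻ c, ∫⁻ d, f a b c d ∂σ ∂ρ = ∫⁻ z, f a b z.1 z.2 ∂(ρ.prod σ) := by
    intro a b
    exact (lintegral_prod _ (hf.comp (measurable_const.prodMk measurable_id : Measurable fun z : γ × δ => ((a, b), z))).aemeasurable).symm
  have h2 : ∀ c d, ∫⁻ a, ∫⁻ b, f a b c d ∂ν ∂μ = ∫⁻ z, f z.1 z.2 c d ∂(μ.prod ν) := by
    intro c d
    exact (lintegral_prod _ (hf.comp (measurable_id.prodMk measurable_const : Measurable fun z : α × β => (z, (c, d)))).aemeasurable).symm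
  simp only [h1, h2]
  rw [← lintegral_prod (fun p : α × β => ∫⁻ z, f p.1 p.2 z.1 z.2 ∂(ρ.prod σ)),
    ← lintegral_prod (fun p : γ × δ => ∫⁻ z, f z.1 z.2 p.1 p.2 ∂(μ.prod ν)), lintegral_lintegral_swap]
  · exact hf.aemeasurable
  · exact (Measurable.lintegral_prod_right' (f := fun q : (γ × δ) × (α × β) => f q.2.1 q.2.2 q.1.1 q.1.2) (hf.comp measurable_swap)).aemeasurable
  · exact (Measurable.lintegral_prod_right' hf).aemeasurable

lemma swap12 {α β γ : Type*} [MeasurableSpace α] [MeasurableSpace β] [MeasurableSpace γ]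
    (μ : Measure α) (ν : Measure β) (ρ : Measure γ) [SFinite μ] [SFinite ν] [SFinite ρ]
    (f : α → β → γ → ENNReal) (hf : Measurable fun p : α × (β × γ) => f p.1 p.2.1 p.2.2) :
    ∫⁻ a, ∫⁻ b, ∫⁻ c, f a b c ∂ρ ∂ν ∂μ = ∫⁻ b, ∫⁻ c, ∫⁻ a, f a b c ∂μ ∂ρ ∂ν := by
  have h1 : ∀ a, ∫⁻ c, ∫⁻ d, f a c d ∂ρ ∂ν = ∫⁻ z, f a z.1 z.2 ∂(ν.prod ρ) := by
    intro a
    exact (lintegral_prod _ (hf.comp (measurable_const.prodMk measurable_id : Measurable fun z : β × γ => (a, z))).aemeasurable).symm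
  simp only [h1]
  rw [lintegral_lintegral_swap, lintegral_prod]
  · exact (Measurable.lintegral_prod_left' hf).aemeasurable
  · exact hf.aemeasurable

lemma swap23 {α β γ δ ε : Type*} [MeasurableSpace α] [MeasurableSpace β] [MeasurableSpace γ] [MeasurableSpace δ]
    [MeasurableSpace ε]
    (μ : Measure α) (ν : Measure β) (ρ : Measure γ) (σ : Measure δ) (τ : Measure ε)
    [SFinite μ] [SFinite ν] [SFinite ρ] [SFinite σ] [SFinite τ]
    (f : α → β → γ → δ → ε → ENNReal)
    (hf : Measurable fun p : (α × β) × (γ × (δ × ε)) => f p.1.1 p.1.2 p.2.1 p.2.2.1 p.2.2.2) :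
    ∫⁻ a, ∫⁻ b, ∫⁻ c, ∫⁻ d, ∫⁻ e, f a b c d e ∂τ ∂σ ∂ρ ∂ν ∂μ
      = ∫⁻ c, ∫⁻ d, ∫⁻ e, ∫⁻ a, ∫⁻ b, f a b c d e ∂ν ∂μ ∂τ ∂σ ∂ρ := by
  have h1 : ∀ a b c, ∫⁻ d, ∫⁻ e, f a b c d e ∂τ ∂σ = ∫⁻ z, f a b c z.1 z.2 ∂(σ.prod τ) := by
    intro a b c
    exact (lintegral_prod _ (hf.comp (by fun_prop : Measurable fun z : δ × ε => ((a, b), (c, z)))).aemeasurable).symm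
  simp only [h1]
  rw [swap22 _ _ _ _ (fun a b c (z : δ × ε) => f a b c z.1 z.2) hf]
  refine lintegral_congr fun c => ?_
  rw [lintegral_prod]
  have := hf.comp (by fun_prop : Measurable fun z : ((δ × ε) × α) × β => ((z.1.2, z.2), (c, z.1.1)))
  exact (Measurable.lintegral_prod_right' (Measurable.lintegral_prod_right' this)).aemeasurable

lemma prod2 {μ ν : Measure ℝ} (c : ℝ) {f g : ℝ → ℝ} (hf : Measurable f) (hg : Measurable g) :
    ∫⁻ x, ∫⁻ y, ENNReal.ofReal (Real.exp (c + f x + g y)) ∂ν ∂μ = ENNReal.ofReal (Real.exp c) *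
      (∫⁻ x, ENNReal.ofReal (Real.exp (f x)) ∂μ) * (∫⁻ y, ENNReal.ofReal (Real.exp (g y)) ∂ν) := by
  simp_rw [Real.exp_add, ENNReal.ofReal_mul (mul_nonneg (Real.exp_pos _).le (Real.exp_pos _).le),
    ENNReal.ofReal_mul (Real.exp_pos _).le]
  simp_rw [lintegral_const_mul _ (by fun_prop : Measurable fun y => ENNReal.ofReal (Real.exp (g y)))]
  rw [lintegral_mul_const _ (by fun_prop), lintegral_const_mul _ (by fun_prop)]

lemma prod3 {μ ν ρ : Measure ℝ} (c : ℝ) {f g h : ℝ → ℝ} (hf : Measurable f) (hg : Measurable g) (hh : Measurable h) :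
    ∫⁻ x, ∫⁻ y, ∫⁻ z, ENNReal.ofReal (Real.exp (c + f x + g y + h z)) ∂ρ ∂ν ∂μ = ENNReal.ofReal (Real.exp c) *
      (∫⁻ x, ENNReal.ofReal (Real.exp (f x)) ∂μ) * (∫⁻ y, ENNReal.ofReal (Real.exp (g y)) ∂ν) *
      (∫⁻ z, ENNReal.ofReal (Real.exp (h z)) ∂ρ) := by
  simp_rw [prod2 _ hg hh, mul_assoc]
  rw [lintegral_mul_const _ (by fun_prop)]
  simp_rw [Real.exp_add, ENNReal.ofReal_mul (Real.exp_pos _).le]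
  rw [lintegral_const_mul _ (by fun_prop)]
  ring

lemma HH_step1 {p q : ℝ} (hp : 0 < p) (hq : 0 < q) {u v w a b : ℝ} (hu : u < 1) (hv : v < 1) (hw : w < 1)
    (ha : -1 < a) (hb : -1 < b) :
    ENNReal.ofReal (Real.Gamma (1 - u)) * ENNReal.ofReal (Real.Gamma (1 - v)) * ENNReal.ofReal (Real.Gamma (1 - w)) *
    ∫⁻ B, ∫⁻ A, ENNReal.ofReal (Real.exp (a * Real.log A + b * Real.log B + (u - 1) * Real.log (1 + A + B)
      + (v - 1) * Real.log (p * A + q * B) + (w - 1) * Real.log (1 + (p * A + q * B)))) ∂mI ∂mI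
    = ENNReal.ofReal (Real.Gamma (1 + a)) * ENNReal.ofReal (Real.Gamma (1 + b)) *
    ∫⁻ l, ∫⁻ n, ∫⁻ o, ENNReal.ofReal (Real.exp (-u * Real.log l - l - v * Real.log n - w * Real.log o - o
      - (1 + a) * Real.log (l + (n + o) * p) - (1 + b) * Real.log (l + (n + o) * q))) ∂mI ∂mI ∂mI := by
  rw [← lintegral_const_mul' _ _ (by finiteness)]
  have e1 : ∀ B ∈ Set.Ioi (0:ℝ), ENNReal.ofReal (Real.Gamma (1 - u)) * ENNReal.ofReal (Real.Gamma (1 - v)) * ENNReal.ofReal (Real.Gamma (1 - w)) *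
    (∫⁻ A, ENNReal.ofReal (Real.exp (a * Real.log A + b * Real.log B + (u - 1) * Real.log (1 + A + B)
      + (v - 1) * Real.log (p * A + q * B) + (w - 1) * Real.log (1 + (p * A + q * B)))) ∂mI)
    = ∫⁻ A, ∫⁻ l, ∫⁻ n, ∫⁻ o, ENNReal.ofReal (Real.exp ((a * Real.log A + b * Real.log B) + (-u * Real.log l - (1 + A + B) * l)
        + (-v * Real.log n - (p * A + q * B) * n) + (-w * Real.log o - (1 + (p * A + q * B)) * o))) ∂mI ∂mI ∂mI ∂mI := by
    intro B hB
    have hB : 0 < B := hB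
    rw [← lintegral_const_mul' _ _ (by finiteness)]
    refine setLIntegral_congr_fun measurableSet_Ioi fun A hA => ?_
    have hA : 0 < A := hA
    rw [prod3 _ (by fun_prop) (by fun_prop) (by fun_prop), gam_lint (by linarith) (by positivity),
      gam_lint (by linarith) (by positivity), gam_lint (by linarith) (by positivity)]
    simp only [← sub_eq_add_neg]
    have : ∀ x y z f g h k : ENNReal, f * (x * g) * (y * h) * (z * k) = x * y * z * (f * g * h * k) := by intros; ring
    rw [this]
    congr 1
    simp only [← ENNReal.ofReal_mul (Real.exp_pos _).le, ← Real.exp_add]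
    congr 2
    ring
  rw [setLIntegral_congr_fun measurableSet_Ioi e1, swap23 _ _ _ _ _ (fun B A l n o => ENNReal.ofReal (Real.exp ((a * Real.log A + b * Real.log B) + (-u * Real.log l - (1 + A + B) * l)
        + (-v * Real.log n - (p * A + q * B) * n) + (-w * Real.log o - (1 + (p * A + q * B)) * o)))) (by fun_prop)]
  rw [← lintegral_const_mul' _ _ (by finiteness)]
  refine setLIntegral_congr_fun measurableSet_Ioi fun l hl => ?_
  rw [← lintegral_const_mul' _ _ (by finiteness)]
  refine setLIntegral_congr_fun measurableSet_Ioi fun n hn => ?_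
  rw [← lintegral_const_mul' _ _ (by finiteness)]
  refine setLIntegral_congr_fun measurableSet_Ioi fun o ho => ?_
  have hl : 0 < l := hl
  have hn : 0 < n := hn
  have ho : 0 < o := ho
  have := prod2 (μ := mI) (ν := mI) (-u * Real.log l - l - v * Real.log n - w * Real.log o - o)
    (f := fun B => b * Real.log B - (l + (n + o) * q) * B) (g := fun A => a * Real.log A - (l + (n + o) * p) * A)
    (by fun_prop) (by fun_prop)
  rw [gam_lint hb (by positivity), gam_lint ha (by positivity)] at this
  trans
  · trans
    swap
    · exact this
    refine lintegral_congr fun B => lintegral_congr fun A => ?_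
    congr 2; ring
  · have : ∀ x y f g h : ENNReal, f * (x * g) * (y * h) = y * x * (f * g * h) := by intros; ring
    rw [this]
    congr 1
    simp only [← ENNReal.ofReal_mul (Real.exp_pos _).le, ← Real.exp_add]
    congr 2
    ring

lemma HH_step2 {p q : ℝ} (hp : 0 < p) (hq : 0 < q) {u v w a b h : ℝ}
    (hh : -1 < h) (he : a + b + h = - u - v - w) :
    ∫⁻ l, ∫⁻ n, ∫⁻ o, ENNReal.ofReal (Real.exp (-u * Real.log l - l - v * Real.log n - w * Real.log o - o
      - (1 + a) * Real.log (l + (n + o) * p) - (1 + b) * Real.log (l + (n + o) * q))) ∂mI ∂mI ∂mI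
    = ENNReal.ofReal (Real.Gamma (1 + h)) * ∫⁻ n, ∫⁻ o, ENNReal.ofReal (Real.exp (- v * Real.log n - w * Real.log o
      - (1 + h) * Real.log (1 + o)
      - (1 + a) * Real.log (1 + (n + o) * p) - (1 + b) * Real.log (1 + (n + o) * q))) ∂mI ∂mI := by
  have e1 : ∀ l ∈ Set.Ioi (0:ℝ), ∫⁻ n, ∫⁻ o, ENNReal.ofReal (Real.exp (-u * Real.log l - l - v * Real.log n - w * Real.log o - o
      - (1 + a) * Real.log (l + (n + o) * p) - (1 + b) * Real.log (l + (n + o) * q))) ∂mI ∂mI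
      = ∫⁻ n, ∫⁻ o, ENNReal.ofReal (Real.exp ((h * Real.log l - (1 + o) * l) + (- v * Real.log n - w * Real.log o
      - (1 + a) * Real.log (1 + (n + o) * p) - (1 + b) * Real.log (1 + (n + o) * q)))) ∂mI ∂mI := by
    intro l hl
    have hl : 0 < l := hl
    rw [scale_sub hl]
    refine setLIntegral_congr_fun measurableSet_Ioi fun n hn => ?_
    have hn : 0 < n := hn
    rw [scale_sub hl, ← lintegral_const_mul' _ _ (by finiteness)]
    refine setLIntegral_congr_fun measurableSet_Ioi fun o ho => ?_
    have ho : 0 < o := ho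
    simp only [← ENNReal.ofReal_mul (Real.exp_pos _).le, ← Real.exp_add]
    have h1 : l + (l * n + l * o) * p = l * (1 + (n + o) * p) := by ring
    have h2 : l + (l * n + l * o) * q = l * (1 + (n + o) * q) := by ring
    rw [h1, h2, Real.log_mul hl.ne' (by positivity : 1 + (n + o) * p ≠ 0), Real.log_mul hl.ne' (by positivity : 1 + (n + o) * q ≠ 0),
      Real.log_mul hl.ne' hn.ne', Real.log_mul hl.ne' ho.ne']
    congr 2
    rw [show h = - u - v - w - a - b by linarith]
    ring
  rw [setLIntegral_congr_fun measurableSet_Ioi e1, swap12 _ _ _ (fun l n o => ENNReal.ofReal (Real.exp ((h * Real.log l - (1 + o) * l) + (- v * Real.log n - w * Real.log o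
      - (1 + a) * Real.log (1 + (n + o) * p) - (1 + b) * Real.log (1 + (n + o) * q))))) (by fun_prop)]
  rw [← lintegral_const_mul' _ _ (by finiteness)]
  refine setLIntegral_congr_fun measurableSet_Ioi fun n hn => ?_
  rw [← lintegral_const_mul' _ _ (by finiteness)]
  refine setLIntegral_congr_fun measurableSet_Ioi fun o ho => ?_
  have ho : 0 < o := ho
  simp_rw [Real.exp_add, ENNReal.ofReal_mul (Real.exp_pos _).le]
  rw [lintegral_mul_const' _ _ (by finiteness), gam_lint hh (by positivity), mul_assoc]
  congr 1
  rw [← ENNReal.ofReal_mul (Real.exp_pos _).le, ← Real.exp_add]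
  congr 2
  ring

lemma HH_step3 {t s : ℝ} (ht : t ∈ Set.Ioo (0:ℝ) 1) (hs : s ∈ Set.Ioo (0:ℝ) 1) {u v w a b h : ℝ}
    (he : a + b + h = - u - v - w) :
    ∫⁻ n, ∫⁻ o, ENNReal.ofReal (Real.exp (- v * Real.log n - w * Real.log o
      - (1 + h) * Real.log (1 + o)
      - (1 + a) * Real.log (1 + (n + o) * (1 - t)) - (1 + b) * Real.log (1 + (n + o) * (1 - s)))) ∂mI ∂mI
    = ∫⁻ r, ∫⁻ X, ENNReal.ofReal (Real.exp ((1 - v - w) * Real.log X - u * Real.log (1 - X) - v * Real.log r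
      - w * Real.log (1 - r) - (1 + a) * Real.log (1 - X * t) - (1 + b) * Real.log (1 - X * s)
      - (1 + h) * Real.log (1 - X * r))) ∂mQ ∂mQ := by
  rw [lintegral_lintegral_swap (by fun_prop)]
  have e1 : ∀ o ∈ Set.Ioi (0:ℝ), ∫⁻ n, ENNReal.ofReal (Real.exp (- v * Real.log n - w * Real.log o
      - (1 + h) * Real.log (1 + o)
      - (1 + a) * Real.log (1 + (n + o) * (1 - t)) - (1 + b) * Real.log (1 + (n + o) * (1 - s)))) ∂mI
      = ∫⁻ r, ENNReal.ofReal (Real.exp ((1 - v - w) * Real.log o - v * Real.log r + (v - 2) * Real.log (1 - r)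
        - (1 + h) * Real.log (1 + o)
      - (1 + a) * Real.log (1 + o / (1 - r) * (1 - t)) - (1 + b) * Real.log (1 + o / (1 - r) * (1 - s)))) ∂mQ := by
    intro o ho
    have ho : 0 < o := ho
    rw [mob_sub ho]
    refine setLIntegral_congr_fun measurableSet_Ioo fun r hr => ?_
    have hr0 := hr.1
    have hr1 : 0 < 1 - r := by linarith [hr.2]
    have h1 : o * r / (1 - r) + o = o / (1 - r) := by field_simp; ring
    rw [← ENNReal.ofReal_mul (Real.exp_pos _).le, ← Real.exp_add, h1, Real.log_div (by positivity) hr1.ne',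
      Real.log_mul ho.ne' hr0.ne']
    congr 2
    ring
  rw [setLIntegral_congr_fun measurableSet_Ioi e1, lintegral_lintegral_swap (by fun_prop)]
  refine setLIntegral_congr_fun measurableSet_Ioo fun r hr => ?_
  have hr0 := hr.1
  have hr1 : 0 < 1 - r := by linarith [hr.2]
  rw [mob_sub hr1]
  refine setLIntegral_congr_fun measurableSet_Ioo fun X hX => ?_
  have hX0 := hX.1
  have hX1 : 0 < 1 - X := by linarith [hX.2]
  have k1 : ∀ y ∈ Set.Ioo (0:ℝ) 1, 0 < 1 - X * y := fun y hy => by nlinarith [hy.1, hy.2]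
  have h1 : ∀ y, 1 + (1 - r) * X / (1 - X) / (1 - r) * (1 - y) = (1 - X * y) / (1 - X) := by
    intro y; field_simp; ring
  have h2 : 1 + (1 - r) * X / (1 - X) = (1 - X * r) / (1 - X) := by field_simp; ring
  rw [← ENNReal.ofReal_mul (Real.exp_pos _).le, ← Real.exp_add, h1, h1, h2, Real.log_div (k1 t ht).ne' hX1.ne',
    Real.log_div (k1 s hs).ne' hX1.ne', Real.log_div (k1 r hr).ne' hX1.ne', Real.log_div (by positivity) hX1.ne',
    Real.log_mul hr1.ne' hX0.ne']
  congr 2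
  rw [show h = - u - v - w - a - b by linarith]
  ring

def psi0 (x1 x2 x3 x4 x5 : ℝ) : ℝ := (x1 + x3) * (x2 + x4) + x5 * (x1 + x2 + x3 + x4)
def phi0 (x1 x2 x3 x4 x5 : ℝ) : ℝ := x1 * x3 * (x2 + x4) + x2 * x4 * (x1 + x3) + x5 * (x1 + x2) * (x3 + x4)

def Iint (c1 c2 c3 c4 a b : ℝ) : ENNReal :=
  ∫⁻ B, ∫⁻ A, ∫⁻ y, ∫⁻ z, ENNReal.ofReal (Real.exp (c1 * Real.log B + c2 * Real.log y + c3 * Real.log A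
    + c4 * Real.log z + (a - 1) * Real.log (psi0 B y A z 1) + (b - 1) * Real.log (phi0 B y A z 1))) ∂mI ∂mI ∂mI ∂mI

def Jint (m1 n1 m2 n2 u v w a b h : ℝ) : ENNReal :=
  ∫⁻ t, ∫⁻ s, ∫⁻ r, ∫⁻ X, ENNReal.ofReal (Real.exp (m1 * Real.log t + n1 * Real.log (1 - t) + m2 * Real.log s
      + n2 * Real.log (1 - s) + ((1 - v - w) * Real.log X - u * Real.log (1 - X) - v * Real.log r
      - w * Real.log (1 - r) - (1 + a) * Real.log (1 - X * t) - (1 + b) * Real.log (1 - X * s)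
      - (1 + h) * Real.log (1 - X * r)))) ∂mQ ∂mQ ∂mQ ∂mQ

lemma Iint_sub (c1 c2 c3 c4 a b : ℝ) :
    Iint c1 c2 c3 c4 a b = ∫⁻ t, ∫⁻ s, ENNReal.ofReal (Real.exp (c2 * Real.log t + (-c2 - a - b) * Real.log (1 - t)
      + c4 * Real.log s + (-c4 - a - b) * Real.log (1 - s))) * ∫⁻ B, ∫⁻ A,
      ENNReal.ofReal (Real.exp ((c3 + c4 + b) * Real.log A + (c1 + c2 + b) * Real.log B +
      ((-c2 - c4 - b) - 1) * Real.log (1 + A + B)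
      + (a - 1) * Real.log ((1 - t) * A + (1 - s) * B) + (b - 1) * Real.log (1 + ((1 - t) * A + (1 - s) * B)))) ∂mI ∂mI ∂mQ ∂mQ := by
  have e1 : ∀ B ∈ Set.Ioi (0:ℝ), ∫⁻ A, ∫⁻ y, ∫⁻ z, ENNReal.ofReal (Real.exp (c1 * Real.log B + c2 * Real.log y + c3 * Real.log A
    + c4 * Real.log z + (a - 1) * Real.log (psi0 B y A z 1) + (b - 1) * Real.log (phi0 B y A z 1))) ∂mI ∂mI ∂mI
    = ∫⁻ A, ∫⁻ t, ∫⁻ s, ENNReal.ofReal (Real.exp ((c2 * Real.log t + (-c2 - a - b) * Real.log (1 - t)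
      + c4 * Real.log s + (-c4 - a - b) * Real.log (1 - s)) +
      ((c3 + c4 + b) * Real.log A + (c1 + c2 + b) * Real.log B +
      ((-c2 - c4 - b) - 1) * Real.log (1 + A + B)
      + (a - 1) * Real.log ((1 - t) * A + (1 - s) * B) + (b - 1) * Real.log (1 + ((1 - t) * A + (1 - s) * B))))) ∂mQ ∂mQ ∂mI := by
    intro B hB
    have hB : 0 < B := hB
    refine setLIntegral_congr_fun measurableSet_Ioi fun A hA => ?_
    have hA : 0 < A := hA
    have hN : 0 < 1 + A + B := by positivity
    rw [mob_sub (by positivity : 0 < B / (1 + A + B))]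
    refine setLIntegral_congr_fun measurableSet_Ioo fun t ht => ?_
    have ht0 := ht.1
    have ht1 : 0 < 1 - t := by linarith [ht.2]
    rw [mob_sub (by positivity : 0 < A / (1 + A + B)), ← lintegral_const_mul' _ _ (by finiteness)]
    refine setLIntegral_congr_fun measurableSet_Ioo fun s hs => ?_
    have hs0 := hs.1
    have hs1 : 0 < 1 - s := by linarith [hs.2]
    simp only [← ENNReal.ofReal_mul (Real.exp_pos _).le, ← Real.exp_add]
    have hS : 0 < (1 - t) * A + (1 - s) * B := by positivity
    have h1 : psi0 B (B / (1 + A + B) * t / (1 - t)) A (A / (1 + A + B) * s / (1 - s)) 1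
        = ((1 - t) * A + (1 - s) * B) / ((1 - t) * (1 - s)) := by
      rw [psi0]; field_simp; ring
    have h2 : phi0 B (B / (1 + A + B) * t / (1 - t)) A (A / (1 + A + B) * s / (1 - s)) 1
        = A * B * (1 + ((1 - t) * A + (1 - s) * B)) / ((1 + A + B) * ((1 - t) * (1 - s))) := by
      rw [phi0]; field_simp; ring
    have hAB : 0 < A * B * (1 + ((1 - t) * A + (1 - s) * B)) := by positivity
    have hNN : 0 < (1 + A + B) * ((1 - t) * (1 - s)) := by positivity
    have hBN : 0 < B / (1 + A + B) := by positivity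
    have hAN : 0 < A / (1 + A + B) := by positivity
    have l1 : Real.log (B / (1 + A + B)) = Real.log B - Real.log (1 + A + B) := Real.log_div hB.ne' hN.ne'
    have l2 : Real.log (A / (1 + A + B)) = Real.log A - Real.log (1 + A + B) := Real.log_div hA.ne' hN.ne'
    have hts : Real.log ((1 - t) * (1 - s)) = Real.log (1 - t) + Real.log (1 - s) := Real.log_mul ht1.ne' hs1.ne'
    rw [h1, h2, Real.log_div hS.ne' (by positivity), Real.log_div hAB.ne' hNN.ne',
      Real.log_mul (by positivity : A * B ≠ 0) (by positivity),
      Real.log_mul hA.ne' hB.ne', Real.log_mul hN.ne' (by positivity), hts,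
      Real.log_div (mul_pos hBN ht0).ne' ht1.ne', Real.log_div (mul_pos hAN hs0).ne' hs1.ne',
      Real.log_mul hBN.ne' ht0.ne', Real.log_mul hAN.ne' hs0.ne', l1, l2]
    congr 2
    ring
  rw [Iint, setLIntegral_congr_fun measurableSet_Ioi e1, swap22 _ _ _ _ (fun B A t s => ENNReal.ofReal (Real.exp ((c2 * Real.log t + (-c2 - a - b) * Real.log (1 - t)
      + c4 * Real.log s + (-c4 - a - b) * Real.log (1 - s)) +
      ((c3 + c4 + b) * Real.log A + (c1 + c2 + b) * Real.log B +
      ((-c2 - c4 - b) - 1) * Real.log (1 + A + B)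
      + (a - 1) * Real.log ((1 - t) * A + (1 - s) * B) + (b - 1) * Real.log (1 + ((1 - t) * A + (1 - s) * B)))))) (by fun_prop)]
  refine lintegral_congr fun t => lintegral_congr fun s => ?_
  rw [← lintegral_const_mul' _ _ (by finiteness)]
  refine lintegral_congr fun B => ?_
  rw [← lintegral_const_mul' _ _ (by finiteness)]
  refine lintegral_congr fun A => ?_
  rw [Real.exp_add, ENNReal.ofReal_mul (Real.exp_pos _).le]

lemma key_id (c1 c2 c3 c4 a b u h a' b' : ℝ) (hu : u = -c2 - c4 - b) (hh : h = -a - 2 * b - c1 - c3)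
    (ha' : a' = c3 + c4 + b) (hb' : b' = c1 + c2 + b) (u1 : u < 1) (v1 : a < 1) (w1 : b < 1) (a1 : -1 < a') (b1 : -1 < b')
    (h1 : -1 < h) :
    ENNReal.ofReal (Real.Gamma (1 - u)) * ENNReal.ofReal (Real.Gamma (1 - a)) * ENNReal.ofReal (Real.Gamma (1 - b)) *
      Iint c1 c2 c3 c4 a b = ENNReal.ofReal (Real.Gamma (1 + a')) * ENNReal.ofReal (Real.Gamma (1 + b')) *
      ENNReal.ofReal (Real.Gamma (1 + h)) * Jint c2 (-c2 - a - b) c4 (-c4 - a - b) u a b a' b' h := by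
  rw [Iint_sub, ← hu, ← ha', ← hb', Jint, ← lintegral_const_mul' _ _ (by finiteness),
    ← lintegral_const_mul' _ _ (by finiteness)]
  refine setLIntegral_congr_fun measurableSet_Ioo fun t ht => ?_
  rw [← lintegral_const_mul' _ _ (by finiteness), ← lintegral_const_mul' _ _ (by finiteness)]
  refine setLIntegral_congr_fun measurableSet_Ioo fun s hs => ?_
  have he : a' + b' + h = - u - a - b := by rw [ha', hb', hh, hu]; ring
  rw [mul_left_comm, HH_step1 (by linarith [ht.2]) (by linarith [hs.2]) u1 v1 w1 a1 b1,
    HH_step2 (by linarith [ht.2]) (by linarith [hs.2]) h1 he, HH_step3 ht hs he, ← mul_assoc _ (ENNReal.ofReal (Real.Gamma (1 + h))),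
    mul_left_comm]
  congr 1
  rw [← lintegral_const_mul' _ _ (by finiteness)]
  refine lintegral_congr fun r => ?_
  rw [← lintegral_const_mul' _ _ (by finiteness)]
  refine lintegral_congr fun X => ?_
  rw [← ENNReal.ofReal_mul (Real.exp_pos _).le, ← Real.exp_add]

lemma posOrthant_meas (n : ℕ) : MeasurableSet (posOrthant n) := MeasurableSet.univ_pi fun _ => measurableSet_Ioi

lemma mem_posOrthant {n : ℕ} {x : Fin n → ℝ} : x ∈ posOrthant n ↔ ∀ i, 0 < x i := by simp [posOrthant]

lemma split_orth {n : ℕ} (p : Fin (n+1)) (f : (Fin (n+1) → ℝ) → ENNReal) (hf : Measurable f) :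
    ∫⁻ x in posOrthant (n+1), f x = ∫⁻ r in Set.Ioi (0:ℝ), ∫⁻ z in posOrthant n, f (p.insertNth r z) := by
  have h := (volume_preserving_piFinSuccAbove (fun _ : Fin (n+1) => ℝ) p).symm
  rw [← h.setLIntegral_comp_preimage (posOrthant_meas _) hf]
  have hpre : (MeasurableEquiv.piFinSuccAbove (fun _ => ℝ) p).symm ⁻¹' posOrthant (n+1) = Set.Ioi 0 ×ˢ posOrthant n := by
    ext ⟨r, z⟩
    simp only [Set.mem_preimage, mem_posOrthant, Set.mem_prod, Set.mem_Ioi]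
    rw [Fin.forall_iff_succAbove p]
    simp [MeasurableEquiv.piFinSuccAbove, Fin.insertNthEquiv]
  rw [hpre, Measure.volume_eq_prod, ← Measure.prod_restrict, lintegral_prod]
  · rfl
  · exact (hf.comp (MeasurableEquiv.measurable _)).aemeasurable

lemma orth_scale {n : ℕ} {r : ℝ} (hr : 0 < r) (g : (Fin n → ℝ) → ENNReal) (hg : Measurable g) :
    ∫⁻ z in posOrthant n, g z = ENNReal.ofReal (r ^ n) * ∫⁻ z in posOrthant n, g (r • z) := by
  have h1 : Measure.map (r • ·) (volume : Measure (Fin n → ℝ)) = _ := Measure.map_addHaar_smul volume hr.ne'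
  rw [← lintegral_indicator (posOrthant_meas n), ← lintegral_indicator (posOrthant_meas n)]
  have h2 : ∀ z, (posOrthant n).indicator (fun z => g (r • z)) z = (posOrthant n).indicator g (r • z) := by
    intro z
    have : r • z ∈ posOrthant n ↔ z ∈ posOrthant n := by
      simp [mem_posOrthant, hr]
    by_cases hz : z ∈ posOrthant n
    · rw [Set.indicator_of_mem hz, Set.indicator_of_mem (this.2 hz)]
    · rw [Set.indicator_of_notMem hz, Set.indicator_of_notMem (mt this.1 hz)]
  simp_rw [h2]
  rw [← lintegral_map (f := (posOrthant n).indicator g) (g := (r • ·)) (hg.indicator (posOrthant_meas n)) (by fun_prop), h1, lintegral_smul_measure, smul_eq_mul, ← mul_assoc,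
    ← ENNReal.ofReal_mul (by positivity)]
  simp [abs_of_pos hr, hr.ne']

lemma proj_int {n : ℕ} (F : (Fin (n+1) → ℝ) → ENNReal) (hF : Measurable F)
    (hom : ∀ r > 0, ∀ x ∈ posOrthant (n+1), ENNReal.ofReal (r ^ (n+1)) * F (r • x) = F x) :
    ∫⁻ x in posOrthant (n+1), F x * ENNReal.ofReal ((∑ i, x i) * Real.exp (-(∑ i, x i)))
      = ∫⁻ y in posOrthant n, F (Fin.snoc y 1) := by
  rw [split_orth (Fin.last n) _ (by fun_prop)]
  simp only [Fin.insertNth_last']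
  have hm : Measurable fun p : (Fin n → ℝ) × ℝ => (Fin.snoc p.1 p.2 : Fin (n+1) → ℝ) := by
    refine measurable_pi_lambda _ fun i => ?_
    induction i using Fin.lastCases with
    | last => simpa using measurable_snd
    | cast i => simp; fun_prop
  have e1 : ∀ r ∈ Set.Ioi (0:ℝ), ∫⁻ z in posOrthant n, F (Fin.snoc z r) *
      ENNReal.ofReal ((∑ i, (Fin.snoc z r : Fin (n+1) → ℝ) i) * Real.exp (-(∑ i, (Fin.snoc z r : Fin (n+1) → ℝ) i)))
      = ∫⁻ y in posOrthant n, F (Fin.snoc y 1) * ENNReal.ofReal (((∑ i, y i) + 1) * Real.exp (0 * Real.log r - ((∑ i, y i) + 1) * r)) := by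
    intro r hr
    have hr : 0 < r := hr
    rw [orth_scale hr]
    · rw [← lintegral_const_mul' _ _ (by finiteness)]
      refine setLIntegral_congr_fun (posOrthant_meas n) fun y hy => ?_
      have hy := mem_posOrthant.1 hy
      have hs : (Fin.snoc (r • y) r : Fin (n+1) → ℝ) = r • (Fin.snoc y 1 : Fin (n+1) → ℝ) := by
        ext i
        induction i using Fin.lastCases with
        | last => simp
        | cast i => simp
      have hmem : (Fin.snoc y 1 : Fin (n+1) → ℝ) ∈ posOrthant (n+1) := by
        rw [mem_posOrthant]; intro i
        induction i using Fin.lastCases with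
        | last => simp
        | cast i => simpa using hy i
      have hsum : ∑ i, (Fin.snoc (r • y) r : Fin (n+1) → ℝ) i = r * ((∑ i, y i) + 1) := by
        rw [Fin.sum_univ_castSucc]; simp [← mul_sum]; ring
      have hσ : 0 ≤ (∑ i, y i) + 1 := by
        have := sum_nonneg fun i (_ : i ∈ univ) => (hy i).le
        linarith
      rw [hsum, ← hom r hr _ hmem, hs, mul_assoc, ENNReal.ofReal_mul' (Real.exp_pos _).le, ENNReal.ofReal_mul hr.le,
        ENNReal.ofReal_mul hσ, pow_succ, ENNReal.ofReal_mul (by positivity)]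
      rw [show -(r * ((∑ i, y i) + 1)) = 0 * Real.log r - ((∑ i, y i) + 1) * r by ring]
      ring
    · have : Measurable fun z : Fin n → ℝ => (Fin.snoc z r : Fin (n+1) → ℝ) := hm.comp (by fun_prop : Measurable fun z : Fin n → ℝ => (z, r))
      fun_prop
  rw [setLIntegral_congr_fun measurableSet_Ioi e1, lintegral_lintegral_swap]
  · refine setLIntegral_congr_fun (posOrthant_meas n) fun y hy => ?_
    have hy := mem_posOrthant.1 hy
    have hσ : 0 < (∑ i, y i) + 1 := by
      have := sum_nonneg fun i (_ : i ∈ univ) => (hy i).le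
      linarith
    simp_rw [ENNReal.ofReal_mul hσ.le]
    simp_rw [← mul_assoc]
    rw [lintegral_const_mul _ (by fun_prop), gam_lint (by norm_num) hσ]
    rw [mul_assoc, ← ENNReal.ofReal_mul (Real.Gamma_pos_of_pos (by norm_num)).le, ← ENNReal.ofReal_mul hσ.le]
    simp [Real.exp_neg, Real.exp_log hσ, hσ.ne']
  · have : Measurable fun p : ℝ × (Fin n → ℝ) => (Fin.snoc p.2 1 : Fin (n+1) → ℝ) := hm.comp (by fun_prop : Measurable fun p : ℝ × (Fin n → ℝ) => (p.2, (1:ℝ)))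
    refine Measurable.aemeasurable ?_
    unfold Function.uncurry
    fun_prop

lemma proj_perm {n : ℕ} (F : (Fin (n+1) → ℝ) → ENNReal) (hF : Measurable F)
    (hom : ∀ r > 0, ∀ x ∈ posOrthant (n+1), ENNReal.ofReal (r ^ (n+1)) * F (r • x) = F x) (π : Equiv.Perm (Fin (n+1))) :
    ∫⁻ y in posOrthant n, F ((Fin.snoc y 1 : Fin (n+1) → ℝ) ∘ π) = ∫⁻ y in posOrthant n, F (Fin.snoc y 1) := by
  have hm : Measurable fun x : Fin (n+1) → ℝ => x ∘ π := measurable_pi_lambda _ fun i => measurable_pi_apply _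
  rw [← proj_int F hF hom, ← proj_int (fun x => F (x ∘ π)) (hF.comp hm)]
  · have h := (volume_measurePreserving_piCongrLeft (fun _ : Fin (n+1) => ℝ) π.symm)
    conv_rhs => rw [← h.setLIntegral_comp_preimage (posOrthant_meas _) (by fun_prop)]
    have hpi : ∀ x : Fin (n+1) → ℝ, MeasurableEquiv.piCongrLeft (fun _ : Fin (n+1) => ℝ) π.symm x = x ∘ π := by
      intro x; ext i
      have := MeasurableEquiv.piCongrLeft_apply_apply (β := fun _ : Fin (n+1) => ℝ) π.symm x (π i)
      simpa using this
    have hs : ⇑(MeasurableEquiv.piCongrLeft (fun _ : Fin (n+1) => ℝ) π.symm) ⁻¹' posOrthant (n+1) = posOrthant (n+1) := by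
      ext x
      simp only [Set.mem_preimage, hpi, mem_posOrthant, Function.comp]
      exact ⟨fun h i => by simpa using h (π.symm i), fun h i => h _⟩
    rw [hs]
    refine lintegral_congr fun x => ?_
    rw [hpi]
    have : ∑ i, (x ∘ π) i = ∑ i, x i := Equiv.sum_comp π x
    rw [this]
  · intro r hr x hx
    exact hom r hr (x ∘ π) (mem_posOrthant.2 fun i => mem_posOrthant.1 hx _)

def anyF (f : Fin 4 → Bool) : Bool := f 0 || f 1 || f 2 || f 3

lemma anyF_iff (f : Fin 4 → Bool) : anyF f = true ↔ ∃ i, f i = true := by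
  simp [anyF, Fin.exists_fin_succ, or_assoc]

def rch (A : Fin 4 → Fin 4 → Bool) (x y : Fin 4) : Bool :=
  x == y || (A x y || (anyF (fun w => A x w && A w y) || anyF (fun w => anyF fun w' => A x w && (A w w' && A w' y))))

lemma rch_iff {G : SimpleGraph (Fin 4)} {A : Fin 4 → Fin 4 → Bool} (hA : ∀ x y, G.Adj x y ↔ A x y = true) (x y : Fin 4) :
    G.Reachable x y ↔ rch A x y = true := by
  simp only [rch, Bool.or_eq_true, anyF_iff, Bool.and_eq_true, ← hA, beq_iff_eq]
  constructor
  · rintro ⟨p⟩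
    have hp := (p.toPath.2).length_lt
    generalize (p.toPath : G.Walk x y) = q at hp
    simp only [Fintype.card_fin] at hp
    match q, hp with
    | .nil, _ => exact Or.inl rfl
    | .cons h .nil, _ => exact Or.inr (Or.inl h)
    | .cons h (.cons h' .nil), _ => exact Or.inr (Or.inr (Or.inl ⟨_, h, h'⟩))
    | .cons h (.cons h' (.cons h'' .nil)), _ => exact Or.inr (Or.inr (Or.inr ⟨_, _, h, h', h''⟩))
    | .cons h (.cons h' (.cons h'' (.cons h3 r))), hp => simp at hp; omega
  · rintro (rfl | h | ⟨w, h, h'⟩ | ⟨w, w', h, h', h''⟩)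
    · exact Reachable.refl _
    · exact h.reachable
    · exact h.reachable.trans h'.reachable
    · exact h.reachable.trans (h'.reachable.trans h''.reachable)

def delB (A : Fin 4 → Fin 4 → Bool) (p q : Fin 4) (x y : Fin 4) : Bool :=
  A x y && !((x == p && y == q) || (x == q && y == p))

def allF (f : Fin 4 → Bool) : Bool := f 0 && (f 1 && (f 2 && f 3))

lemma allF_iff (f : Fin 4 → Bool) : allF f = true ↔ ∀ i, f i = true := by
  simp [allF, Fin.forall_fin_succ]

def acB (A : Fin 4 → Fin 4 → Bool) : Bool := allF fun p => allF fun q => !(A p q) || !(rch (delB A p q) p q)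

lemma acB_iff {G : SimpleGraph (Fin 4)} {A : Fin 4 → Fin 4 → Bool} (hA : ∀ x y, G.Adj x y ↔ A x y = true) :
    G.IsAcyclic ↔ acB A = true := by
  rw [isAcyclic_iff_forall_adj_isBridge]
  simp only [acB, allF_iff, Bool.or_eq_true, Bool.not_eq_true', isBridge_iff, ← Bool.not_eq_true]
  refine forall_congr' fun p => forall_congr' fun q => ?_
  have := rch_iff (G := G.deleteEdges {s(p, q)}) (A := delB A p q) (by
    intro x y
    simp [delB, hA]; tauto) p q
  rw [← this, ← hA]
  tauto

lemma tree_iffB {G : SimpleGraph (Fin 4)} {A : Fin 4 → Fin 4 → Bool} (hA : ∀ x y, G.Adj x y ↔ A x y = true) :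
    G.IsTree ↔ (acB A && allF fun y => rch A 0 y) = true := by
  simp only [Bool.and_eq_true, allF_iff, ← acB_iff hA, ← rch_iff hA]
  constructor
  · intro h; exact ⟨h.isAcyclic, fun y => h.connected.preconnected 0 y⟩
  · rintro ⟨h1, h2⟩
    exact ⟨⟨fun x y => (h2 x).symm.trans (h2 y)⟩, h1⟩

lemma forest_iffB {G : SimpleGraph (Fin 4)} {A : Fin 4 → Fin 4 → Bool} (hA : ∀ x y, G.Adj x y ↔ A x y = true) :
    (G.IsAcyclic ∧ Nat.card G.ConnectedComponent = 2 ∧ ¬ G.Reachable 0 1) ↔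
     (acB A && (!(rch A 0 1) && allF fun y => rch A 0 y || rch A 1 y)) = true := by
  simp only [Bool.and_eq_true, allF_iff, Bool.or_eq_true, Bool.not_eq_true', ← Bool.not_eq_true, ← acB_iff hA, ← rch_iff hA]
  refine and_congr_right fun _ => ?_
  rw [and_comm]
  refine and_congr_right fun h => ?_
  rw [Nat.card_eq_two_iff' (G.connectedComponentMk 0)]
  have h01 : G.connectedComponentMk 1 ≠ G.connectedComponentMk 0 := by
    intro e; exact h (ConnectedComponent.exact e).symm
  constructor
  · rintro ⟨c, hc, hu⟩ y
    by_cases hy : G.connectedComponentMk y = G.connectedComponentMk 0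
    · exact Or.inl (ConnectedComponent.exact hy).symm
    · right
      have e1 := hu _ hy
      have e2 := hu _ h01
      exact (ConnectedComponent.exact (e1.trans e2.symm)).symm
  · intro H
    refine ⟨_, h01, ?_⟩
    intro c
    refine c.ind fun y hy => ?_
    rcases H y with h' | h'
    · exact absurd (ConnectedComponent.sound h').symm hy
    · exact (ConnectedComponent.sound h').symm

def ed0 : Fin 5 → Sym2 (Fin 4) := ![s(0,2), s(0,3), s(1,2), s(1,3), s(2,3)]

def adjT (b : Fin 5 → Bool) (x y : Fin 4) : Bool :=
  (![![false, false, b 0, b 1], ![false, false, b 2, b 3], ![b 0, b 2, false, b 4], ![b 1, b 3, b 4, false]] : Fin 4 → Fin 4 → Bool) x y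

lemma adjT_iff (S : Finset (Fin 5)) (x y : Fin 4) :
    (SimpleGraph.fromEdgeSet (↑(S.image ed0) : Set (Sym2 (Fin 4)))).Adj x y ↔ adjT (fun i => decide (i ∈ S)) x y = true := by
  rw [fromEdgeSet_adj]
  simp only [coe_image, Set.mem_image, mem_coe]
  fin_cases x <;> fin_cases y <;> simp [ed0, adjT, Fin.exists_fin_succ]

def trees : Finset (Finset (Fin 5)) :=
  {{0, 1, 2}, {0, 1, 3}, {0, 2, 3}, {0, 2, 4}, {0, 3, 4}, {1, 2, 3}, {1, 2, 4}, {1, 3, 4}}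

def forests : Finset (Finset (Fin 5)) :=
  {{0, 1}, {0, 3}, {0, 4}, {1, 2}, {1, 4}, {2, 3}, {2, 4}, {3, 4}}

set_option maxRecDepth 100000 in
lemma trees_dec : ∀ S : Finset (Fin 5), (acB (adjT fun i => decide (i ∈ S)) && allF fun y => rch (adjT fun i => decide (i ∈ S)) 0 y) = true ↔ S ∈ trees := by
  decide +kernel

set_option maxRecDepth 100000 in
lemma forests_dec : ∀ S : Finset (Fin 5), (acB (adjT fun i => decide (i ∈ S)) && (!(rch (adjT fun i => decide (i ∈ S)) 0 1) &&
    allF fun y => rch (adjT fun i => decide (i ∈ S)) 0 y || rch (adjT fun i => decide (i ∈ S)) 1 y)) = true ↔ S ∈ forests := by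
  decide +kernel

lemma psi_can (x : Fin 5 → ℝ) : psiI ed0 x = psi0 (x 0) (x 2) (x 1) (x 3) (x 4) := by
  unfold psiI
  simp only [tree_iffB (adjT_iff _), trees_dec]
  rw [← sum_filter, Finset.filter_mem_eq_inter, univ_inter]
  have hc : ∀ S : Finset (Fin 5), ∏ i ∈ Sᶜ, x i = ∏ i, if i ∈ S then 1 else x i := by
    intro S; rw [← Finset.prod_mul_prod_compl S (fun i => if i ∈ S then 1 else x i)]
    rw [prod_congr rfl (fun i hi => if_pos hi), prod_const_one, one_mul]
    exact prod_congr rfl fun i hi => (if_neg (mem_compl.1 hi)).symm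
  simp_rw [hc, trees, Fin.prod_univ_five]
  repeat rw [sum_insert (by decide)]
  simp
  rw [psi0]; ring

lemma phi_can (x : Fin 5 → ℝ) : phiI ed0 0 1 x = phi0 (x 0) (x 2) (x 1) (x 3) (x 4) := by
  unfold phiI
  simp only [forest_iffB (adjT_iff _), forests_dec]
  rw [← sum_filter, Finset.filter_mem_eq_inter, univ_inter]
  have hc : ∀ S : Finset (Fin 5), ∏ i ∈ Sᶜ, x i = ∏ i, if i ∈ S then 1 else x i := by
    intro S; rw [← Finset.prod_mul_prod_compl S (fun i => if i ∈ S then 1 else x i)]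
    rw [prod_congr rfl (fun i hi => if_pos hi), prod_const_one, one_mul]
    exact prod_congr rfl fun i hi => (if_neg (mem_compl.1 hi)).symm
  simp_rw [hc, forests, Fin.prod_univ_five]
  repeat rw [sum_insert (by decide)]
  simp
  rw [phi0]; ring

lemma img_adj (τ : Equiv.Perm (Fin 4)) (s : Finset (Sym2 (Fin 4))) (a b : Fin 4) :
    (SimpleGraph.fromEdgeSet (↑(s.image (Sym2.map τ)) : Set (Sym2 (Fin 4)))).Adj (τ a) (τ b) ↔
    (SimpleGraph.fromEdgeSet (↑s : Set (Sym2 (Fin 4)))).Adj a b := by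
  simp only [fromEdgeSet_adj, coe_image, ne_eq, EmbeddingLike.apply_eq_iff_eq]
  rw [← Sym2.map_mk, Function.Injective.mem_set_image (Sym2.map.injective τ.injective)]

def imgIso (τ : Equiv.Perm (Fin 4)) (s : Finset (Sym2 (Fin 4))) :
    SimpleGraph.fromEdgeSet (↑s : Set (Sym2 (Fin 4))) ≃g
    SimpleGraph.fromEdgeSet (↑(s.image (Sym2.map τ)) : Set (Sym2 (Fin 4))) :=
  ⟨τ, img_adj τ s _ _⟩

lemma graph_main (u v : Fin 4) (he0 : s(u, v) ∈ (⊤ : SimpleGraph (Fin 4)).edgeSet)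
    (ed : Fin 5 → Sym2 (Fin 4))
    (hrange : Set.range ed = ((⊤ : SimpleGraph (Fin 4)).deleteEdges {s(u, v)}).edgeSet) :
    ∃ π : Equiv.Perm (Fin 5), ∀ x : Fin 5 → ℝ,
      psiI ed x = psi0 (x (π 0)) (x (π 2)) (x (π 1)) (x (π 3)) (x (π 4)) ∧
      phiI ed u v x = phi0 (x (π 0)) (x (π 2)) (x (π 1)) (x (π 3)) (x (π 4)) := by
  have huv : u ≠ v := by simpa using he0
  obtain ⟨τ, rfl, rfl⟩ : ∃ τ : Equiv.Perm (Fin 4), τ 0 = u ∧ τ 1 = v := by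
    clear hrange he0
    revert u v; decide
  have hmem : ∀ j, ∃ i, ed i = Sym2.map τ (ed0 j) := by
    intro j
    have : Sym2.map τ (ed0 j) ∈ Set.range ed := by
      rw [hrange, edgeSet_deleteEdges, Set.mem_sdiff]
      fin_cases j <;> simp [ed0]
    exact this
  choose f hf using hmem
  have hinj : Function.Injective f := by
    intro i j h
    have : Sym2.map τ (ed0 i) = Sym2.map τ (ed0 j) := by rw [← hf, ← hf, h]
    have := Sym2.map.injective τ.injective this
    clear h
    have hd : ∀ i j : Fin 5, ed0 i = ed0 j → i = j := by decide
    exact hd i j this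
  let π := Equiv.ofBijective f (Finite.injective_iff_bijective.1 hinj)
  have hed : ed ∘ π = Sym2.map τ ∘ ed0 := by ext1 j; exact hf j
  have him : ∀ S : Finset (Fin 5), (S.map π.toEmbedding).image ed = (S.image ed0).image (Sym2.map τ) := by
    intro S
    rw [map_eq_image, image_image, image_image]
    exact congrArg (fun g => S.image g) hed
  have hprod : ∀ (x : Fin 5 → ℝ) (S : Finset (Fin 5)), ∏ i ∈ (S.map π.toEmbedding)ᶜ, x i = ∏ i ∈ Sᶜ, x (π i) := by
    intro x S
    have : (S.map π.toEmbedding)ᶜ = Sᶜ.map π.toEmbedding := by ext i; simp [mem_map_equiv]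
    rw [this, prod_map]; rfl
  refine ⟨π, fun x => ⟨?_, ?_⟩⟩
  · rw [← psi_can (fun i => x (π i))]
    unfold psiI
    rw [← Equiv.sum_comp π.finsetCongr]
    refine sum_congr rfl fun S _ => ?_
    rw [Equiv.finsetCongr_apply, hprod]
    have hk := (imgIso τ (S.image ed0)).isTree_iff
    rw [← him] at hk
    by_cases hc : (fromEdgeSet (↑(image ed0 S) : Set (Sym2 (Fin 4)))).IsTree
    · rw [if_pos hc, if_pos (hk.1 hc)]
    · rw [if_neg hc, if_neg (mt hk.2 hc)]
  · rw [← phi_can (fun i => x (π i))]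
    unfold phiI
    rw [← Equiv.sum_comp π.finsetCongr]
    refine sum_congr rfl fun S _ => ?_
    have h3 := (imgIso τ (S.image ed0)).reachable_iff (u := 0) (v := 1)
    have h4 := Nat.card_congr (imgIso τ (S.image ed0)).connectedComponentEquiv
    have h5 : ∀ a, imgIso τ (S.image ed0) a = τ a := fun _ => rfl
    simp only [h5] at h3
    rw [Equiv.finsetCongr_apply, hprod]
    have hk := (imgIso τ (S.image ed0)).isAcyclic_iff
    rw [← him] at hk h3 h4
    by_cases hc : ((fromEdgeSet (↑(image ed0 S) : Set (Sym2 (Fin 4)))).IsAcyclic ∧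
          Nat.card (fromEdgeSet (↑(image ed0 S) : Set (Sym2 (Fin 4)))).ConnectedComponent = 2 ∧
            ¬(fromEdgeSet (↑(image ed0 S) : Set (Sym2 (Fin 4)))).Reachable 0 1)
    · rw [if_pos hc, if_pos (by rw [← hk, ← h4, h3]; exact hc)]
    · rw [if_neg hc, if_neg (by rw [← hk, ← h4, h3]; exact hc)]

def psiv (x : Fin 5 → ℝ) : ℝ := psi0 (x 0) (x 2) (x 1) (x 3) (x 4)
def phiv (x : Fin 5 → ℝ) : ℝ := phi0 (x 0) (x 2) (x 1) (x 3) (x 4)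

lemma psiv_pos {x : Fin 5 → ℝ} (hx : x ∈ posOrthant 5) : 0 < psiv x := by
  have hx := mem_posOrthant.1 hx
  have := hx 0; have := hx 1; have := hx 2; have := hx 3; have := hx 4
  unfold psiv psi0; positivity

lemma phiv_pos {x : Fin 5 → ℝ} (hx : x ∈ posOrthant 5) : 0 < phiv x := by
  have hx := mem_posOrthant.1 hx
  have := hx 0; have := hx 1; have := hx 2; have := hx 3; have := hx 4
  unfold phiv phi0; positivity

lemma psiv_meas : Measurable psiv := by unfold psiv psi0; fun_prop
lemma phiv_meas : Measurable phiv := by unfold phiv phi0; fun_prop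

/-- the six logarithms -/
def LL (P Q : ℝ) (x : Fin 5 → ℝ) : Option (Fin 5) → ℝ
  | none => Real.log (P ^ 3 / Q ^ 2)
  | some i => Real.log (x i * P / Q)

def Fcan (l0 : ℝ) (m : Fin 5 → ℝ) (x : Fin 5 → ℝ) : ENNReal :=
  ENNReal.ofReal (Real.exp (l0 * Real.log (psiv x ^ 3 / phiv x ^ 2) + ∑ j, m j * Real.log (x j * psiv x / phiv x))
    * (psiv x * phiv x)⁻¹)

lemma Fcan_meas (l0 : ℝ) (m : Fin 5 → ℝ) : Measurable (Fcan l0 m) := by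
  have := psiv_meas
  have := phiv_meas
  unfold Fcan; fun_prop

lemma Fcan_hom (l0 : ℝ) (m : Fin 5 → ℝ) (r : ℝ) (hr : r > 0) (x : Fin 5 → ℝ) (hx : x ∈ posOrthant 5) :
    ENNReal.ofReal (r ^ 5) * Fcan l0 m (r • x) = Fcan l0 m x := by
  have h1 : psiv (r • x) = r ^ 2 * psiv x := by simp [psiv, psi0]; ring
  have h2 : phiv (r • x) = r ^ 3 * phiv x := by simp [phiv, phi0]; ring
  have hp := psiv_pos hx
  have hq := phiv_pos hx
  have h3 : ((r ^ 2 * psiv x) ^ 3 / (r ^ 3 * phiv x) ^ 2) = psiv x ^ 3 / phiv x ^ 2 := by field_simp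
  have h4 : ∀ j, (r • x) j * (r ^ 2 * psiv x) / (r ^ 3 * phiv x) = x j * psiv x / phiv x := by
    intro j; simp only [Pi.smul_apply, smul_eq_mul]; field_simp
  rw [Fcan, h1, h2, h3]
  simp only [h4]
  rw [Fcan, ← ENNReal.ofReal_mul (by positivity)]
  congr 1
  field_simp

lemma Fcan_eq (l0 : ℝ) (m : Fin 5 → ℝ) {x : Fin 5 → ℝ} (hx : x ∈ posOrthant 5) :
    Fcan l0 m x = ENNReal.ofReal (Real.exp (m 0 * Real.log (x 0) + m 2 * Real.log (x 2) + m 1 * Real.log (x 1)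
    + m 3 * Real.log (x 3) + (3 * l0 + ∑ i, m i - 1) * Real.log (psiv x) + (-2 * l0 - ∑ i, m i - 1) * Real.log (phiv x)
      + m 4 * Real.log (x 4))) := by
  have hp := psiv_pos hx
  have hq := phiv_pos hx
  have hx := mem_posOrthant.1 hx
  have h1 : (psiv x * phiv x)⁻¹ = Real.exp (- Real.log (psiv x) - Real.log (phiv x)) := by
    rw [Real.exp_sub, Real.exp_neg, Real.exp_log hp, Real.exp_log hq, mul_inv]; rfl
  have h2 : ∀ j, Real.log (x j * psiv x / phiv x) = Real.log (x j) + Real.log (psiv x) - Real.log (phiv x) := by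
    intro j
    rw [Real.log_div (mul_pos (hx j) hp).ne' hq.ne', Real.log_mul (hx j).ne' hp.ne']
  rw [Fcan, h1, ← Real.exp_add, Real.log_div (by positivity) (by positivity), Real.log_pow, Real.log_pow]
  congr 2
  simp only [h2, Fin.sum_univ_five]
  push_cast
  ring

lemma orth0 (f : (Fin 0 → ℝ) → ENNReal) : ∫⁻ z in posOrthant 0, f z = f default := by
  have : posOrthant 0 = Set.univ := by ext; simp [mem_posOrthant]
  rw [this, Measure.restrict_univ, volume_pi, Measure.pi_of_empty (fun _ : Fin 0 => (volume : Measure ℝ)) default, lintegral_dirac]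

lemma Fcan_int (l0 : ℝ) (m : Fin 5 → ℝ) :
    ∫⁻ y in posOrthant 4, Fcan l0 m (Fin.snoc y 1) =
      Iint (m 0) (m 2) (m 1) (m 3) (3 * l0 + ∑ i, m i) (-2 * l0 - ∑ i, m i) := by
  have hm : Measurable fun y : Fin 4 → ℝ => (Fin.snoc y 1 : Fin 5 → ℝ) := by
    refine measurable_pi_lambda _ fun i => ?_
    induction i using Fin.lastCases with
    | last =>
      have : (fun c : Fin 4 → ℝ => (Fin.snoc c 1 : Fin 5 → ℝ) (Fin.last 4)) = fun _ => (1:ℝ) := by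
        funext c; exact Fin.snoc_last (α := fun _ => ℝ) _ _
      rw [this]; exact measurable_const
    | cast i => simp only [Fin.snoc_castSucc]; fun_prop
  have hins : ∀ (n : ℕ) (r : ℝ), Measurable fun y : Fin n → ℝ => ((0 : Fin (n+1)).insertNth r y : Fin (n+1) → ℝ) := by
    intro n r
    refine measurable_pi_lambda _ fun i => ?_
    simp only [Fin.insertNth_zero']
    induction i using Fin.cases with
    | zero => simp
    | succ i => simp; fun_prop
  have hF := (Fcan_meas l0 m).comp hm
  rw [Iint]
  refine (split_orth 0 _ hF).trans ?_
  refine setLIntegral_congr_fun measurableSet_Ioi fun B hB => ?_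
  refine (split_orth 0 _ (hF.comp (hins _ _))).trans ?_
  refine setLIntegral_congr_fun measurableSet_Ioi fun A hA => ?_
  refine (split_orth 0 _ ((hF.comp (hins _ _)).comp (hins _ _))).trans ?_
  refine setLIntegral_congr_fun measurableSet_Ioi fun y hy => ?_
  refine (split_orth 0 _ (((hF.comp (hins _ _)).comp (hins _ _)).comp (hins _ _))).trans ?_
  refine setLIntegral_congr_fun measurableSet_Ioi fun z hz => ?_
  rw [orth0]
  have hB : 0 < B := hB
  have hA : 0 < A := hA
  have hy : 0 < y := hy
  have hz : 0 < z := hz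
  have hv : (Fin.snoc ((0 : Fin 4).insertNth B ((0 : Fin 3).insertNth A ((0 : Fin 2).insertNth y ((0 : Fin 1).insertNth z default)))) 1 : Fin 5 → ℝ)
      = ![B, A, y, z, 1] := by
    ext i; fin_cases i <;> rfl
  simp only [Function.comp]
  rw [hv, Fcan_eq]
  · simp [psiv, phiv]
  · rw [mem_posOrthant]; intro i; fin_cases i <;> simp [*]

/-- generating function of the coefficient integrals -/
lemma I_main (u v : Fin 4) (ed : Fin 5 → Sym2 (Fin 4)) (π : Equiv.Perm (Fin 5))
    (hπ : ∀ x : Fin 5 → ℝ, psiI ed x = psiv (x ∘ π) ∧ phiI ed u v x = phiv (x ∘ π)) (l : Option (Fin 5) → ℝ) :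
    ∫⁻ y in posOrthant 4, ENNReal.ofReal (Real.exp (∑ i, l i * LL (psiI ed (Fin.snoc y 1)) (phiI ed u v (Fin.snoc y 1)) (Fin.snoc y 1) i)
      * (psiI ed (Fin.snoc y 1) * phiI ed u v (Fin.snoc y 1))⁻¹) =
      Iint (l (some (π 0))) (l (some (π 2))) (l (some (π 1))) (l (some (π 3)))
        (3 * l none + ∑ i, l (some i)) (-2 * l none - ∑ i, l (some i)) := by
  have h := proj_perm (Fcan (l none) (fun j => l (some (π j)))) (Fcan_meas _ _) (Fcan_hom _ _) π
  rw [Fcan_int, Equiv.sum_comp π (fun j => l (some j))] at h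
  rw [← h]
  refine lintegral_congr fun y => ?_
  rw [(hπ _).1, (hπ _).2, Fcan, Fintype.sum_option]
  simp only [LL]
  rw [← Equiv.sum_comp π (fun i => l (some i) * _)]
  rfl

lemma lin_of_mon {Ω σ : Type*} [MeasurableSpace Ω] [Fintype σ] [DecidableEq σ] {μ : Measure Ω} {L : σ → Ω → ℝ}
    (h : ∀ d : σ → ℕ, Integrable (fun ω => ∏ i, L i ω ^ d i) μ ∧ ∫ ω, ∏ i, L i ω ^ d i ∂μ ∈ Zs)
    (e : σ → ℚ) (n : ℕ) : ∫ ω, (∑ i, (e i : ℝ) * L i ω) ^ n ∂μ ∈ Zs := by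
  have h1 : ∀ ω, (∑ i, (e i : ℝ) * L i ω) ^ n = ∑ k ∈ Finset.piAntidiag univ n,
      (((Nat.multinomial univ k : ℚ) * ∏ i, e i ^ k i : ℚ) : ℝ) * ∏ i, L i ω ^ k i := by
    intro ω
    rw [Finset.sum_pow_eq_sum_piAntidiag]
    refine sum_congr rfl fun k _ => ?_
    push_cast
    simp only [mul_pow, prod_mul_distrib]
    ring
  simp only [h1]
  rw [integral_finsetSum _ fun k _ => (h k).1.const_mul _]
  refine Submodule.sum_mem _ fun k _ => ?_
  rw [integral_const_mul, ← Rat.smul_def]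
  exact Submodule.smul_mem _ _ (h k).2

lemma mon_of_lin {Ω σ : Type*} [MeasurableSpace Ω] [Fintype σ] [DecidableEq σ] {μ : Measure Ω} {L : σ → Ω → ℝ}
    (hL : ∀ i, Measurable (L i))
    (h : ∀ (e : σ → ℚ) (n : ℕ), Integrable (fun ω => (∑ i, (e i : ℝ) * L i ω) ^ n) μ ∧
      ∫ ω, (∑ i, (e i : ℝ) * L i ω) ^ n ∂μ ∈ Zs)
    (d : σ → ℕ) : Integrable (fun ω => ∏ i, L i ω ^ d i) μ ∧ ∫ ω, ∏ i, L i ω ^ d i ∂μ ∈ Zs := by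
  have hint : ∀ d : σ → ℕ, Integrable (fun ω => ∏ i, L i ω ^ d i) μ := by
    intro d
    have h1 : ∀ i n, Integrable (fun ω => L i ω ^ n) μ := by
      intro i n
      have := (h (Pi.single i 1) n).1
      simpa [Pi.single_apply, ite_mul, apply_ite (Rat.cast (K := ℝ))] using this
    have hb : Integrable (fun ω => 1 + ∑ i, |L i ω ^ (∑ i, d i)|) μ := by
      refine Integrable.add ?_ (integrable_finsetSum _ fun i _ => (h1 i _).abs)
      simpa using (h 0 0).1
    refine hb.mono' (by fun_prop) (.of_forall fun ω => ?_)
    rw [Real.norm_eq_abs, abs_prod]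
    simp only [abs_pow]
    rcases isEmpty_or_nonempty σ with hσ | hσ
    · simp
    · obtain ⟨i, _, hi⟩ := exists_max_image univ (fun i => |L i ω|) univ_nonempty
      calc ∏ i, |L i ω| ^ d i ≤ ∏ j, |L i ω| ^ d j := by
            refine prod_le_prod (fun _ _ => by positivity) fun j hj => ?_
            have := hi j hj
            gcongr
        _ = |L i ω| ^ ∑ j, d j := by rw [prod_pow_eq_pow_sum]
        _ ≤ ∑ i, |L i ω| ^ ∑ i, d i := single_le_sum (f := fun i => |L i ω| ^ ∑ i, d i) (fun _ _ => by positivity) (mem_univ i)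
        _ ≤ _ := by linarith
  refine ⟨hint d, ?_⟩
  by_contra hcon
  obtain ⟨f, hf2, hf1⟩ := Submodule.exists_le_ker_of_notMem hcon
  set n := ∑ i, d i with hn
  let c : (σ → ℕ) → ℚ := fun k => (Nat.multinomial univ k : ℚ) * f (∫ ω, ∏ i, L i ω ^ k i ∂μ)
  let P : MvPolynomial σ ℚ := ∑ k ∈ Finset.piAntidiag univ n, MvPolynomial.monomial (Finsupp.equivFunOnFinite.symm k) (c k)
  have hP : P = 0 := by
    refine MvPolynomial.funext fun e => ?_
    have h1 : ∀ ω, (∑ i, (e i : ℝ) * L i ω) ^ n = ∑ k ∈ Finset.piAntidiag univ n,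
        (((Nat.multinomial univ k : ℚ) * ∏ i, e i ^ k i : ℚ) : ℝ) * ∏ i, L i ω ^ k i := by
      intro ω
      rw [Finset.sum_pow_eq_sum_piAntidiag]
      refine sum_congr rfl fun k _ => ?_
      push_cast
      simp only [mul_pow, prod_mul_distrib]
      ring
    have h2 := hf1 (h e n).2
    rw [LinearMap.mem_ker] at h2
    simp only [h1] at h2
    rw [integral_finsetSum _ fun k _ => (hint k).const_mul _, map_sum] at h2
    simp only [integral_const_mul] at h2
    simp only [← Rat.smul_def, map_smul, smul_eq_mul] at h2
    simp only [P, map_sum, MvPolynomial.eval_monomial, map_zero]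
    rw [← h2]
    refine sum_congr rfl fun k _ => ?_
    rw [Finsupp.prod_fintype _ _ (by simp)]
    simp [c]; ring
  have hc := congrArg (MvPolynomial.coeff (Finsupp.equivFunOnFinite.symm d)) hP
  simp only [P, MvPolynomial.coeff_sum, MvPolynomial.coeff_monomial, MvPolynomial.coeff_zero,
    EmbeddingLike.apply_eq_iff_eq] at hc
  rw [sum_ite_eq', if_pos (by simp [hn])] at hc
  have : (Nat.multinomial univ d : ℚ) ≠ 0 := by exact_mod_cast (Nat.multinomial_pos _ _).ne'
  rcases mul_eq_zero.1 hc with h | h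
  · exact this h
  · exact hf2 h

def Good (f : ℝ → ℝ) : Prop := AnalyticAt ℝ f 0 ∧ ∀ n, iteratedDeriv n f 0 ∈ Zs

lemma Zs_mul {x y : ℝ} (hx : x ∈ Zs) (hy : y ∈ Zs) : x * y ∈ Zs :=
  mem_ZA.1 (mul_mem (mem_ZA.2 hx) (mem_ZA.2 hy))

lemma Zs_nat {y : ℝ} (n : ℕ) (hy : y ∈ Zs) : (n : ℝ) * y ∈ Zs := by
  rw [← nsmul_eq_mul]; exact Submodule.smul_of_tower_mem _ _ hy

lemma Good.mul {f g : ℝ → ℝ} (hf : Good f) (hg : Good g) : Good (f * g) := by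
  refine ⟨hf.1.mul hg.1, fun n => ?_⟩
  rw [iteratedDeriv_mul hf.1.contDiffAt hg.1.contDiffAt]
  refine Submodule.sum_mem _ fun k _ => ?_
  rw [mul_assoc]
  exact Zs_nat _ (Zs_mul (hf.2 _) (hg.2 _))

lemma Good.div {f g h : ℝ → ℝ} (hf : AnalyticAt ℝ f 0) (hg : Good g) (hh : Good h)
    (e : f * g =ᶠ[𝓝 0] h) (hg0 : g 0 = 1 / 2) (n : ℕ) : iteratedDeriv n f 0 ∈ Zs := by
  induction n using Nat.strong_induction_on with
  | _ n ih =>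
    have h1 := e.iteratedDeriv_eq n
    rw [iteratedDeriv_mul hf.contDiffAt hg.1.contDiffAt, sum_range_succ] at h1
    simp only [Nat.choose_self, Nat.sub_self, iteratedDeriv_zero, hg0] at h1
    have h2 : iteratedDeriv n f 0 = (2:ℚ) • (iteratedDeriv n h 0 - ∑ i ∈ range n, (n.choose i : ℝ) * iteratedDeriv i f 0 * iteratedDeriv (n - i) g 0) := by
      rw [← h1, Rat.smul_def]; push_cast; ring
    rw [h2]
    refine Submodule.smul_mem _ _ (Submodule.sub_mem _ (hh.2 n) (Submodule.sum_mem _ fun k hk => ?_))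
    rw [mul_assoc]
    exact Zs_nat _ (Zs_mul (ih k (mem_range.1 hk)) (hg.2 _))

open ProbabilityTheory in
lemma expset_of_pos {Ω σ : Type*} [MeasurableSpace Ω] [Fintype σ] {μ : Measure Ω} {L : σ → Ω → ℝ}
    (hL : ∀ i, Measurable (L i)) (hpos : ∀ᵐ ω ∂μ, ∀ i, 0 ≤ L i ω) {δ : ℝ} (hδ : 0 < δ)
    (hint : Integrable (fun ω => Real.exp (δ * ∑ i, L i ω)) μ) (e : σ → ℝ) :
    0 ∈ interior (integrableExpSet (fun ω => ∑ i, e i * L i ω) μ) := by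
  rw [mem_interior_iff_mem_nhds]
  set M := 1 + ∑ i, |e i| with hM
  have hM0 : 0 < M := by positivity
  refine Filter.mem_of_superset (Metric.ball_mem_nhds 0 (by positivity : 0 < δ / M)) fun t ht => ?_
  refine hint.mono' (by fun_prop) ?_
  filter_upwards [hpos] with ω hω
  rw [Real.norm_eq_abs, abs_of_pos (Real.exp_pos _), Real.exp_le_exp, mul_sum, mul_sum]
  refine sum_le_sum fun i _ => ?_
  rw [← mul_assoc]
  refine mul_le_mul_of_nonneg_right ?_ (hω i)
  have h1 : |e i| ≤ M := by
    have := single_le_sum (f := fun i => |e i|) (fun _ _ => abs_nonneg _) (mem_univ i)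
    linarith
  have h2 : |t| < δ / M := by simpa using ht
  calc t * e i ≤ |t| * |e i| := by rw [← abs_mul]; exact le_abs_self _
    _ ≤ δ / M * M := by gcongr
    _ = δ := by field_simp

open ProbabilityTheory in
lemma mgf_good {Ω σ : Type*} [MeasurableSpace Ω] [Fintype σ] [DecidableEq σ] {μ : Measure Ω} {L : σ → Ω → ℝ}
    (hL : ∀ i, Measurable (L i)) (hpos : ∀ᵐ ω ∂μ, ∀ i, 0 ≤ L i ω) {δ : ℝ} (hδ : 0 < δ)
    (hint : Integrable (fun ω => Real.exp (δ * ∑ i, L i ω)) μ)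
    (hZ : ∀ d : σ → ℕ, ∫⁻ ω, ENNReal.ofReal (∏ i, L i ω ^ d i) ∂μ ≠ ⊤ → (∫⁻ ω, ENNReal.ofReal (∏ i, L i ω ^ d i) ∂μ).toReal ∈ Zs)
    (e : σ → ℚ) : Good (mgf (fun ω => ∑ i, (e i : ℝ) * L i ω) μ) := by
  have h0 := expset_of_pos hL hpos hδ hint
  refine ⟨analyticAt_mgf (h0 _), fun n => ?_⟩
  rw [iteratedDeriv_mgf_zero (h0 _)]
  have hmon : ∀ d : σ → ℕ, Integrable (fun ω => ∏ i, L i ω ^ d i) μ := by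
    intro d
    have hn := integrable_pow_abs_of_mem_interior_integrableExpSet (h0 fun _ => 1) (∑ i, d i)
    refine hn.mono' (by fun_prop) ?_
    filter_upwards [hpos] with ω hω
    simp only [one_mul]
    rw [Real.norm_eq_abs, abs_of_nonneg (prod_nonneg fun i _ => pow_nonneg (hω i) _),
      abs_of_nonneg (sum_nonneg fun i _ => hω i), ← prod_pow_eq_pow_sum]
    refine prod_le_prod (fun i _ => pow_nonneg (hω i) _) fun i _ => ?_
    have := single_le_sum (f := fun i => L i ω) (fun i _ => hω i) (mem_univ i)
    have := hω i
    gcongr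
  refine lin_of_mon (fun d => ⟨hmon d, ?_⟩) e n
  have hp : 0 ≤ᵐ[μ] fun ω => ∏ i, L i ω ^ d i := by
    filter_upwards [hpos] with ω hω using prod_nonneg fun i _ => pow_nonneg (hω i) _
  rw [integral_eq_lintegral_of_nonneg_ae hp (hmon d).1]
  refine hZ d ?_
  have := (hmon d).2
  rw [hasFiniteIntegral_iff_ofReal hp] at this
  exact this.ne

open ProbabilityTheory in
lemma beta_val {p q : ℝ} (hp : 0 < p) (hq : 0 < q) :
    ∫⁻ t, ENNReal.ofReal (Real.exp ((p - 1) * Real.log t + (q - 1) * Real.log (1 - t))) ∂mQ = ENNReal.ofReal (beta p q) := by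
  have h := lintegral_betaPDF_eq_one hp hq
  have hB := beta_pos hp hq
  rw [← mul_one (ENNReal.ofReal (beta p q)), ← h, ← lintegral_indicator measurableSet_Ioo, ← lintegral_const_mul']
  · refine lintegral_congr fun x => ?_
    rw [betaPDF_eq, ← ENNReal.ofReal_mul hB.le, Set.indicator_apply]
    simp only [Set.mem_Ioo]
    split_ifs with hx
    · congr 1
      rw [← mul_assoc, ← mul_assoc, mul_one_div_cancel hB.ne', one_mul, Real.rpow_def_of_pos hx.1,
        Real.rpow_def_of_pos (by linarith [hx.2] : 0 < 1 - x), ← Real.exp_add]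
      congr 1; ring
    · simp
  · exact ENNReal.ofReal_ne_top

def muB (n : ℕ) : Measure ℝ := mQ.withDensity fun t => ENNReal.ofReal (t ^ n)

def bl : Fin 2 → ℝ → ℝ := ![fun t => -Real.log t, fun t => -Real.log (1 - t)]

lemma bl_meas (i : Fin 2) : Measurable (bl i) := by
  fin_cases i
  · exact (Real.measurable_log).neg
  · exact (Real.measurable_log.comp (measurable_const.sub measurable_id)).neg

lemma muB_lint (n : ℕ) {f : ℝ → ENNReal} (hf : Measurable f) :
    ∫⁻ t, f t ∂(muB n) = ∫⁻ t, ENNReal.ofReal (t ^ n) * f t ∂mQ := by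
  rw [muB, lintegral_withDensity_eq_lintegral_mul _ (by fun_prop) hf]
  rfl

lemma mQ_mem : ∀ᵐ t ∂mQ, t ∈ Set.Ioo (0:ℝ) 1 := ae_restrict_mem measurableSet_Ioo

open ProbabilityTheory in
lemma muB_val (n : ℕ) (p q : ℝ) (hp : 0 < 1 + n + p) (hq : 0 < 1 + q) :
    ∫⁻ t, ENNReal.ofReal (Real.exp (-p * bl 0 t + -q * bl 1 t)) ∂(muB n) = ENNReal.ofReal (beta (1 + n + p) (1 + q)) := by
  have := bl_meas
  rw [muB_lint _ (by fun_prop), ← beta_val hp hq]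
  refine lintegral_congr_ae ?_
  filter_upwards [mQ_mem] with t ht
  have h0 := ht.1
  rw [← ENNReal.ofReal_mul (by positivity)]
  congr 1
  rw [← Real.exp_log (pow_pos h0 n), ← Real.exp_add, Real.log_pow]
  congr 1
  simp [bl]; ring

lemma mgf_lint {Ω : Type*} [MeasurableSpace Ω] {μ : Measure Ω} {X : Ω → ℝ} (hX : Measurable X) (t : ℝ) :
    ProbabilityTheory.mgf X μ t = (∫⁻ ω, ENNReal.ofReal (Real.exp (t * X ω)) ∂μ).toReal :=
  integral_eq_lintegral_of_nonneg_ae (.of_forall fun _ => (Real.exp_pos _).le) (by fun_prop)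

lemma exp_int_iff {Ω : Type*} [MeasurableSpace Ω] {μ : Measure Ω} {X : Ω → ℝ} (hX : Measurable X) :
    Integrable (fun ω => Real.exp (X ω)) μ ↔ ∫⁻ ω, ENNReal.ofReal (Real.exp (X ω)) ∂μ ≠ ⊤ := by
  rw [Integrable, and_iff_right (by fun_prop), hasFiniteIntegral_iff_ofReal (.of_forall fun _ => (Real.exp_pos _).le),
    lt_top_iff_ne_top]

open ProbabilityTheory in
lemma muB_mgf (n : ℕ) (p q : ℚ) (t : ℝ) (hp : 0 < 1 + n + t * p) (hq : 0 < 1 + t * q) :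
    mgf (fun ω => ∑ i, ((![-p, -q] i : ℚ) : ℝ) * bl i ω) (muB n) t = beta (1 + n + t * p) (1 + t * q) := by
  have := bl_meas
  rw [mgf_lint (by fun_prop)]
  rw [← ENNReal.toReal_ofReal (beta_pos hp hq).le, ← muB_val n _ _ hp hq]
  congr 1
  refine lintegral_congr fun ω => ?_
  congr 2
  simp [Fin.sum_univ_two]; ring

lemma muB_good (n : ℕ) (e : Fin 2 → ℚ) : Good (ProbabilityTheory.mgf (fun ω => ∑ i, (e i : ℝ) * bl i ω) (muB n)) := by
  have hm := bl_meas
  have hpos : ∀ᵐ t ∂(muB n), ∀ i, 0 ≤ bl i t := by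
    refine (withDensity_absolutelyContinuous _ _).ae_le ?_
    filter_upwards [mQ_mem] with t ht
    have p1 : 0 ≤ -Real.log t := by linarith [Real.log_neg ht.1 ht.2]
    have p2 : 0 ≤ -Real.log (1 - t) := by linarith [Real.log_neg (by linarith [ht.2] : 0 < 1 - t) (by linarith [ht.1])]
    rw [Fin.forall_fin_two]
    exact ⟨p1, p2⟩
  refine mgf_good (δ := 1/2) hm hpos (by norm_num) ?_ (fun d _ => ?_) e
  · rw [exp_int_iff (by fun_prop)]
    have h := muB_val n (-(1/2)) (-(1/2)) (by linarith [Nat.cast_nonneg (α := ℝ) n]) (by norm_num)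
    have : ∀ ω, (1/2 : ℝ) * ∑ i, bl i ω = - -(1/2) * bl 0 ω + - -(1/2) * bl 1 ω := by
      intro ω; rw [Fin.sum_univ_two]; ring
    simp only [this]
    rw [h]
    exact ENNReal.ofReal_ne_top
  · rw [muB_lint _ (by fun_prop)]
    have : ∫⁻ t, ENNReal.ofReal (t ^ n) * ENNReal.ofReal (∏ i, bl i t ^ d i) ∂mQ = ENNReal.ofReal (EE (d 0) (d 1) n) := by
      rw [EE, ofReal_integral_eq_lintegral_ofReal (EE_int _ _ _)]
      · refine lintegral_congr_ae ?_
        filter_upwards [mQ_mem] with t ht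
        have h0 := ht.1
        rw [← ENNReal.ofReal_mul (by positivity), Fin.prod_univ_two]
        rfl
      · filter_upwards [mQ_mem] with t ht
        have p1 : 0 ≤ -Real.log t := by linarith [Real.log_neg ht.1 ht.2]
        have p2 : 0 ≤ -Real.log (1 - t) := by linarith [Real.log_neg (by linarith [ht.2] : 0 < 1 - t) (by linarith [ht.1])]
        have h0 := ht.1
        simp only [Pi.zero_apply]
        positivity
    rw [this, ENNReal.toReal_ofReal (EE_nonneg _ _ _)]
    exact TT_val (EE_mem _ _) _

/-- the Dirichlet factor -/
def DD (p q r : ℚ) : ℝ → ℝ :=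
  ProbabilityTheory.mgf (fun ω => ∑ i, ((![-p, -q] i : ℚ) : ℝ) * bl i ω) (muB 0) *
  ProbabilityTheory.mgf (fun ω => ∑ i, ((![-(p+q), -r] i : ℚ) : ℝ) * bl i ω) (muB 1)

lemma DD_good (p q r : ℚ) : Good (DD p q r) := (muB_good _ _).mul (muB_good _ _)

lemma DD_val (p q r : ℚ) (t : ℝ) (hp : 0 < 1 + t * p) (hq : 0 < 1 + t * q) (hr : 0 < 1 + t * r) :
    DD p q r t = Real.Gamma (1 + t * p) * Real.Gamma (1 + t * q) * Real.Gamma (1 + t * r) / Real.Gamma (3 + t * (p + q + r)) := by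
  have e1 : (0:ℝ) < 1 + (1:ℕ) + t * ((p + q : ℚ) : ℝ) := by push_cast; linarith
  have h : Real.Gamma (1 + t * p + (1 + t * q)) ≠ 0 := (Real.Gamma_pos_of_pos (by linarith)).ne'
  rw [DD, Pi.mul_apply, muB_mgf 0 p q t (by simpa using hp) hq, muB_mgf 1 (p+q) r t e1 hr, ProbabilityTheory.beta, ProbabilityTheory.beta]
  push_cast
  rw [show (1 + 1 + t * ((p:ℝ) + q)) = 1 + t * p + (1 + t * q) by ring,
    show (1 + t * p + (1 + t * q)) + (1 + t * (r:ℝ)) = 3 + t * (p + q + r) by ring, add_zero]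
  field_simp

lemma DD_zero (p q r : ℚ) : DD p q r 0 = 1 / 2 := by
  rw [DD_val _ _ _ _ (by simp) (by simp) (by simp)]
  simp

abbrev O4 := ℝ × ℝ × ℝ × ℝ

def wJ (o : O4) : ℝ := o.2.2.2 / ((1 - o.2.2.2 * o.1) * (1 - o.2.2.2 * o.2.1) * (1 - o.2.2.2 * o.2.2.1))

lemma wJ_meas : Measurable wJ := by unfold wJ; fun_prop

def muJ : Measure O4 := (mQ.prod (mQ.prod (mQ.prod mQ))).withDensity fun o => ENNReal.ofReal (wJ o)

def jb : Fin 11 → O4 → ℝ := ![fun o => o.1, fun o => 1 - o.1, fun o => o.2.1, fun o => 1 - o.2.1,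
  fun o => o.2.2.2, fun o => 1 - o.2.2.2, fun o => o.2.2.1, fun o => 1 - o.2.2.1,
  fun o => 1 - o.2.2.2 * o.1, fun o => 1 - o.2.2.2 * o.2.1, fun o => 1 - o.2.2.2 * o.2.2.1]

def jl (i : Fin 11) (o : O4) : ℝ := -Real.log (jb i o)

lemma jb_meas (i : Fin 11) : Measurable (jb i) := by
  have h : ∀ f : O4 → ℝ, Measurable f → Measurable fun o => 1 - o.2.2.2 * f o := by intro f hf; fun_prop
  have h1 : ∀ f : O4 → ℝ, Measurable f → Measurable fun o => 1 - f o := by intro f hf; fun_prop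
  have m1 : Measurable fun o : O4 => o.1 := by fun_prop
  have m2 : Measurable fun o : O4 => o.2.1 := by fun_prop
  have m3 : Measurable fun o : O4 => o.2.2.1 := by fun_prop
  have m4 : Measurable fun o : O4 => o.2.2.2 := by fun_prop
  fin_cases i
  exacts [m1, h1 _ m1, m2, h1 _ m2, m4, h1 _ m4, m3, h1 _ m3, h _ m1, h _ m2, h _ m3]

lemma jl_meas (i : Fin 11) : Measurable (jl i) := by
  have := jb_meas i
  unfold jl; fun_prop

def OQ : Set O4 := Set.Ioo 0 1 ×ˢ Set.Ioo 0 1 ×ˢ Set.Ioo 0 1 ×ˢ Set.Ioo 0 1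

lemma jb_mem {o : O4} (ho : o ∈ OQ) (i : Fin 11) : 0 < jb i o ∧ jb i o ≤ 1 := by
  obtain ⟨t, s, r, X⟩ := o
  obtain ⟨⟨a1, a2⟩, ⟨b1, b2⟩, ⟨c1, c2⟩, ⟨d1, d2⟩⟩ := ho
  simp only at a1 a2 b1 b2 c1 c2 d1 d2
  have k1 : ∀ x : ℝ, 0 < x → x < 1 → 0 < 1 - x ∧ 1 - x ≤ 1 := fun x h h' => ⟨by linarith, by linarith⟩
  have k2 : ∀ x : ℝ, 0 < x → x < 1 → 0 < 1 - X * x ∧ 1 - X * x ≤ 1 := fun x h h' =>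
    k1 _ (mul_pos d1 h) (by nlinarith)
  fin_cases i
  exacts [⟨a1, a2.le⟩, k1 _ a1 a2, ⟨b1, b2.le⟩, k1 _ b1 b2, ⟨d1, d2.le⟩, k1 _ d1 d2, ⟨c1, c2.le⟩, k1 _ c1 c2,
    k2 _ a1 a2, k2 _ b1 b2, k2 _ c1 c2]

lemma jl_nonneg {o : O4} (ho : o ∈ OQ) (i : Fin 11) : 0 ≤ jl i o := by
  have := jb_mem ho i
  have := Real.log_nonpos this.1.le this.2
  unfold jl; linarith

lemma OQ_ae : ∀ᵐ o ∂(mQ.prod (mQ.prod (mQ.prod mQ))), o ∈ OQ := by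
  have : mQ.prod (mQ.prod (mQ.prod mQ)) = volume.restrict OQ := by
    rw [OQ, Measure.prod_restrict, Measure.prod_restrict, Measure.prod_restrict]
    rfl
  rw [this]
  exact ae_restrict_mem (measurableSet_Ioo.prod (measurableSet_Ioo.prod (measurableSet_Ioo.prod measurableSet_Ioo)))

lemma prod4_lint {f : O4 → ENNReal} (hf : Measurable f) :
    ∫⁻ o, f o ∂(mQ.prod (mQ.prod (mQ.prod mQ))) = ∫⁻ t, ∫⁻ s, ∫⁻ r, ∫⁻ X, f (t, s, r, X) ∂mQ ∂mQ ∂mQ ∂mQ := by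
  refine (lintegral_prod _ hf.aemeasurable).trans ?_
  refine lintegral_congr fun t => ?_
  have h1 := hf.comp (measurable_const.prodMk measurable_id : Measurable fun o : ℝ × ℝ × ℝ => (t, o))
  refine (lintegral_prod _ h1.aemeasurable).trans ?_
  refine lintegral_congr fun s => ?_
  have h2 := h1.comp (measurable_const.prodMk measurable_id : Measurable fun o : ℝ × ℝ => (s, o))
  exact (lintegral_prod _ h2.aemeasurable)

lemma muJ_lint {f : O4 → ENNReal} (hf : Measurable f) :
    ∫⁻ o, f o ∂muJ = ∫⁻ o, ENNReal.ofReal (wJ o) * f o ∂(mQ.prod (mQ.prod (mQ.prod mQ))) := by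
  have := wJ_meas
  rw [muJ, lintegral_withDensity_eq_lintegral_mul _ (by fun_prop) hf]
  rfl

lemma wJ_exp {o : O4} (ho : o ∈ OQ) : 0 < wJ o ∧ wJ o = Real.exp (- jl 4 o + jl 8 o + jl 9 o + jl 10 o) := by
  have h4 := (jb_mem ho 4).1
  have h8 := (jb_mem ho 8).1
  have h9 := (jb_mem ho 9).1
  have h10 := (jb_mem ho 10).1
  have e : wJ o = jb 4 o / (jb 8 o * jb 9 o * jb 10 o) := rfl
  refine ⟨by rw [e]; positivity, ?_⟩
  rw [e]
  simp only [jl, Real.exp_add, neg_neg, Real.exp_neg, Real.exp_log h4, Real.exp_log h8, Real.exp_log h9, Real.exp_log h10]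
  field_simp

lemma J_val (m1 n1 m2 n2 u v w a b h : ℝ) :
    ∫⁻ o, ENNReal.ofReal (Real.exp (∑ i, (![-m1, -n1, -m2, -n2, v + w, u, v, w, a, b, h] : Fin 11 → ℝ) i * jl i o)) ∂muJ
      = Jint m1 n1 m2 n2 u v w a b h := by
  have := jl_meas
  rw [muJ_lint (by fun_prop), Jint]
  let g : O4 → ENNReal := fun o => ENNReal.ofReal (Real.exp (m1 * Real.log o.1 + n1 * Real.log (1 - o.1) + m2 * Real.log o.2.1
      + n2 * Real.log (1 - o.2.1) + ((1 - v - w) * Real.log o.2.2.2 - u * Real.log (1 - o.2.2.2) - v * Real.log o.2.2.1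
      - w * Real.log (1 - o.2.2.1) - (1 + a) * Real.log (1 - o.2.2.2 * o.1) - (1 + b) * Real.log (1 - o.2.2.2 * o.2.1)
      - (1 + h) * Real.log (1 - o.2.2.2 * o.2.2.1))))
  have hg : Measurable g := by fun_prop
  refine Eq.trans ?_ (prod4_lint hg)
  refine lintegral_congr_ae ?_
  filter_upwards [OQ_ae] with o ho
  have hw := wJ_exp ho
  rw [← ENNReal.ofReal_mul hw.1.le, hw.2, ← Real.exp_add]
  simp only [g]
  congr 2
  simp only [Fin.sum_univ_succ, Fin.sum_univ_zero, jl, jb]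
  simp
  ring

lemma J_fin : ∫⁻ o, ENNReal.ofReal (Real.exp ((1/16) * ∑ i, jl i o)) ∂muJ ≠ ⊤ := by
  have hm := jl_meas
  rw [muJ_lint (by fun_prop)]
  let g : O4 → ENNReal := fun o => ENNReal.ofReal (o.1 ^ (-(1/16):ℝ) * (1 - o.1) ^ (-(14/16):ℝ)) *
    (ENNReal.ofReal (o.2.1 ^ (-(1/16):ℝ) * (1 - o.2.1) ^ (-(14/16):ℝ)) *
    (ENNReal.ofReal (o.2.2.1 ^ (-(1/16):ℝ) * (1 - o.2.2.1) ^ (-(14/16):ℝ)) *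
    ENNReal.ofReal (o.2.2.2 ^ (-(1/16):ℝ) * (1 - o.2.2.2) ^ (-(13/16):ℝ))))
  have hg : Measurable g := by fun_prop
  have hfin : ∫⁻ o, g o ∂(mQ.prod (mQ.prod (mQ.prod mQ))) < ⊤ := by
    rw [prod4_lint hg]
    simp only [g]
    have e1 := beta_fin (a := 1/16) (b := 14/16) (by norm_num) (by norm_num)
    have e2 := beta_fin (a := 1/16) (b := 13/16) (by norm_num) (by norm_num)
    simp_rw [lintegral_const_mul' _ _ ENNReal.ofReal_ne_top]
    rw [lintegral_mul_const _ (by fun_prop), lintegral_mul_const _ (by fun_prop), lintegral_mul_const _ (by fun_prop)]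
    exact ENNReal.mul_lt_top e1 (ENNReal.mul_lt_top e1 (ENNReal.mul_lt_top e1 e2))
  refine (lt_of_le_of_lt (lintegral_mono_ae ?_) hfin).ne
  filter_upwards [OQ_ae] with o ho
  have hw := wJ_exp ho
  have hb := jb_mem ho
  have l4 := jl_nonneg ho 4
  have hrp : ∀ i (c : ℝ), jb i o ^ (-c) = Real.exp (c * jl i o) := by
    intro i c
    rw [Real.rpow_def_of_pos (hb i).1, jl]; congr 1; ring
  have hge : jl 8 o ≤ jl 1 o ∧ jl 8 o ≤ jl 5 o ∧ jl 9 o ≤ jl 3 o ∧ jl 9 o ≤ jl 5 o ∧ jl 10 o ≤ jl 7 o ∧ jl 10 o ≤ jl 5 o := by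
    have key : ∀ i j, jb j o ≤ jb i o → jl i o ≤ jl j o := fun i j h => by
      have := Real.log_le_log (hb j).1 h
      unfold jl; linarith
    obtain ⟨t, s, r, X⟩ := o
    obtain ⟨⟨a1, a2⟩, ⟨b1, b2⟩, ⟨c1, c2⟩, ⟨d1, d2⟩⟩ := ho
    simp only at a1 a2 b1 b2 c1 c2 d1 d2
    have k1 : ∀ x : ℝ, 0 < x → x < 1 → 1 - x ≤ 1 - X * x := fun x h h' => by nlinarith
    have k2 : ∀ x : ℝ, 0 < x → x < 1 → 1 - X ≤ 1 - X * x := fun x h h' => by nlinarith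
    exact ⟨key _ _ (k1 _ a1 a2), key _ _ (k2 _ a1 a2), key _ _ (k1 _ b1 b2), key _ _ (k2 _ b1 b2), key _ _ (k1 _ c1 c2), key _ _ (k2 _ c1 c2)⟩
  have p : ∀ i j (c d : ℝ), 0 ≤ jb i o ^ c * jb j o ^ d := fun i j c d =>
    mul_nonneg (Real.rpow_nonneg (hb i).1.le _) (Real.rpow_nonneg (hb j).1.le _)
  have hgo : g o = ENNReal.ofReal ((jb 0 o ^ (-(1/16):ℝ) * jb 1 o ^ (-(14/16):ℝ)) * ((jb 2 o ^ (-(1/16):ℝ) * jb 3 o ^ (-(14/16):ℝ)) *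
      ((jb 6 o ^ (-(1/16):ℝ) * jb 7 o ^ (-(14/16):ℝ)) * (jb 4 o ^ (-(1/16):ℝ) * jb 5 o ^ (-(13/16):ℝ))))) := by
    rw [ENNReal.ofReal_mul (p _ _ _ _), ENNReal.ofReal_mul (p _ _ _ _), ENNReal.ofReal_mul (p _ _ _ _)]
    rfl
  rw [hgo, ← ENNReal.ofReal_mul hw.1.le, hw.2, ← Real.exp_add]
  refine ENNReal.ofReal_le_ofReal ?_
  simp only [hrp, ← Real.exp_add]
  rw [Real.exp_le_exp]
  simp only [Fin.sum_univ_succ, Fin.sum_univ_zero]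
  simp
  obtain ⟨g1, g2, g3, g4, g5, g6⟩ := hge
  linarith

lemma J_mon (d : Fin 11 → ℕ) : ∫⁻ o, ENNReal.ofReal (∏ i, jl i o ^ d i) ∂muJ =
    Jmon (d 4) (d 5) (d 0) (d 1) (d 8) (d 2) (d 3) (d 9) (d 6) (d 7) (d 10) := by
  have hm := jl_meas
  rw [muJ_lint (by fun_prop)]
  let A : ℕ → ℕ → ℕ → ℝ → ℝ → ENNReal := fun i j k X t =>
    ENNReal.ofReal ((-Real.log t) ^ i * (-Real.log (1 - t)) ^ j * ((-Real.log (1 - X * t)) ^ k / (1 - X * t)))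
  have hA : ∀ i j k, Measurable fun p : ℝ × ℝ => A i j k p.1 p.2 := by intro i j k; fun_prop
  let B : ℝ → ENNReal := fun X => ENNReal.ofReal (X*((-Real.log X)^d 4*(-Real.log (1-X))^d 5))
  have hB : Measurable B := by fun_prop
  let G : ℝ → ℝ → ℝ → ℝ → ENNReal := fun t s r X => B X * (A (d 0) (d 1) (d 8) X t * A (d 2) (d 3) (d 9) X s * A (d 6) (d 7) (d 10) X r)
  have hG : Measurable fun o : O4 => G o.1 o.2.1 o.2.2.1 o.2.2.2 := by simp only [G, A, B]; fun_prop
  have e1 : ∫⁻ o, ENNReal.ofReal (wJ o) * ENNReal.ofReal (∏ i, jl i o ^ d i) ∂(mQ.prod (mQ.prod (mQ.prod mQ)))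
      = ∫⁻ o : O4, G o.1 o.2.1 o.2.2.1 o.2.2.2 ∂(mQ.prod (mQ.prod (mQ.prod mQ))) := by
    refine lintegral_congr_ae ?_
    filter_upwards [OQ_ae] with o ho
    have hw := wJ_exp ho
    have hb := jb_mem ho
    have hl := jl_nonneg ho
    have q : ∀ i j k (x y z : ℕ), 0 ≤ jl i o ^ x * jl j o ^ y * (jl k o ^ z / jb k o) := fun i j k x y z =>
      mul_nonneg (mul_nonneg (pow_nonneg (hl i) _) (pow_nonneg (hl j) _)) (div_nonneg (pow_nonneg (hl k) _) (hb k).1.le)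
    have hGo : G o.1 o.2.1 o.2.2.1 o.2.2.2 = ENNReal.ofReal (jb 4 o * (jl 4 o ^ d 4 * jl 5 o ^ d 5)) *
      (ENNReal.ofReal (jl 0 o ^ d 0 * jl 1 o ^ d 1 * (jl 8 o ^ d 8 / jb 8 o)) *
       ENNReal.ofReal (jl 2 o ^ d 2 * jl 3 o ^ d 3 * (jl 9 o ^ d 9 / jb 9 o)) *
       ENNReal.ofReal (jl 6 o ^ d 6 * jl 7 o ^ d 7 * (jl 10 o ^ d 10 / jb 10 o))) := rfl
    rw [hGo, ← ENNReal.ofReal_mul (q _ _ _ _ _ _), ← ENNReal.ofReal_mul (mul_nonneg (q _ _ _ _ _ _) (q _ _ _ _ _ _)),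
      ← ENNReal.ofReal_mul (mul_nonneg (hb 4).1.le (mul_nonneg (pow_nonneg (hl _) _) (pow_nonneg (hl _) _))),
      ← ENNReal.ofReal_mul hw.1.le]
    congr 1
    have e : wJ o = jb 4 o / (jb 8 o * jb 9 o * jb 10 o) := rfl
    rw [e]
    have h8 := (hb 8).1.ne'
    have h9 := (hb 9).1.ne'
    have h10 := (hb 10).1.ne'
    have hp : ∏ i, jl i o ^ d i = jl 0 o ^ d 0 * jl 1 o ^ d 1 * jl 2 o ^ d 2 * jl 3 o ^ d 3 * jl 4 o ^ d 4 * jl 5 o ^ d 5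
       * jl 6 o ^ d 6 * jl 7 o ^ d 7 * jl 8 o ^ d 8 * jl 9 o ^ d 9 * jl 10 o ^ d 10 := by
      simp only [Fin.prod_univ_castSucc, Fin.prod_univ_zero, one_mul]; rfl
    rw [hp]
    simp only [div_eq_mul_inv, mul_inv]
    generalize jl 0 o ^ d 0 = y0
    generalize jl 1 o ^ d 1 = y1
    generalize jl 2 o ^ d 2 = y2
    generalize jl 3 o ^ d 3 = y3
    generalize jl 4 o ^ d 4 = y4
    generalize jl 5 o ^ d 5 = y5
    generalize jl 6 o ^ d 6 = y6
    generalize jl 7 o ^ d 7 = y7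
    generalize jl 8 o ^ d 8 = y8
    generalize jl 9 o ^ d 9 = y9
    generalize jl 10 o ^ d 10 = y10
    generalize (jb 8 o)⁻¹ = z8
    generalize (jb 9 o)⁻¹ = z9
    generalize (jb 10 o)⁻¹ = z10
    ring
  rw [e1, prod4_lint hG, swap22 mQ mQ mQ mQ G (by simp only [G, A, B]; fun_prop), Jmon]
  rw [lintegral_lintegral_swap]
  · refine lintegral_congr fun X => ?_
    have hAX : ∀ i j k, Measurable (A i j k X) := by intro i j k; fun_prop
    simp only [G]
    have s1 : ∀ r t, ∫⁻ s, B X * (A (d 0) (d 1) (d 8) X t * A (d 2) (d 3) (d 9) X s * A (d 6) (d 7) (d 10) X r) ∂mQ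
      = B X * (A (d 0) (d 1) (d 8) X t * PsiI3 (d 2) (d 3) (d 9) X * A (d 6) (d 7) (d 10) X r) := by
      intro r t
      rw [lintegral_const_mul _ (by fun_prop), lintegral_mul_const _ (by fun_prop), lintegral_const_mul _ (by fun_prop)]
      rfl
    simp only [s1]
    have s2 : ∀ r, ∫⁻ t, B X * (A (d 0) (d 1) (d 8) X t * PsiI3 (d 2) (d 3) (d 9) X * A (d 6) (d 7) (d 10) X r) ∂mQ
      = B X * (PsiI3 (d 0) (d 1) (d 8) X * PsiI3 (d 2) (d 3) (d 9) X * A (d 6) (d 7) (d 10) X r) := by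
      intro r
      rw [lintegral_const_mul _ (by fun_prop), lintegral_mul_const _ (by fun_prop), lintegral_mul_const _ (by fun_prop)]
      rfl
    simp only [s2]
    rw [lintegral_const_mul _ (by fun_prop), lintegral_const_mul _ (by fun_prop)]
    rfl
  · refine Measurable.aemeasurable ?_
    refine Measurable.lintegral_prod_right' (f := fun p : (ℝ × ℝ) × ℝ => ∫⁻ s, G p.2 s p.1.1 p.1.2 ∂mQ) ?_
    refine Measurable.lintegral_prod_right' (f := fun p : ((ℝ × ℝ) × ℝ) × ℝ => G p.1.2 p.2 p.1.1.1 p.1.1.2) ?_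
    simp only [G, A, B]; fun_prop

lemma J_good (e : Fin 11 → ℚ) : Good (ProbabilityTheory.mgf (fun o => ∑ i, (e i : ℝ) * jl i o) muJ) ∧
    0 ∈ interior (ProbabilityTheory.integrableExpSet (fun o => ∑ i, (e i : ℝ) * jl i o) muJ) := by
  have hm := jl_meas
  have hpos : ∀ᵐ o ∂muJ, ∀ i, 0 ≤ jl i o := by
    refine (withDensity_absolutelyContinuous _ _).ae_le ?_
    filter_upwards [OQ_ae] with o ho using jl_nonneg ho
  have hint : Integrable (fun o => Real.exp ((1/16) * ∑ i, jl i o)) muJ := (exp_int_iff (by fun_prop)).2 J_fin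
  refine ⟨mgf_good hm hpos (by norm_num) hint (fun d hd => ?_) e, expset_of_pos hm hpos (by norm_num) hint _⟩
  rw [J_mon] at hd ⊢
  exact Jmon_mem _ _ _ _ _ _ _ _ _ _ _ hd

lemma ev_pos (q : ℚ) : ∀ᶠ t : ℝ in 𝓝 0, 0 < 1 + t * q := by
  have : Tendsto (fun t : ℝ => 1 + t * q) (𝓝 0) (𝓝 (1 + 0 * q)) := (by fun_prop : Continuous fun t : ℝ => 1 + t * q).tendsto 0
  exact this.eventually (lt_mem_nhds (by simp))

def muI (u v : Fin 4) (ed : Fin 5 → Sym2 (Fin 4)) : Measure (Fin 4 → ℝ) :=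
  (volume.restrict (posOrthant 4)).withDensity fun y => ENNReal.ofReal ((psiI ed (Fin.snoc y 1) * phiI ed u v (Fin.snoc y 1))⁻¹)

def LI (u v : Fin 4) (ed : Fin 5 → Sym2 (Fin 4)) (i : Option (Fin 5)) (y : Fin 4 → ℝ) : ℝ :=
  LL (psiI ed (Fin.snoc y 1)) (phiI ed u v (Fin.snoc y 1)) (Fin.snoc y 1) i

lemma snoc_meas : Measurable fun y : Fin 4 → ℝ => (Fin.snoc y 1 : Fin 5 → ℝ) := by
  refine measurable_pi_lambda _ fun i => ?_
  induction i using Fin.lastCases with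
  | last =>
    have : (fun c : Fin 4 → ℝ => (Fin.snoc c 1 : Fin 5 → ℝ) (Fin.last 4)) = fun _ => (1:ℝ) := by
      funext c; exact Fin.snoc_last (α := fun _ => ℝ) _ _
    rw [this]; exact measurable_const
  | cast i => simp only [Fin.snoc_castSucc]; fun_prop

lemma snoc_pos {y : Fin 4 → ℝ} (hy : y ∈ posOrthant 4) : (Fin.snoc y 1 : Fin 5 → ℝ) ∈ posOrthant 5 := by
  rw [mem_posOrthant] at hy ⊢
  intro i
  induction i using Fin.lastCases with
  | last =>
    have : (Fin.snoc y 1 : Fin 5 → ℝ) (Fin.last 4) = 1 := Fin.snoc_last (α := fun _ => ℝ) _ _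
    rw [this]; exact one_pos
  | cast i => simpa only [Fin.snoc_castSucc] using hy i

section
variable {u v : Fin 4} {ed : Fin 5 → Sym2 (Fin 4)} {π : Equiv.Perm (Fin 5)}
    (hπ : ∀ x : Fin 5 → ℝ, psiI ed x = psiv (x ∘ π) ∧ phiI ed u v x = phiv (x ∘ π))

lemma comp_meas (π : Equiv.Perm (Fin 5)) : Measurable fun x : Fin 5 → ℝ => x ∘ π :=
  measurable_pi_lambda _ fun i => measurable_pi_apply _

lemma P_meas (hπ : ∀ x : Fin 5 → ℝ, psiI ed x = psiv (x ∘ π) ∧ phiI ed u v x = phiv (x ∘ π)) :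
    Measurable fun y : Fin 4 → ℝ => psiI ed (Fin.snoc y 1) := by
  simp only [(hπ _).1]
  exact psiv_meas.comp ((comp_meas π).comp snoc_meas)

lemma Q_meas (hπ : ∀ x : Fin 5 → ℝ, psiI ed x = psiv (x ∘ π) ∧ phiI ed u v x = phiv (x ∘ π)) :
    Measurable fun y : Fin 4 → ℝ => phiI ed u v (Fin.snoc y 1) := by
  simp only [(hπ _).2]
  exact phiv_meas.comp ((comp_meas π).comp snoc_meas)

lemma PQ_pos (hπ : ∀ x : Fin 5 → ℝ, psiI ed x = psiv (x ∘ π) ∧ phiI ed u v x = phiv (x ∘ π))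
    {y : Fin 4 → ℝ} (hy : y ∈ posOrthant 4) : 0 < psiI ed (Fin.snoc y 1) ∧ 0 < phiI ed u v (Fin.snoc y 1) := by
  have h := mem_posOrthant.1 (snoc_pos hy)
  have h2 : (Fin.snoc y 1 : Fin 5 → ℝ) ∘ π ∈ posOrthant 5 := mem_posOrthant.2 fun i => h _
  rw [(hπ _).1, (hπ _).2]
  exact ⟨psiv_pos h2, phiv_pos h2⟩

lemma LI_meas (hπ : ∀ x : Fin 5 → ℝ, psiI ed x = psiv (x ∘ π) ∧ phiI ed u v x = phiv (x ∘ π))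
    (i : Option (Fin 5)) : Measurable (LI u v ed i) := by
  have h1 := P_meas hπ
  have h2 := Q_meas hπ
  have h3 := snoc_meas
  cases i with
  | none => exact Real.measurable_log.comp ((h1.pow_const 3).div (h2.pow_const 2))
  | some i => exact Real.measurable_log.comp ((((measurable_pi_apply i).comp h3).mul h1).div h2)

lemma I_lint (hπ : ∀ x : Fin 5 → ℝ, psiI ed x = psiv (x ∘ π) ∧ phiI ed u v x = phiv (x ∘ π)) (l : Option (Fin 5) → ℝ) :
    ∫⁻ y, ENNReal.ofReal (Real.exp (∑ i, l i * LI u v ed i y)) ∂(muI u v ed) =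
      Iint (l (some (π 0))) (l (some (π 2))) (l (some (π 1))) (l (some (π 3)))
        (3 * l none + ∑ i, l (some i)) (-2 * l none - ∑ i, l (some i)) := by
  have h1 := P_meas hπ
  have h2 := Q_meas hπ
  have h3 := LI_meas hπ
  rw [← I_main u v ed π hπ l, muI, lintegral_withDensity_eq_lintegral_mul _ (by fun_prop) (by fun_prop)]
  refine lintegral_congr fun y => ?_
  rw [Pi.mul_apply, ENNReal.ofReal_mul (Real.exp_pos _).le, mul_comm]
  rfl

open ProbabilityTheory in
lemma I_mom (hπ : ∀ x : Fin 5 → ℝ, psiI ed x = psiv (x ∘ π) ∧ phiI ed u v x = phiv (x ∘ π)) (l : Option (Fin 5) → ℚ) (n : ℕ) :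
    Integrable (fun y => (∑ i, (l i : ℝ) * LI u v ed i y) ^ n) (muI u v ed) ∧
      ∫ y, (∑ i, (l i : ℝ) * LI u v ed i y) ^ n ∂(muI u v ed) ∈ Zs := by
  have hLm := LI_meas hπ
  have hjm := jl_meas
  obtain ⟨c1, hc1⟩ : ∃ c, c = l (some (π 0)) := ⟨_, rfl⟩
  obtain ⟨c2, hc2⟩ : ∃ c, c = l (some (π 2)) := ⟨_, rfl⟩
  obtain ⟨c3, hc3⟩ : ∃ c, c = l (some (π 1)) := ⟨_, rfl⟩
  obtain ⟨c4, hc4⟩ : ∃ c, c = l (some (π 3)) := ⟨_, rfl⟩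
  obtain ⟨a, ha⟩ : ∃ c, c = 3 * l none + ∑ i, l (some i) := ⟨_, rfl⟩
  obtain ⟨b, hb⟩ : ∃ c, c = -2 * l none - ∑ i, l (some i) := ⟨_, rfl⟩
  obtain ⟨w, hw⟩ : ∃ c, c = -c2 - c4 - b := ⟨_, rfl⟩
  obtain ⟨h, hh⟩ : ∃ c, c = -a - 2 * b - c1 - c3 := ⟨_, rfl⟩
  obtain ⟨a', ha'⟩ : ∃ c, c = c3 + c4 + b := ⟨_, rfl⟩
  obtain ⟨b', hb'⟩ : ∃ c, c = c1 + c2 + b := ⟨_, rfl⟩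
  let e : Fin 11 → ℚ := ![-c2, -(-c2-a-b), -c4, -(-c4-a-b), a + b, w, a, b, a', b', h]
  have hI : ∀ t : ℝ, ∫⁻ y, ENNReal.ofReal (Real.exp (t * ∑ i, (l i : ℝ) * LI u v ed i y)) ∂(muI u v ed) =
      Iint (t * c1) (t * c2) (t * c3) (t * c4) (t * a) (t * b) := by
    intro t
    have := I_lint hπ (fun i => t * l i)
    rw [hc1, hc2, hc3, hc4, ha, hb]
    push_cast
    simp only [mul_sum, mul_assoc, mul_add, mul_sub] at this ⊢
    rw [this]
    congr 1 <;> ring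
  have hJ : ∀ t : ℝ, ∫⁻ o, ENNReal.ofReal (Real.exp (t * ∑ i, (e i : ℝ) * jl i o)) ∂muJ =
      Jint (t * c2) (-(t * c2) - t * a - t * b) (t * c4) (-(t * c4) - t * a - t * b) (t * w) (t * a) (t * b) (t * a') (t * b') (t * h) := by
    intro t
    rw [← J_val]
    refine lintegral_congr fun o => ?_
    congr 2
    simp only [Fin.sum_univ_succ, Fin.sum_univ_zero, e]
    simp
    ring
  obtain ⟨hJg, hJi⟩ := J_good e
  have hJe : ∀ᶠ t : ℝ in 𝓝 0, t ∈ integrableExpSet (fun o => ∑ i, (e i : ℝ) * jl i o) muJ :=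
    mem_interior_iff_mem_nhds.1 hJi
  have main : ∀ᶠ t : ℝ in 𝓝 0, t ∈ integrableExpSet (fun y => ∑ i, (l i : ℝ) * LI u v ed i y) (muI u v ed) ∧
      mgf (fun y => ∑ i, (l i : ℝ) * LI u v ed i y) (muI u v ed) t * DD (-w) (-a) (-b) t =
      mgf (fun o => ∑ i, (e i : ℝ) * jl i o) muJ t * DD a' b' h t := by
    filter_upwards [hJe, ev_pos (-w), ev_pos (-a), ev_pos (-b), ev_pos a', ev_pos b', ev_pos h] with t hJt pw pa pb pa' pb' ph
    rw [DD_val _ _ _ _ pw pa pb, DD_val _ _ _ _ pa' pb' ph, mgf_lint (by fun_prop), mgf_lint (by fun_prop)]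
    have hJt' : ∫⁻ o, ENNReal.ofReal (Real.exp (t * ∑ i, (e i : ℝ) * jl i o)) ∂muJ ≠ ⊤ :=
      (exp_int_iff (X := fun o => t * ∑ i, (e i : ℝ) * jl i o) (by fun_prop)).1 hJt
    have hset : t ∈ integrableExpSet (fun y => ∑ i, (l i : ℝ) * LI u v ed i y) (muI u v ed) ↔
        ∫⁻ y, ENNReal.ofReal (Real.exp (t * ∑ i, (l i : ℝ) * LI u v ed i y)) ∂(muI u v ed) ≠ ⊤ :=
      exp_int_iff (X := fun y => t * ∑ i, (l i : ℝ) * LI u v ed i y) (by fun_prop)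
    rw [hset, hI, hJ]
    rw [hJ] at hJt'
    have K := key_id (t * c1) (t * c2) (t * c3) (t * c4) (t * a) (t * b) (t * w) (t * h) (t * a') (t * b')
      (by rw [hw]; push_cast; ring) (by rw [hh]; push_cast; ring) (by rw [ha']; push_cast; ring) (by rw [hb']; push_cast; ring)
      (by push_cast at pw; linarith) (by push_cast at pa; linarith) (by push_cast at pb; linarith)
      (by linarith) (by linarith) (by linarith)
    have g1 : 0 < Real.Gamma (1 - t * w) := Real.Gamma_pos_of_pos (by push_cast at pw; linarith)
    have g2 : 0 < Real.Gamma (1 - t * a) := Real.Gamma_pos_of_pos (by push_cast at pa; linarith)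
    have g3 : 0 < Real.Gamma (1 - t * b) := Real.Gamma_pos_of_pos (by push_cast at pb; linarith)
    have g4 : 0 < Real.Gamma (1 + t * a') := Real.Gamma_pos_of_pos pa'
    have g5 : 0 < Real.Gamma (1 + t * b') := Real.Gamma_pos_of_pos pb'
    have g6 : 0 < Real.Gamma (1 + t * h) := Real.Gamma_pos_of_pos ph
    rw [← ENNReal.ofReal_mul g1.le, ← ENNReal.ofReal_mul (by positivity), ← ENNReal.ofReal_mul g4.le, ← ENNReal.ofReal_mul (by positivity)] at K
    refine ⟨fun hcon => ?_, ?_⟩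
    · rw [hcon, ENNReal.mul_top (by simp; positivity)] at K
      exact ENNReal.mul_ne_top ENNReal.ofReal_ne_top hJt' K.symm
    · have K2 := congrArg ENNReal.toReal K
      rw [ENNReal.toReal_mul, ENNReal.toReal_mul, ENNReal.toReal_ofReal (by positivity), ENNReal.toReal_ofReal (by positivity)] at K2
      have hs : ((-w : ℚ) : ℝ) + ((-a : ℚ) : ℝ) + ((-b : ℚ) : ℝ) = a' + b' + h := by
        rw [hw, ha', hb', hh]; push_cast; ring
      rw [hs]
      push_cast
      simp only [mul_neg, ← sub_eq_add_neg]
      rw [← mul_div_assoc, ← mul_div_assoc, mul_comm, K2, mul_comm]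
  have h0 : 0 ∈ interior (integrableExpSet (fun y => ∑ i, (l i : ℝ) * LI u v ed i y) (muI u v ed)) := by
    rw [mem_interior_iff_mem_nhds]
    exact main.mono fun t ht => ht.1
  refine ⟨integrable_pow_of_mem_interior_integrableExpSet h0 n, ?_⟩
  have := Good.div (analyticAt_mgf h0) (DD_good (-w) (-a) (-b)) (hJg.mul (DD_good a' b' h)) (main.mono fun t ht => ht.2) (DD_zero _ _ _) n
  rwa [iteratedDeriv_mgf_zero h0] at this

end
/-- Theorem 1 of the paper for the two-loop propagator `F = K₄ - e₀`: every
coefficient integral `∫_{(0,∞)^4} (ψφ)⁻¹ lnᵏ(ψ³/φ²) ∏ᵢ ln^{kᵢ}(αᵢψ/φ)` in the chart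
`α₅ = 1` is absolutely convergent and is a rational linear combination of `1` and
multiple zeta values. -/
theorem statement6 (u v : Fin 4) (he0 : s(u, v) ∈ (⊤ : SimpleGraph (Fin 4)).edgeSet)
    (ed : Fin 5 → Sym2 (Fin 4)) (hinj : Function.Injective ed)
    (hrange : Set.range ed = ((⊤ : SimpleGraph (Fin 4)).deleteEdges {s(u, v)}).edgeSet)
    (k : ℕ) (kk : Fin 5 → ℕ) :
    IntegrableOn (fun y : Fin 4 → ℝ => coeffIntegrand ed u v (-1) (-1) 3 2 k kk y) (posOrthant 4) volume ∧
      (∫ y in posOrthant 4, coeffIntegrand ed u v (-1) (-1) 3 2 k kk y) ∈ Submodule.span ℚ (insert (1 : ℝ) mzvSet) := by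
  obtain ⟨π, hπ0⟩ := graph_main u v he0 ed hrange
  have hπ : ∀ x : Fin 5 → ℝ, psiI ed x = psiv (x ∘ π) ∧ phiI ed u v x = phiv (x ∘ π) := hπ0
  have h1 := P_meas hπ
  have h2 := Q_meas hπ
  have H := mon_of_lin (LI_meas hπ) (I_mom hπ) (fun i => Option.elim i k kk)
  rw [muI, integrable_withDensity_iff_integrable_smul' (by fun_prop) (.of_forall fun _ => ENNReal.ofReal_lt_top),
    integral_withDensity_eq_integral_toReal_smul (by fun_prop) (.of_forall fun _ => ENNReal.ofReal_lt_top)] at H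
  have hae : (fun y : Fin 4 → ℝ => (ENNReal.ofReal ((psiI ed (Fin.snoc y 1) * phiI ed u v (Fin.snoc y 1))⁻¹)).toReal •
      ∏ i, LI u v ed i y ^ (Option.elim i k kk)) =ᵐ[volume.restrict (posOrthant 4)]
      fun y => coeffIntegrand ed u v (-1) (-1) 3 2 k kk y := by
    filter_upwards [ae_restrict_mem (posOrthant_meas 4)] with y hy
    obtain ⟨hp, hq⟩ := PQ_pos hπ hy
    rw [ENNReal.toReal_ofReal (by positivity), Fintype.prod_option, smul_eq_mul, mul_inv, ← mul_assoc]
    simp only [coeffIntegrand, zpow_neg_one]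
    rfl
  rw [integrable_congr hae, integral_congr_ae hae] at H
  exact H
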